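/- For every 𝒦 > 1 there exists a constant M > 1 with the following property. For every A ∈ ℝ^{2×2}, b ∈ ℝ², α ∈ [0,1), δ ∈ (0,1) and every regular domain Ω ⊂ ℝ² there exists a piecewise affine map u ∈ W^{1,1}(Ω;ℝ²) ∩ C^α(closure(Ω);ℝ²) such that: u = l_{A,b} on ∂Ω; ‖u − l_{A,b}‖_{C^α(closure(Ω))} < δ; ∇u(x) ∈ E_𝒦 ∪ E_{1/𝒦} for almost every x ∈ Ω; and for every t > 1 + |A|, M^{−1}(1+|A|^{q_𝒦}) t^{−q_𝒦} ≤ |{x ∈ Ω : |∇u(x)| > t}|/|Ω| ≤ M(1+|A|^{q_𝒦}) t^{−q_𝒦}, where q_𝒦 := 2𝒦/(𝒦+1). In particular u ∈ W^{1,p}(Ω) for every p < q_𝒦, while ∫_Ω |∇u|^{q_𝒦} dx = ∞. -/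

import Mathlib

open MeasureTheory Set Filter Topology

noncomputable section

namespace Paper

variable {ι κ : Type*}

/-- Frobenius (Hilbert–Schmidt) norm of a matrix. -/
def frobNorm [Fintype ι] [Fintype κ] (A : Matrix κ ι ℝ) : ℝ :=
  Real.sqrt (∑ k, ∑ i, (A k i) ^ 2)

/-- Frobenius distance from a matrix to a set of matrices. -/
def frobDist [Fintype ι] [Fintype κ] (X : Matrix κ ι ℝ) (S : Set (Matrix κ ι ℝ)) : ℝ :=
  sInf ((fun Y => frobNorm (X - Y)) '' S)

/-- The affine map `x ↦ A x + b`. -/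
def lmap [Fintype ι] (A : Matrix κ ι ℝ) (b : κ → ℝ) (x : ι → ℝ) : κ → ℝ :=
  fun k => (∑ i, A k i * x i) + b k

/-- A regular domain: open, bounded, connected, with Lebesgue-null boundary. -/
def IsRegularDomain [Fintype ι] (Ω : Set (ι → ℝ)) : Prop :=
  IsOpen Ω ∧ Bornology.IsBounded Ω ∧ IsConnected Ω ∧ volume (frontier Ω) = 0

/-- `u` agrees with an affine map on `S`. -/
def IsAffineOn [Fintype ι] (u : (ι → ℝ) → κ → ℝ) (S : Set (ι → ℝ)) : Prop :=
  ∃ (B : Matrix κ ι ℝ) (c : κ → ℝ), ∀ x ∈ S, u x = lmap B c x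

/-- `u` is piecewise affine on `Ω`. -/
def IsPiecewiseAffineOn [Fintype ι] (u : (ι → ℝ) → κ → ℝ) (Ω : Set (ι → ℝ)) : Prop :=
  ∃ 𝒮 : Set (Set (ι → ℝ)), 𝒮.Countable ∧
    (∀ V ∈ 𝒮, IsRegularDomain V ∧ V ⊆ Ω ∧ IsAffineOn u V) ∧
    𝒮.PairwiseDisjoint id ∧ volume (Ω \ ⋃₀ 𝒮) = 0

/-- `G` is the weak (distributional) gradient of `u` on `Ω`, and `u ∈ W^{1,1}(Ω)`. -/
structure HasWeakGradientOn [Fintype ι] [DecidableEq ι] [Fintype κ]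
    (u : (ι → ℝ) → κ → ℝ) (G : (ι → ℝ) → Matrix κ ι ℝ) (Ω : Set (ι → ℝ)) : Prop where
  integrable : IntegrableOn u Ω volume
  integrable_grad : ∀ (k : κ) (i : ι), IntegrableOn (fun x => G x k i) Ω volume
  parts : ∀ φ : (ι → ℝ) → ℝ, (∀ n : ℕ, ContDiff ℝ n φ) → HasCompactSupport φ →
    tsupport φ ⊆ Ω → ∀ (k : κ) (i : ι),
      ∫ x in Ω, u x k * fderiv ℝ φ x (Pi.single i 1) = - ∫ x in Ω, G x k i * φ x

/-- Membership in `C^α(S)`: continuous on `S` and (for `α > 0`) `α`-Hölder on `S`. -/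
def MemHolder [Fintype ι] [Fintype κ] (α : ℝ) (S : Set (ι → ℝ)) (u : (ι → ℝ) → κ → ℝ) : Prop :=
  ContinuousOn u S ∧ ∃ C : ℝ, ∀ x ∈ S, ∀ y ∈ S, dist (u x) (u y) ≤ C * dist x y ^ α

/-- The `C^α` norm on `S`. -/
def holderNorm [Fintype ι] [Fintype κ] (α : ℝ) (S : Set (ι → ℝ)) (u : (ι → ℝ) → κ → ℝ) : ℝ :=
  sSup ((fun x => ‖u x‖) '' S) +
    sSup {r : ℝ | ∃ x ∈ S, ∃ y ∈ S, x ≠ y ∧ r = dist (u x) (u y) / dist x y ^ α}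

/-- `K` can be reduced to `K'` in weak `L^p`, with constant `M`. -/
def ReducesWith [Fintype ι] [DecidableEq ι] [Fintype κ] (M : ℝ)
    (K K' : Set (Matrix κ ι ℝ)) (p : ℝ) : Prop :=
  ∀ A ∈ K, ∀ b : κ → ℝ, ∀ ε ∈ Set.Ioo (0:ℝ) 1, ∀ α ∈ Set.Ioo (0:ℝ) 1, ∀ s ∈ Set.Ioi (1:ℝ),
    ∀ Ω : Set (ι → ℝ), IsRegularDomain Ω →
      ∃ (u : (ι → ℝ) → κ → ℝ) (G : (ι → ℝ) → Matrix κ ι ℝ),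
        IsPiecewiseAffineOn u Ω ∧ HasWeakGradientOn u G Ω ∧ MemHolder α (closure Ω) u ∧
        (∀ x ∈ frontier Ω, u x = lmap A b x) ∧
        (∫ x in {x ∈ Ω | G x ∉ K'}, (1 + frobNorm (G x)) ^ s) < ε * (volume Ω).toReal ∧
        ∀ t : ℝ, 0 < t →
          volume {x ∈ Ω | t < frobNorm (G x)}
            ≤ ENNReal.ofReal (M ^ p * (1 + frobNorm A ^ p) * t ^ (-p)) * volume Ω

/-- `K` can be reduced to `K'` in weak `L^p`. -/
def ReducedTo [Fintype ι] [DecidableEq ι] [Fintype κ]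
    (K K' : Set (Matrix κ ι ℝ)) (p : ℝ) : Prop :=
  ∃ M : ℝ, 1 ≤ M ∧ ReducesWith M K K' p

/-- The special orthogonal group `SO(2)` as a set of `2×2` matrices. -/
def SO2 : Set (Matrix (Fin 2) (Fin 2) ℝ) := {R | R.transpose * R = 1 ∧ R.det = 1}

/-- The set `E_ρ = {diag(λ, ρλ) R : λ ≥ 0, R ∈ SO(2)}`. -/
def Eset (ρ : ℝ) : Set (Matrix (Fin 2) (Fin 2) ℝ) :=
  {X | ∃ lam : ℝ, 0 ≤ lam ∧ ∃ R ∈ SO2, X = Matrix.diagonal ![lam, ρ * lam] * R}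

/-- The plane `ℝ²`, with the sup norm. -/
abbrev Plane := Fin 2 → ℝ

/-- The affine function `x ↦ a ⬝ᵥ x + b`. -/
def aff (a : Plane) (b : ℝ) (x : Plane) : ℝ := a ⬝ᵥ x + b

lemma aff_def (a : Plane) (b : ℝ) (x : Plane) : aff a b x = a 0 * x 0 + a 1 * x 1 + b := by
  simp [aff, dotProduct, Fin.sum_univ_two]

lemma continuous_aff (a : Plane) (b : ℝ) : Continuous (aff a b) := by
  have : aff a b = fun x => a 0 * x 0 + a 1 * x 1 + b := funext (aff_def a b)
  rw [this]; fun_prop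

lemma aff_sub (a : Plane) (b : ℝ) (x y : Plane) : |aff a b x - aff a b y| ≤
    2 * ‖a‖ * dist x y := by
  have h0 : |x 0 - y 0| ≤ dist x y := by
    rw [← Real.dist_eq]; exact dist_le_pi_dist x y 0
  have h1 : |x 1 - y 1| ≤ dist x y := by
    rw [← Real.dist_eq]; exact dist_le_pi_dist x y 1
  have e0 : |a 0| ≤ ‖a‖ := norm_le_pi_norm a 0
  have e1 : |a 1| ≤ ‖a‖ := norm_le_pi_norm a 1
  have : aff a b x - aff a b y = a 0 * (x 0 - y 0) + a 1 * (x 1 - y 1) := by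
    simp only [aff_def]; ring
  rw [this]
  calc _ ≤ |a 0 * (x 0 - y 0)| + |a 1 * (x 1 - y 1)| := abs_add_le _ _
    _ = |a 0| * |x 0 - y 0| + |a 1| * |x 1 - y 1| := by simp only [abs_mul]
    _ ≤ ‖a‖ * dist x y + ‖a‖ * dist x y := by gcongr
    _ = _ := by ring

lemma aff_comb (a : Plane) (b s t : ℝ) (hst : s + t = 1) (x y : Plane) :
    aff a b (s • x + t • y) = s * aff a b x + t * aff a b y := by
  simp only [aff_def, Pi.add_apply, Pi.smul_apply, smul_eq_mul]
  linear_combination (-b) * hst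

lemma convex_aff_pos (a : Plane) (b : ℝ) : Convex ℝ {x | 0 < aff a b x} := by
  intro x hx y hy s t hs ht hst
  simp only [mem_ofPred_eq] at *
  rw [aff_comb a b s t hst]
  rcases hs.eq_or_lt with h | h
  · have : t = 1 := by linarith
    subst this; rw [← h]; simpa using hy
  · have := mul_pos h hx
    have := mul_nonneg ht hy.le
    linarith

lemma aff_sub_aff (a a' : Plane) (b b' : ℝ) (x : Plane) :
    aff (a - a') (b - b') x = aff a b x - aff a' b' x := by
  simp only [aff_def, Pi.sub_apply]; ring

lemma volume_aff_eq_zero {a : Plane} (ha : a ≠ 0) (b : ℝ) :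
    volume {x | aff a b x = 0} = 0 := by
  let s : AffineSubspace ℝ Plane :=
    { carrier := {x | aff a b x = 0}
      smul_vsub_vadd_mem' := by
        intro c p q r hp hq hr
        simp only [mem_ofPred_eq, aff_def, vsub_eq_sub, vadd_eq_add, Pi.add_apply, Pi.smul_apply,
          smul_eq_mul, Pi.sub_apply] at *
        linear_combination c * hp - c * hq + hr }
  refine Measure.addHaar_affineSubspace volume s ?_
  intro h
  have h0 : ∀ x : Plane, aff a b x = 0 := by
    intro x
    have : x ∈ s := by rw [h]; trivial
    exact this
  have e := h0 0
  have e1 := h0 a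
  simp only [aff_def, Pi.zero_apply] at e e1
  have h2 : a 0 * a 0 + a 1 * a 1 = 0 := by linarith
  have a0 : a 0 = 0 := by nlinarith [mul_self_nonneg (a 0), mul_self_nonneg (a 1)]
  have a1 : a 1 = 0 := by nlinarith [mul_self_nonneg (a 0), mul_self_nonneg (a 1)]
  apply ha; ext i; fin_cases i <;> simp [a0, a1]

section roof

/-- The positive part of the minimum of finitely many affine functions. -/
def roof (a : Fin 4 → Plane) (b : Fin 4 → ℝ) (x : Plane) : ℝ :=
  max 0 (Finset.univ.inf' Finset.univ_nonempty fun j => aff (a j) (b j) x)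

/-- The polygon on which `roof a b` is positive. -/
def roofBase (a : Fin 4 → Plane) (b : Fin 4 → ℝ) : Set Plane := {x | ∀ j, 0 < aff (a j) (b j) x}

/-- The face of the roof on which the `j`-th affine function is the smallest one. -/
def roofCell (a : Fin 4 → Plane) (b : Fin 4 → ℝ) (j : Fin 4) : Set Plane :=
  {x | 0 < aff (a j) (b j) x ∧ ∀ k, k ≠ j → aff (a j) (b j) x < aff (a k) (b k) x}

/-- The gradient of `roof a b`. -/
def roofGrad (a : Fin 4 → Plane) (b : Fin 4 → ℝ) (x : Plane) : Plane :=
  ∑ j, (roofCell a b j).indicator (fun _ => a j) x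

variable (a : Fin 4 → Plane) (b : Fin 4 → ℝ)

lemma roof_nonneg (x : Plane) : 0 ≤ roof a b x := le_max_left _ _

lemma roof_le (j : Fin 4) (x : Plane) : roof a b x ≤ max 0 (aff (a j) (b j) x) :=
  max_le_max le_rfl (Finset.inf'_le _ (Finset.mem_univ j))

lemma roof_eq_zero {x : Plane} (hx : x ∉ roofBase a b) : roof a b x = 0 := by
  simp only [roofBase, mem_ofPred_eq, not_forall, not_lt] at hx
  obtain ⟨j, hj⟩ := hx
  exact le_antisymm ((roof_le a b j x).trans (max_le le_rfl hj)) (roof_nonneg a b x)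

lemma roof_eq_of_mem {x : Plane} {j : Fin 4} (hx : x ∈ roofCell a b j) :
    roof a b x = aff (a j) (b j) x := by
  apply le_antisymm
  · exact (roof_le a b j x).trans (max_le hx.1.le le_rfl)
  · refine le_max_of_le_right (Finset.le_inf' _ _ fun k _ => ?_)
    rcases eq_or_ne k j with rfl | h
    · exact le_rfl
    · exact (hx.2 k h).le

lemma roof_le_add {K : ℝ} (hK : ∀ j, 2 * ‖a j‖ ≤ K) (x y : Plane) :
    roof a b x ≤ roof a b y + K * dist x y := by
  obtain ⟨j, -, hj⟩ := Finset.exists_mem_eq_inf' (s := Finset.univ) Finset.univ_nonempty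
    (fun j => aff (a j) (b j) y)
  have h1 : aff (a j) (b j) x ≤ aff (a j) (b j) y + K * dist x y := by
    have := (abs_le.1 (aff_sub (a j) (b j) x y)).2
    have := mul_le_mul_of_nonneg_right (hK j) (dist_nonneg (x := x) (y := y))
    linarith
  have hK0 : 0 ≤ K * dist x y :=
    mul_nonneg ((by positivity : 0 ≤ 2 * ‖a j‖).trans (hK j)) dist_nonneg
  have h2 : roof a b y = max 0 (aff (a j) (b j) y) := by rw [roof, hj]
  rw [h2]
  refine (roof_le a b j x).trans (max_le ?_ ?_)
  · have := le_max_left 0 (aff (a j) (b j) y); linarith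
  · have := le_max_right 0 (aff (a j) (b j) y); linarith

lemma roof_lipschitz {K : NNReal} (hK : ∀ j, 2 * ‖a j‖ ≤ K) : LipschitzWith K (roof a b) :=
  LipschitzWith.of_le_add_mul K (roof_le_add a b hK)

lemma isOpen_roofBase : IsOpen (roofBase a b) := by
  simp only [roofBase, ofPred_forall]
  exact isOpen_iInter_of_finite fun j => isOpen_lt continuous_const (continuous_aff _ _)

lemma convex_roofBase : Convex ℝ (roofBase a b) := by
  simp only [roofBase, ofPred_forall]
  exact convex_iInter fun j => convex_aff_pos _ _

lemma isOpen_roofCell (j : Fin 4) : IsOpen (roofCell a b j) := by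
  simp only [roofCell, ofPred_and, ofPred_forall]
  refine (isOpen_lt continuous_const (continuous_aff _ _)).inter ?_
  exact isOpen_iInter_of_finite fun k => isOpen_iInter_of_finite fun _ =>
    isOpen_lt (continuous_aff _ _) (continuous_aff _ _)

lemma convex_roofCell (j : Fin 4) : Convex ℝ (roofCell a b j) := by
  simp only [roofCell, ofPred_and, ofPred_forall]
  refine (convex_aff_pos _ _).inter (convex_iInter fun k => convex_iInter fun _ => ?_)
  have := convex_aff_pos (a k - a j) (b k - b j)
  simpa only [aff_sub_aff, sub_pos] using this

lemma roofCell_subset (j : Fin 4) : roofCell a b j ⊆ roofBase a b := by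
  intro x hx k
  rcases eq_or_ne k j with rfl | h
  · exact hx.1
  · exact hx.1.trans (hx.2 k h)

lemma roofCell_disjoint {x : Plane} {i j : Fin 4} (hi : x ∈ roofCell a b i)
    (hj : x ∈ roofCell a b j) : i = j := by
  by_contra h
  exact lt_asymm (hi.2 j (Ne.symm h)) (hj.2 i h)

lemma roofGrad_eq_of_mem {x : Plane} {j : Fin 4} (hx : x ∈ roofCell a b j) :
    roofGrad a b x = a j := by
  classical
  rw [roofGrad, Finset.sum_eq_single j]
  · simp [hx]
  · intro k _ hk
    exact indicator_of_notMem (fun h => hk (roofCell_disjoint a b h hx)) _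
  · simp

lemma roofGrad_eq_zero {x : Plane} (hx : ∀ j, x ∉ roofCell a b j) : roofGrad a b x = 0 :=
  Finset.sum_eq_zero fun j _ => indicator_of_notMem (hx j) _

lemma measurable_roofGrad : Measurable (roofGrad a b) := by
  unfold roofGrad
  exact Finset.measurable_sum _ fun j _ =>
    measurable_const.indicator (isOpen_roofCell a b j).measurableSet

lemma volume_roofBase_diff (ha : Function.Injective a) :
    volume (roofBase a b \ ⋃ j, roofCell a b j) = 0 := by
  have hsub : roofBase a b \ ⋃ j, roofCell a b j ⊆
      ⋃ p : {p : Fin 4 × Fin 4 // p.1 ≠ p.2},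
        {x | aff (a p.1.1 - a p.1.2) (b p.1.1 - b p.1.2) x = 0} := by
    rintro x ⟨hx, hx'⟩
    obtain ⟨j, -, hj⟩ := Finset.exists_mem_eq_inf' (s := Finset.univ) Finset.univ_nonempty
      (fun j => aff (a j) (b j) x)
    have hmin : ∀ k, aff (a j) (b j) x ≤ aff (a k) (b k) x := fun k => by
      rw [← hj]; exact Finset.inf'_le _ (Finset.mem_univ k)
    have : x ∉ roofCell a b j := fun h => hx' (mem_iUnion.2 ⟨j, h⟩)
    simp only [roofCell, mem_ofPred_eq, not_and, not_forall, not_lt] at this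
    obtain ⟨k, hk, hk'⟩ := this (hx j)
    refine mem_iUnion.2 ⟨⟨(k, j), hk⟩, ?_⟩
    simp only [mem_ofPred_eq, aff_sub_aff]
    linarith [hmin k]
  refine measure_mono_null hsub (measure_iUnion_null fun p => ?_)
  exact volume_aff_eq_zero (sub_ne_zero.2 fun h => p.2 (ha h)) _

end roof

/-- `g` is the distributional gradient of `f` on the whole plane. -/
def IsWeakGrad (f : Plane → ℝ) (g : Plane → Plane) : Prop :=
  ∀ φ : Plane → ℝ, (∀ n : ℕ, ContDiff ℝ n φ) → HasCompactSupport φ → ∀ i : Fin 2,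
    ∫ x, f x * fderiv ℝ φ x (Pi.single i 1) = - ∫ x, g x i * φ x

lemma isWeakGrad_of_lipschitz {K : NNReal} {f : Plane → ℝ} (hf : LipschitzWith K f)
    {g : Plane → Plane} (hg : ∀ i, ∀ᵐ x, lineDeriv ℝ f x (Pi.single i 1) = g x i) :
    IsWeakGrad f g := by
  intro φ hφ hc i
  have hφ1 : ContDiff ℝ 1 φ := by exact_mod_cast hφ 1
  obtain ⟨D, hD⟩ := hφ1.lipschitzWith_of_hasCompactSupport hc (by simp)
  have h := hf.integral_lineDeriv_mul_eq (μ := volume) hD hc (Pi.single i 1)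
  have e1 : ∫ x, lineDeriv ℝ f x (Pi.single i 1) * φ x = ∫ x, g x i * φ x := by
    apply integral_congr_ae
    filter_upwards [hg i] with x hx
    rw [hx]
  rw [← e1, h, ← integral_neg]
  congr 1; ext x
  rw [(hφ1.differentiable (by simp)).differentiableAt.lineDeriv_eq_fderiv, map_neg]
  ring

lemma lineDeriv_aff (a : Plane) (b : ℝ) (x : Plane) (i : Fin 2) :
    lineDeriv ℝ (aff a b) x (Pi.single i 1) = a i := by
  have : HasLineDerivAt ℝ (aff a b) (a i) x (Pi.single i 1) := by
    have h : (fun t : ℝ => aff a b (x + t • Pi.single i 1)) = fun t => a i * t + aff a b x := by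
      ext t
      simp only [aff, dotProduct_add, dotProduct_smul, dotProduct_single, smul_eq_mul]
      ring
    unfold HasLineDerivAt
    rw [h]
    simpa using ((hasDerivAt_id (0 : ℝ)).const_mul (a i)).add_const (aff a b x)
  exact this.lineDeriv

lemma isWeakGrad_roof (a : Fin 4 → Plane) (b : Fin 4 → ℝ)
    (ha : Function.Injective a) : IsWeakGrad (roof a b) (roofGrad a b) := by
  obtain ⟨K, hK⟩ : ∃ K : NNReal, ∀ j, 2 * ‖a j‖ ≤ K := by
    obtain ⟨K, hK⟩ := Finite.exists_le (fun j => 2 * ‖a j‖)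
    exact ⟨K.toNNReal, fun j => (hK j).trans (Real.le_coe_toNNReal K)⟩
  refine isWeakGrad_of_lipschitz (roof_lipschitz a b hK) fun i => ?_
  have h1 : ∀ᵐ x, x ∉ roofBase a b \ ⋃ j, roofCell a b j := by
    exact measure_eq_zero_iff_ae_notMem.1 (volume_roofBase_diff a b ha)
  have h2 : ∀ᵐ x, x ∉ frontier (roofBase a b) := by
    exact measure_eq_zero_iff_ae_notMem.1 ((convex_roofBase a b).addHaar_frontier volume)
  filter_upwards [h1, h2] with x hx1 hx2
  by_cases hx : x ∈ roofBase a b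
  · obtain ⟨j, hj⟩ : ∃ j, x ∈ roofCell a b j := by
      by_contra hcon
      exact hx1 ⟨hx, by simpa using hcon⟩
    rw [roofGrad_eq_of_mem a b hj, ← lineDeriv_aff (a j) (b j) x i]
    apply Filter.EventuallyEq.lineDeriv_eq
    filter_upwards [(isOpen_roofCell a b j).mem_nhds hj] with y hy
    exact roof_eq_of_mem a b hy
  · have hcl : x ∉ closure (roofBase a b) := by
      intro h
      exact hx2 ⟨h, fun h' => hx (interior_subset h')⟩
    rw [roofGrad_eq_zero a b fun j hj => hx (roofCell_subset a b j hj)]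
    have : lineDeriv ℝ (roof a b) x (Pi.single i 1) =
        lineDeriv ℝ (fun _ => (0 : ℝ)) x (Pi.single i 1) := by
      apply Filter.EventuallyEq.lineDeriv_eq
      filter_upwards [isClosed_closure.isOpen_compl.mem_nhds hcl] with y hy
      exact roof_eq_zero a b fun h => hy (subset_closure h)
    rw [this]
    simp [lineDeriv]

/-- The offsets for which `roofBase a` is the image of `roofBase a b` under `x ↦ c + r x`, where
`z = (c, r)`. -/
def shift (a : Fin 4 → Plane) (b : Fin 4 → ℝ) (z : Plane × ℝ) (j : Fin 4) : ℝ :=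
  z.2 * b j - a j ⬝ᵥ z.1

section packing

variable (a : Fin 4 → Plane) (b : Fin 4 → ℝ)

lemma aff_shift {z : Plane × ℝ} (hz : 0 < z.2) (j : Fin 4) (x : Plane) :
    aff (a j) (shift a b z j) x = z.2 * aff (a j) (b j) (z.2⁻¹ • (x - z.1)) := by
  simp only [aff, shift, dotProduct_smul, dotProduct_sub, smul_eq_mul]
  field_simp
  ring

lemma roofBase_shift {z : Plane × ℝ} (hz : 0 < z.2) :
    roofBase a (shift a b z) = (fun x => z.2⁻¹ • (x - z.1)) ⁻¹' roofBase a b := by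
  ext x
  simp only [roofBase, mem_ofPred_eq, mem_preimage, aff_shift a b hz, mul_pos_iff_of_pos_left hz]

lemma roofCell_shift {z : Plane × ℝ} (hz : 0 < z.2) (j : Fin 4) :
    roofCell a (shift a b z) j = (fun x => z.2⁻¹ • (x - z.1)) ⁻¹' roofCell a b j := by
  ext x
  simp only [roofCell, mem_ofPred_eq, mem_preimage, aff_shift a b hz, mul_pos_iff_of_pos_left hz,
    mul_lt_mul_iff_right₀ hz]

lemma volume_preimage_rescale {z : Plane × ℝ} (hz : 0 < z.2) (S : Set Plane) :
    volume ((fun x => z.2⁻¹ • (x - z.1)) ⁻¹' S) = ENNReal.ofReal (z.2 ^ 2) * volume S := by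
  have h : (fun x : Plane => z.2⁻¹ • (x - z.1)) ⁻¹' S =
      (fun x => x + -z.1) ⁻¹' ((fun x => z.2⁻¹ • x) ⁻¹' S) := by
    ext x; simp [sub_eq_add_neg]
  rw [h, measure_preimage_add_right, Measure.addHaar_preimage_smul _ (by positivity)]
  congr 2
  simp [abs_of_pos hz]

variable {a b}

lemma exists_packing {ρ : ℝ} (hρ : 0 < ρ) (hb : roofBase a b ⊆ Metric.closedBall 0 ρ)
    (hne : (roofBase a b).Nonempty) {V : Set Plane} (hV : IsOpen V) {r₀ : ℝ} (hr₀ : 0 < r₀) :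
    ∃ u : Set (Plane × ℝ), u.Countable ∧
      (∀ z ∈ u, 0 < z.2 ∧ z.2 ≤ r₀ ∧ roofBase a (shift a b z) ⊆ V) ∧
      u.PairwiseDisjoint (fun z => roofBase a (shift a b z)) ∧
      volume (V \ ⋃ z ∈ u, roofBase a (shift a b z)) = 0 := by
  have hvol : 0 < volume (roofBase a b) := (isOpen_roofBase a b).measure_pos volume hne
  have hvol' : volume (roofBase a b) < ⊤ :=
    (measure_mono hb).trans_lt (isCompact_closedBall _ _).measure_lt_top
  set m := (volume (roofBase a b)).toReal with hm
  have hm0 : 0 < m := ENNReal.toReal_pos hvol.ne' hvol'.ne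
  have hball : ∀ z : Plane × ℝ, 0 < z.2 →
      closure (roofBase a (shift a b z)) ⊆ Metric.closedBall z.1 (z.2 * ρ) := by
    intro z hz
    refine closure_minimal (fun x hx => ?_) Metric.isClosed_closedBall
    rw [roofBase_shift a b hz] at hx
    have := hb hx
    rw [mem_closedBall_zero_iff, norm_smul, norm_inv, Real.norm_eq_abs, abs_of_pos hz] at this
    rw [mem_closedBall_iff_norm]
    rwa [inv_mul_le_iff₀ hz] at this
  obtain ⟨u, hut, huc, hud, hu⟩ := Vitali.exists_disjoint_covering_ae volume V
    {z : Plane × ℝ | 0 < z.2 ∧ z.2 ≤ r₀ ∧ Metric.closedBall z.1 (z.2 * ρ) ⊆ V}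
    ((36 * ρ ^ 2 / m).toNNReal) (fun z => z.2 * ρ) (fun z => z.1)
    (fun z => closure (roofBase a (shift a b z)))
    (fun z hz => hball z hz.1)
    (by
      rintro z ⟨hz, -, -⟩
      have h1 : volume (Metric.closedBall z.1 (3 * (z.2 * ρ))) =
          ENNReal.ofReal (36 * ρ ^ 2 * z.2 ^ 2) := by
        rw [Real.volume_pi_closedBall _ (by positivity)]
        congr 1
        simp only [Fintype.card_fin]; ring
      have h2 : ENNReal.ofReal (z.2 ^ 2) * ENNReal.ofReal m ≤
          volume (closure (roofBase a (shift a b z))) := by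
        rw [hm, ENNReal.ofReal_toReal hvol'.ne, ← volume_preimage_rescale hz,
          ← roofBase_shift a b hz]
        exact measure_mono subset_closure
      rw [h1]
      refine le_trans (le_of_eq ?_) (mul_le_mul_right h2 _)
      rw [← ENNReal.ofReal, ← ENNReal.ofReal_mul (by positivity),
        ← ENNReal.ofReal_mul (by positivity)]
      congr 1
      field_simp)
    (by
      rintro z ⟨hz, -, -⟩
      obtain ⟨x, hx⟩ := hne
      refine ⟨z.1 + z.2 • x, interior_mono subset_closure ?_⟩
      rw [(isOpen_roofBase _ _).interior_eq, roofBase_shift a b hz]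
      simpa [smul_smul, hz.ne'] using hx)
    (fun z _ => isClosed_closure)
    (by
      intro x hx ε hε
      obtain ⟨δ, hδ, hδV⟩ := Metric.isOpen_iff.1 hV x hx
      set r := min r₀ (min (ε / ρ) (δ / (2 * ρ)))
      have hr : 0 < r := by positivity
      have h1 : r ≤ ε / ρ := (min_le_right _ _).trans (min_le_left _ _)
      have h2 : r ≤ δ / (2 * ρ) := (min_le_right _ _).trans (min_le_right _ _)
      rw [le_div_iff₀ (by positivity)] at h1 h2
      refine ⟨(x, r), ⟨hr, min_le_left _ _, ?_⟩, h1, rfl⟩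
      refine (Metric.closedBall_subset_ball ?_).trans hδV
      simp only; linarith)
  refine ⟨u, huc, fun z hz => ⟨(hut hz).1, (hut hz).2.1, ?_⟩, ?_, ?_⟩
  · exact (subset_closure.trans (hball z (hut hz).1)).trans (hut hz).2.2
  · exact fun i hi j hj hij => (hud hi hj hij).mono subset_closure subset_closure
  · refine measure_mono_null (t := (V \ ⋃ z ∈ u, closure (roofBase a (shift a b z))) ∪
      ⋃ z ∈ u, frontier (roofBase a (shift a b z))) ?_ (measure_union_null hu ?_)
    · rintro x ⟨hxV, hx⟩
      by_cases h : x ∈ ⋃ z ∈ u, closure (roofBase a (shift a b z))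
      · right
        simp only [mem_iUnion, exists_prop] at h hx ⊢
        obtain ⟨z, hz, hxz⟩ := h
        exact ⟨z, hz, hxz, fun h' => hx ⟨z, hz, interior_subset h'⟩⟩
      · exact Or.inl ⟨hxV, h⟩
    · rw [measure_biUnion_null_iff huc]
      exact fun z _ => (convex_roofBase _ _).addHaar_frontier volume

end packing

/-- The rotation by a right angle. -/
def rot (p : Plane) : Plane := ![-p 1, p 0]

lemma norm_rot (p : Plane) : ‖rot p‖ = ‖p‖ := by
  have h : ∀ q : Plane, ‖q‖ = max |q 0| |q 1| := by
    intro q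
    apply le_antisymm
    · rw [pi_norm_le_iff_of_nonneg (by positivity)]
      intro i; fin_cases i
      · exact le_max_left _ _
      · exact le_max_right _ _
    · exact max_le (norm_le_pi_norm q 0) (norm_le_pi_norm q 1)
  rw [h, h, rot]
  simp [max_comm]

/-- The gradients of the faces of a hip roof over a long rectangle: two opposite main faces, and
two small faces closing the ends. -/
def hipGrad (p : Plane) (lam η : ℝ) : Fin 4 → Plane :=
  ![(1 - lam) • p, -(lam • p), -(η • rot p), η • rot p]

/-- The offsets of the faces of a hip roof. -/
def hipOff (lam η l : ℝ) : Fin 4 → ℝ := ![0, lam, η * l, η * l]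

lemma dot_self_pos {p : Plane} (hp : p ≠ 0) : 0 < p 0 ^ 2 + p 1 ^ 2 := by
  by_contra h
  have h0 : p 0 = 0 := by nlinarith [sq_nonneg (p 0), sq_nonneg (p 1)]
  have h1 : p 1 = 0 := by nlinarith [sq_nonneg (p 0), sq_nonneg (p 1)]
  apply hp; ext i; fin_cases i <;> simp [h0, h1]

lemma injective_hipGrad {p : Plane} (hp : p ≠ 0) {lam η : ℝ} (h0 : 0 < lam) (h1 : lam < 1)
    (hη : 0 < η) : Function.Injective (hipGrad p lam η) := by
  have hd := dot_self_pos hp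
  obtain ⟨A, hA⟩ : ∃ A, A = (1 - lam) * (p 0 ^ 2 + p 1 ^ 2) := ⟨_, rfl⟩
  obtain ⟨B, hB⟩ : ∃ B, B = lam * (p 0 ^ 2 + p 1 ^ 2) := ⟨_, rfl⟩
  obtain ⟨C, hC⟩ : ∃ C, C = η * (p 0 ^ 2 + p 1 ^ 2) := ⟨_, rfl⟩
  have hA0 : 0 < A := hA ▸ mul_pos (by linarith) hd
  have hB0 : 0 < B := hB ▸ mul_pos h0 hd
  have hC0 : 0 < C := hC ▸ mul_pos hη hd
  have e1 : ∀ j, hipGrad p lam η j 0 * p 0 + hipGrad p lam η j 1 * p 1 = ![A, -B, 0, 0] j := by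
    intro j; fin_cases j <;> simp [hipGrad, rot, hA, hB] <;> ring
  have e2 : ∀ j, hipGrad p lam η j 1 * p 0 - hipGrad p lam η j 0 * p 1 = ![0, 0, -C, C] j := by
    intro j; fin_cases j <;> simp [hipGrad, rot, hC] <;> ring
  intro i j hij
  have f1 := e1 i
  have f2 := e2 i
  rw [hij, e1 j] at f1
  rw [hij, e2 j] at f2
  fin_cases i <;> fin_cases j <;> first | rfl | (exfalso; simp at f1 f2; linarith)

/-- The coordinates `(p ⬝ᵥ x, rot p ⬝ᵥ x)` as a linear map. -/
def frameMap (p : Plane) : Plane →ₗ[ℝ] Plane := Matrix.toLin' !![p 0, p 1; -p 1, p 0]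

lemma frameMap_zero (p x : Plane) : frameMap p x 0 = p 0 * x 0 + p 1 * x 1 := by
  simp [frameMap, Matrix.mulVec, dotProduct, Fin.sum_univ_two]

lemma frameMap_one (p x : Plane) : frameMap p x 1 = -p 1 * x 0 + p 0 * x 1 := by
  simp [frameMap, Matrix.mulVec, dotProduct, Fin.sum_univ_two]

lemma det_frameMap (p : Plane) : LinearMap.det (frameMap p) = p 0 ^ 2 + p 1 ^ 2 := by
  rw [frameMap, LinearMap.det_toLin', Matrix.det_fin_two]
  simp; ring

/-- An open box in the coordinates given by `frameMap p`. -/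
def box (p : Plane) (s₀ s₁ l : ℝ) : Set Plane :=
  {x | (s₀ < frameMap p x 0 ∧ frameMap p x 0 < s₁) ∧ (-l < frameMap p x 1 ∧ frameMap p x 1 < l)}

lemma volume_box {p : Plane} (hp : p ≠ 0) {s₀ s₁ l : ℝ} (hs : s₀ ≤ s₁) :
    volume (box p s₀ s₁ l) =
      ENNReal.ofReal ((p 0 ^ 2 + p 1 ^ 2)⁻¹) * ENNReal.ofReal ((s₁ - s₀) * (2 * l)) := by
  have h : box p s₀ s₁ l =
      frameMap p ⁻¹' (Set.pi univ fun i => Ioo (![s₀, -l] i) (![s₁, l] i)) := by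
    ext x
    simp [box, Set.mem_pi, Fin.forall_fin_two]
  have hd := dot_self_pos hp
  rw [h, Measure.addHaar_preimage_linearMap volume (by rw [det_frameMap]; exact hd.ne'),
    det_frameMap, Real.volume_pi_Ioo, abs_of_pos (by positivity)]
  congr 1
  have e : l - -l = 2 * l := by ring
  rw [Fin.prod_univ_two, ENNReal.ofReal_mul (by linarith)]
  simp [e]

section hip

variable {p : Plane} {lam η l : ℝ}

lemma aff_hip (x : Plane) :
    aff (hipGrad p lam η 0) (hipOff lam η l 0) x = (1 - lam) * frameMap p x 0 ∧
    aff (hipGrad p lam η 1) (hipOff lam η l 1) x = lam * (1 - frameMap p x 0) ∧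
    aff (hipGrad p lam η 2) (hipOff lam η l 2) x = η * (l - frameMap p x 1) ∧
    aff (hipGrad p lam η 3) (hipOff lam η l 3) x = η * (l + frameMap p x 1) := by
  refine ⟨?_, ?_, ?_, ?_⟩ <;>
  · simp only [aff_def, hipGrad, hipOff, frameMap_zero, frameMap_one, rot]
    simp
    ring

lemma roofBase_hip (h0 : 0 < lam) (h1 : lam < 1) (hη : 0 < η) :
    roofBase (hipGrad p lam η) (hipOff lam η l) = box p 0 1 l := by
  ext x
  obtain ⟨e0, e1, e2, e3⟩ := aff_hip (p := p) (lam := lam) (η := η) (l := l) x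
  simp only [roofBase, box, mem_ofPred_eq, Fin.forall_fin_succ, Fin.succ_zero_eq_one,
    Fin.succ_one_eq_two]
  have e3' : (Fin.succ 2 : Fin 4) = 3 := rfl
  simp only [e3', e0, e1, e2, e3, mul_pos_iff_of_pos_left h0, mul_pos_iff_of_pos_left hη,
    mul_pos_iff_of_pos_left (sub_pos.2 h1)]
  constructor
  · rintro ⟨a, b, c, d, -⟩; refine ⟨⟨a, ?_⟩, ?_, ?_⟩ <;> linarith
  · rintro ⟨⟨a, b⟩, c, d⟩; refine ⟨a, ?_, ?_, ?_, fun i => i.elim0⟩ <;> linarith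

lemma box_subset_roofCell_zero (h1 : lam < 1) {m : ℝ}
    (hm : lam * (1 - lam) ≤ η * (l - m)) (hη : 0 < η) :
    box p 0 lam m ⊆ roofCell (hipGrad p lam η) (hipOff lam η l) 0 := by
  rintro x ⟨⟨a, b⟩, c, d⟩
  obtain ⟨e0, e1, e2, e3⟩ := aff_hip (p := p) (lam := lam) (η := η) (l := l) x
  refine ⟨?_, fun k hk => ?_⟩
  · rw [e0]; exact mul_pos (by linarith) a
  · rw [e0]
    have := mul_lt_mul_of_pos_left b (sub_pos.2 h1)
    have := mul_lt_mul_of_pos_left c hη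
    have := mul_lt_mul_of_pos_left d hη
    fin_cases k
    · exact absurd rfl hk
    · simp only [Fin.mk_one, e1]; linarith
    · simp only [Fin.reduceFinMk, e2]; linarith
    · simp only [Fin.reduceFinMk, e3]; linarith

lemma box_subset_roofCell_one (h0 : 0 < lam) {m : ℝ}
    (hm : lam * (1 - lam) ≤ η * (l - m)) (hη : 0 < η) :
    box p lam 1 m ⊆ roofCell (hipGrad p lam η) (hipOff lam η l) 1 := by
  rintro x ⟨⟨a, b⟩, c, d⟩
  obtain ⟨e0, e1, e2, e3⟩ := aff_hip (p := p) (lam := lam) (η := η) (l := l) x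
  refine ⟨?_, fun k hk => ?_⟩
  · rw [e1]; exact mul_pos h0 (by linarith)
  · rw [e1]
    have := mul_lt_mul_of_pos_left a h0
    have := mul_lt_mul_of_pos_left c hη
    have := mul_lt_mul_of_pos_left d hη
    fin_cases k
    · simp only [Fin.zero_eta, e0]; linarith
    · exact absurd rfl hk
    · simp only [Fin.reduceFinMk, e2]; linarith
    · simp only [Fin.reduceFinMk, e3]; linarith

lemma exists_box_subset_closedBall (hp : p ≠ 0) :
    ∃ ρ > 0, box p 0 1 l ⊆ Metric.closedBall 0 ρ := by
  have hd := dot_self_pos hp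
  set d := p 0 ^ 2 + p 1 ^ 2 with hdd
  refine ⟨(|p 0| + |p 1|) * (1 + |l|) / d + 1, by positivity, ?_⟩
  rintro x ⟨⟨a, b⟩, c, e⟩
  have hs : |frameMap p x 0| ≤ 1 + |l| := by
    rw [abs_of_pos a]; have := abs_nonneg l; linarith
  have ht : |frameMap p x 1| ≤ 1 + |l| := by
    rw [abs_le]; have := le_abs_self l; constructor <;> linarith
  have x0 : x 0 = (p 0 * frameMap p x 0 - p 1 * frameMap p x 1) / d := by
    rw [eq_div_iff hd.ne', frameMap_zero, frameMap_one, hdd]; ring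
  have x1 : x 1 = (p 1 * frameMap p x 0 + p 0 * frameMap p x 1) / d := by
    rw [eq_div_iff hd.ne', frameMap_zero, frameMap_one, hdd]; ring
  have key : ∀ u v : ℝ, |u * frameMap p x 0 + v * frameMap p x 1| ≤ (|u| + |v|) * (1 + |l|) := by
    intro u v
    calc _ ≤ |u * frameMap p x 0| + |v * frameMap p x 1| := abs_add_le _ _
      _ = |u| * |frameMap p x 0| + |v| * |frameMap p x 1| := by simp only [abs_mul]
      _ ≤ |u| * (1 + |l|) + |v| * (1 + |l|) := by gcongr
      _ = _ := by ring
  rw [mem_closedBall_zero_iff, pi_norm_le_iff_of_nonneg (by positivity), Fin.forall_fin_two]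
  constructor
  · rw [x0, Real.norm_eq_abs, abs_div, abs_of_pos hd]
    have := key (p 0) (-p 1)
    rw [abs_neg, neg_mul, ← sub_eq_add_neg] at this
    have := div_le_div_of_nonneg_right this hd.le
    linarith
  · rw [x1, Real.norm_eq_abs, abs_div, abs_of_pos hd]
    have := key (p 1) (p 0)
    rw [add_comm |p 1|] at this
    have := div_le_div_of_nonneg_right this hd.le
    linarith

end hip

/-- `f` is a Hölder-small bounded perturbation supported in `B`, with bounded weak gradient `g`. -/
structure IsBump (α κ C : ℝ) (B : Set Plane) (f : Plane → ℝ) (g : Plane → Plane) : Prop where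
  fun_off : ∀ x ∉ B, f x = 0
  grad_off : ∀ x ∉ B, g x = 0
  abs_le : ∀ x, |f x| ≤ κ
  holder : ∀ x y, |f x - f y| ≤ κ * dist x y ^ α
  measurable : Measurable g
  norm_le : ∀ x, ‖g x‖ ≤ C
  weak : IsWeakGrad f g

lemma continuous_of_holder {α κ : ℝ} (hα : 0 < α) {f : Plane → ℝ}
    (hf : ∀ x y, |f x - f y| ≤ κ * dist x y ^ α) : Continuous f := by
  rw [continuous_iff_continuousAt]
  intro y
  rw [ContinuousAt, tendsto_iff_dist_tendsto_zero]
  refine squeeze_zero (fun _ => dist_nonneg) (fun x => hf x y) ?_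
  have : Continuous fun x : Plane => κ * dist x y ^ α :=
    continuous_const.mul ((continuous_id.dist continuous_const).rpow_const fun _ => Or.inr hα.le)
  have := this.tendsto y
  simpa [Real.zero_rpow hα.ne'] using this

lemma IsBump.continuous {α κ C : ℝ} (hα : 0 < α) {B : Set Plane} {f : Plane → ℝ}
    {g : Plane → Plane} (h : IsBump α κ C B f g) : Continuous f :=
  continuous_of_holder hα h.holder

section glue

variable {J : Type*} {B : J → Set Plane} {E : Type*} [AddCommGroup E] [TopologicalSpace E]
  {f : J → Plane → E}

lemma tsum_eq_of_mem (hB : Pairwise (Function.onFun Disjoint B)) (hf : ∀ j, ∀ x ∉ B j, f j x = 0)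
    {j : J} {x : Plane} (hx : x ∈ B j) : ∑' i, f i x = f j x :=
  tsum_eq_single j fun i hi => hf i x fun h => (disjoint_left.1 (hB hi) h hx).elim

lemma tsum_eq_zero_of_notMem (hf : ∀ j, ∀ x ∉ B j, f j x = 0)
    {x : Plane} (hx : x ∉ ⋃ j, B j) : ∑' i, f i x = 0 := by
  simp only [mem_iUnion, not_exists] at hx
  simp [fun i => hf i x (hx i)]

end glue

lemma integrable_mul_of_bounded {f g : Plane → ℝ} {C : ℝ} (hf : Measurable f)
    (hC : ∀ x, |f x| ≤ C) (hg : Continuous g) (hg' : HasCompactSupport g) :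
    Integrable (fun x => f x * g x) :=
  (hg.integrable_of_hasCompactSupport hg').bdd_mul hf.aestronglyMeasurable
    (Eventually.of_forall hC)

lemma integral_glue {J : Type*} [Countable J] {B : J → Set Plane}
    (hBm : ∀ j, MeasurableSet (B j)) (hB : Pairwise (Function.onFun Disjoint B))
    {f : J → Plane → ℝ} (hf : ∀ j, ∀ x ∉ B j, f j x = 0)
    (hi : Integrable (fun x => ∑' j, f j x)) :
    ∫ x, ∑' j, f j x = ∑' j, ∫ x, f j x := by
  rw [← setIntegral_eq_integral_of_forall_compl_eq_zero (s := ⋃ j, B j)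
    (fun x hx => tsum_eq_zero_of_notMem hf hx), integral_iUnion hBm hB hi.integrableOn]
  refine tsum_congr fun j => ?_
  rw [← setIntegral_eq_integral_of_forall_compl_eq_zero (hf j)]
  exact setIntegral_congr_fun (hBm j) fun x hx => tsum_eq_of_mem hB hf hx

lemma measurable_tsum {J : Type*} [Countable J] {B : J → Set Plane}
    (hBm : ∀ j, MeasurableSet (B j)) (hB : Pairwise (Function.onFun Disjoint B))
    {g : J → Plane → Plane} (hg : ∀ j, ∀ x ∉ B j, g j x = 0) (hm : ∀ j, Measurable (g j)) :
    Measurable fun x => ∑' j, g j x := by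
  intro s hs
  have : (fun x => ∑' j, g j x) ⁻¹' s =
      (⋃ j, B j ∩ g j ⁻¹' s) ∪ ((⋃ j, B j)ᶜ ∩ (fun _ => (0 : Plane)) ⁻¹' s) := by
    ext x
    by_cases hx : x ∈ ⋃ j, B j
    · obtain ⟨j, hj⟩ := mem_iUnion.1 hx
      rw [mem_preimage, tsum_eq_of_mem hB hg hj]
      constructor
      · exact fun h => Or.inl (mem_iUnion.2 ⟨j, hj, h⟩)
      · rintro (h | h)
        · obtain ⟨i, hi, hi'⟩ := mem_iUnion.1 h
          rcases eq_or_ne i j with rfl | hij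
          · exact hi'
          · exact (disjoint_left.1 (hB hij) hi hj).elim
        · exact absurd hx h.1
    · rw [mem_preimage, tsum_eq_zero_of_notMem hg hx]
      constructor
      · exact fun h => Or.inr ⟨hx, h⟩
      · rintro (h | h)
        · obtain ⟨i, hi, -⟩ := mem_iUnion.1 h
          exact absurd (mem_iUnion.2 ⟨i, hi⟩) hx
        · exact h.2
  rw [this]
  exact (MeasurableSet.iUnion fun j => (hBm j).inter (hm j hs)).union
    ((MeasurableSet.iUnion hBm).compl.inter (measurable_const hs))

lemma isBump_zero {α κ C : ℝ} (hκ : 0 ≤ κ) (hC : 0 ≤ C) (B : Set Plane) :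
    IsBump α κ C B (fun _ => 0) (fun _ => 0) where
  fun_off _ _ := rfl
  grad_off _ _ := rfl
  abs_le _ := by simpa using hκ
  holder x y := by simpa using mul_nonneg hκ (Real.rpow_nonneg dist_nonneg _)
  measurable := measurable_const
  norm_le _ := by simpa using hC
  weak φ _ _ i := by simp

lemma IsBump.mono {α κ C κ' C' : ℝ} {B B' : Set Plane} {f : Plane → ℝ} {g : Plane → Plane}
    (h : IsBump α κ C B f g) (hκ : κ ≤ κ') (hC : C ≤ C') (hB : B ⊆ B') :
    IsBump α κ' C' B' f g where
  fun_off x hx := h.fun_off x fun h' => hx (hB h')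
  grad_off x hx := h.grad_off x fun h' => hx (hB h')
  abs_le x := (h.abs_le x).trans hκ
  holder x y := (h.holder x y).trans
    (mul_le_mul_of_nonneg_right hκ (Real.rpow_nonneg dist_nonneg _))
  measurable := h.measurable
  norm_le x := (h.norm_le x).trans hC
  weak := h.weak

lemma isBump_glue {J : Type*} [Countable J] {α κ C : ℝ} (hα : 0 < α) (hκ : 0 ≤ κ) (hC : 0 ≤ C)
    {B : J → Set Plane} (hBm : ∀ j, MeasurableSet (B j))
    (hB : Pairwise (Function.onFun Disjoint B)) {f : J → Plane → ℝ} {g : J → Plane → Plane}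
    (h : ∀ j, IsBump α κ C (B j) (f j) (g j)) :
    IsBump α (2 * κ) C (⋃ j, B j) (fun x => ∑' j, f j x) (fun x => ∑' j, g j x) := by
  have hf := fun j => (h j).fun_off
  have hg := fun j => (h j).grad_off
  have hnn : ∀ x y : Plane, 0 ≤ κ * dist x y ^ α := fun x y =>
    mul_nonneg hκ (Real.rpow_nonneg dist_nonneg _)
  have hol0 : ∀ x y : Plane, ∀ j, x ∈ B j → y ∉ B j → |f j x| ≤ κ * dist x y ^ α := by
    intro x y j _ hy
    simpa [hf j y hy] using (h j).holder x y
  have hhol : ∀ x y : Plane, |(∑' j, f j x) - ∑' j, f j y| ≤ 2 * κ * dist x y ^ α := by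
    intro x y
    have hxy := hnn x y
    rw [mul_assoc]
    by_cases hx : x ∈ ⋃ j, B j
    · obtain ⟨j, hj⟩ := mem_iUnion.1 hx
      rw [tsum_eq_of_mem hB hf hj]
      by_cases hy : y ∈ ⋃ j, B j
      · obtain ⟨i, hi⟩ := mem_iUnion.1 hy
        rw [tsum_eq_of_mem hB hf hi]
        rcases eq_or_ne i j with rfl | hij
        · exact ((h i).holder x y).trans (by linarith)
        · have a1 := hol0 x y j hj fun h' => (disjoint_left.1 (hB hij) hi h').elim
          have a2 := hol0 y x i hi fun h' => (disjoint_left.1 (hB hij) h' hj).elim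
          rw [dist_comm] at a2
          exact (abs_sub _ _).trans (by linarith)
      · rw [tsum_eq_zero_of_notMem hf hy, sub_zero]
        have := hol0 x y j hj fun h' => hy (mem_iUnion.2 ⟨j, h'⟩)
        linarith
    · rw [tsum_eq_zero_of_notMem hf hx, zero_sub, abs_neg]
      by_cases hy : y ∈ ⋃ j, B j
      · obtain ⟨i, hi⟩ := mem_iUnion.1 hy
        rw [tsum_eq_of_mem hB hf hi]
        have := hol0 y x i hi fun h' => hx (mem_iUnion.2 ⟨i, h'⟩)
        rw [dist_comm] at this
        linarith
      · rw [tsum_eq_zero_of_notMem hf hy]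
        simpa using hxy
  have hmeas := measurable_tsum hBm hB hg fun j => (h j).measurable
  have hnorm : ∀ x, ‖∑' j, g j x‖ ≤ C := by
    intro x
    by_cases hx : x ∈ ⋃ j, B j
    · obtain ⟨j, hj⟩ := mem_iUnion.1 hx
      rw [tsum_eq_of_mem hB hg hj]; exact (h j).norm_le x
    · rw [tsum_eq_zero_of_notMem hg hx]; simpa using hC
  refine ⟨fun x hx => tsum_eq_zero_of_notMem hf hx, fun x hx => tsum_eq_zero_of_notMem hg hx,
    fun x => ?_, hhol, hmeas, hnorm, ?_⟩
  · by_cases hx : x ∈ ⋃ j, B j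
    · obtain ⟨j, hj⟩ := mem_iUnion.1 hx
      rw [tsum_eq_of_mem hB hf hj]
      have := (h j).abs_le x; linarith
    · rw [tsum_eq_zero_of_notMem hf hx]; simpa using hκ
  · intro φ hφ hφc i
    have hcf : Continuous fun x => ∑' j, f j x := continuous_of_holder hα hhol
    have hdφ : Continuous fun x => fderiv ℝ φ x (Pi.single i 1) :=
      ((hφ 1).continuous_fderiv one_ne_zero).clm_apply continuous_const
    have hdc : HasCompactSupport fun x => fderiv ℝ φ x (Pi.single i 1) :=
      hφc.fderiv_apply (𝕜 := ℝ) _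
    have e1 : (fun x => (∑' j, f j x) * fderiv ℝ φ x (Pi.single i 1)) =
        fun x => ∑' j, f j x * fderiv ℝ φ x (Pi.single i 1) := by
      funext x; exact tsum_mul_right.symm
    have e2 : (fun x => (∑' j, g j x) i * φ x) = fun x => ∑' j, g j x i * φ x := by
      funext x
      rw [tsum_mul_right]
      congr 1
      by_cases hx : x ∈ ⋃ j, B j
      · obtain ⟨j, hj⟩ := mem_iUnion.1 hx
        rw [tsum_eq_of_mem hB hg hj, tsum_eq_of_mem (f := fun j x => g j x i) hB
          (fun j x hx => by simp [hg j x hx]) hj]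
      · rw [tsum_eq_zero_of_notMem hg hx, tsum_eq_zero_of_notMem (f := fun j x => g j x i)
          (fun j x hx => by simp [hg j x hx]) hx]
        rfl
    have i1 : Integrable fun x => (∑' j, f j x) * fderiv ℝ φ x (Pi.single i 1) :=
      (hcf.mul hdφ).integrable_of_hasCompactSupport hdc.mul_left
    have i2 : Integrable fun x => (∑' j, g j x) i * φ x :=
      integrable_mul_of_bounded ((measurable_pi_apply i).comp hmeas)
        (fun x => (norm_le_pi_norm _ i).trans (hnorm x)) (hφ 0).continuous hφc
    rw [e1, e2]
    rw [e1] at i1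
    rw [e2] at i2
    rw [integral_glue hBm hB (fun j x hx => by simp [hf j x hx]) i1,
      integral_glue hBm hB (fun j x hx => by simp [hg j x hx]) i2, ← tsum_neg]
    exact tsum_congr fun j => (h j).weak φ hφ hφc i

lemma le_interpolate {α t s L : ℝ} (hα : α ∈ Ioo (0 : ℝ) 1) (ht : 0 ≤ t) (h1 : t ≤ s) (h2 : t ≤ L) :
    t ≤ s ^ (1 - α) * L ^ α := by
  have hs := ht.trans h1
  rcases ht.eq_or_lt with rfl | ht'
  · positivity
  calc t = t ^ (1 - α) * t ^ α := by rw [← Real.rpow_add ht']; simp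
    _ ≤ s ^ (1 - α) * L ^ α :=
      mul_le_mul (Real.rpow_le_rpow ht h1 (by linarith [hα.2])) (Real.rpow_le_rpow ht h2 hα.1.le)
        (by positivity) (by positivity)

/-- A height below which functions of Lipschitz constant `L` are `α`-Hölder with constant `κ`. -/
lemma exists_height {α κ L : ℝ} (hα : α ∈ Ioo (0 : ℝ) 1) (hκ : 0 < κ) (hL : 0 < L) :
    ∃ s > 0, s ≤ κ ∧ s ^ (1 - α) * L ^ α ≤ κ := by
  have h1 : 0 < 1 - α := by linarith [hα.2]
  refine ⟨min κ ((κ / L ^ α) ^ (1 - α)⁻¹), by positivity, min_le_left _ _, ?_⟩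
  have h2 : (min κ ((κ / L ^ α) ^ (1 - α)⁻¹)) ^ (1 - α) ≤ κ / L ^ α := by
    calc _ ≤ ((κ / L ^ α) ^ (1 - α)⁻¹) ^ (1 - α) :=
        Real.rpow_le_rpow (by positivity) (min_le_right _ _) h1.le
      _ = κ / L ^ α := Real.rpow_inv_rpow (by positivity) h1.ne'
  rwa [le_div_iff₀ (by positivity)] at h2

/-- A scalar perturbation of an affine function on `V`, whose gradient is `(1 - lam) p` and
`-lam p` on proportions almost `lam` and `1 - lam` of `V`, and small elsewhere. -/
structure IsSplit (α κ ε lam : ℝ) (p : Plane) (V : Set Plane) (f : Plane → ℝ)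
    (g : Plane → Plane) (𝒯 : Set (Set Plane)) : Prop where
  bump : IsBump α κ (‖p‖ + ε) V f g
  countable : 𝒯.Countable
  piece : ∀ T ∈ 𝒯, IsRegularDomain T ∧ T ⊆ V ∧ ∃ a b, ∀ x ∈ T, f x = aff a b x ∧ g x = a
  disjoint : 𝒯.PairwiseDisjoint id
  null : volume (V \ ⋃₀ 𝒯) = 0
  grad : ∀ x ∈ V, g x = (1 - lam) • p ∨ g x = -(lam • p) ∨ ‖g x‖ ≤ ε
  volume_fst : ENNReal.ofReal ((1 - ε) * lam) * volume V ≤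
    volume {x ∈ V | g x = (1 - lam) • p}
  volume_snd : ENNReal.ofReal ((1 - ε) * (1 - lam)) * volume V ≤
    volume {x ∈ V | g x = -(lam • p)}
  trivial : p = 0 → f = 0 ∧ g = 0 ∧ 𝒯 = {V}

lemma isSplit_zero {α κ ε lam : ℝ} (hκ : 0 ≤ κ) (hε : ε ∈ Ioo (0 : ℝ) 1)
    (hl : lam ∈ Ioo (0 : ℝ) 1) {V : Set Plane} (hV : IsRegularDomain V) :
    IsSplit α κ ε lam 0 V 0 0 {V} where
  bump := isBump_zero hκ (by simpa using hε.1.le) V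
  countable := countable_singleton V
  piece := by
    rintro T rfl
    exact ⟨hV, Subset.rfl, 0, 0, fun x _ => by simp [aff]⟩
  disjoint := pairwiseDisjoint_singleton V id
  null := by simp
  grad x _ := by simp
  volume_fst := by
    have : ENNReal.ofReal ((1 - ε) * lam) ≤ 1 :=
      ENNReal.ofReal_le_one.2 (mul_le_one₀ (by linarith [hε.1]) hl.1.le hl.2.le)
    simpa using mul_le_mul_left this (volume V)
  volume_snd := by
    have : ENNReal.ofReal ((1 - ε) * (1 - lam)) ≤ 1 :=
      ENNReal.ofReal_le_one.2 (mul_le_one₀ (by linarith [hε.1]) (by linarith [hl.2])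
        (by linarith [hl.1]))
    simpa using mul_le_mul_left this (volume V)
  trivial _ := ⟨rfl, rfl, rfl⟩

lemma roof_le_of_add {a : Fin 4 → Plane} {b : Fin 4 → ℝ} {h : ℝ} (hh : 0 ≤ h) {x : Plane}
    (hx : aff (a 2) (b 2) x + aff (a 3) (b 3) x ≤ 2 * h) : roof a b x ≤ h := by
  rcases le_total (aff (a 2) (b 2) x) (aff (a 3) (b 3) x) with h' | h'
  · exact (roof_le a b 2 x).trans (max_le hh (by linarith))
  · exact (roof_le a b 3 x).trans (max_le hh (by linarith))

lemma isBump_roof {a : Fin 4 → Plane} (ha : Function.Injective a) {b : Fin 4 → ℝ}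
    {α κ s C : ℝ} (hα : α ∈ Ioo (0 : ℝ) 1) (hC : 0 < C) (haC : ∀ j, ‖a j‖ ≤ C)
    (hs : s ≤ κ) (hs' : s ^ (1 - α) * (2 * C) ^ α ≤ κ) (h : ∀ x, roof a b x ≤ s) :
    IsBump α κ C (roofBase a b) (roof a b) (roofGrad a b) where
  fun_off x := roof_eq_zero a b
  grad_off x hx := roofGrad_eq_zero a b fun j hj => hx (roofCell_subset a b j hj)
  abs_le x := by rw [abs_of_nonneg (roof_nonneg a b x)]; exact (h x).trans hs
  holder x y := by
    have hK : ∀ j, 2 * ‖a j‖ ≤ 2 * C := fun j => by linarith [haC j]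
    have h1 : |roof a b x - roof a b y| ≤ 2 * C * dist x y := by
      have h1 := roof_le_add a b hK x y
      have h2 := roof_le_add a b hK y x
      rw [dist_comm] at h2
      exact abs_sub_le_iff.2 ⟨by linarith, by linarith⟩
    have h2 : |roof a b x - roof a b y| ≤ s :=
      abs_sub_le_iff.2 ⟨by linarith [h x, roof_nonneg a b y], by linarith [h y, roof_nonneg a b x]⟩
    refine (le_interpolate hα (abs_nonneg _) h2 h1).trans ?_
    rw [Real.mul_rpow (by positivity) dist_nonneg, ← mul_assoc]
    exact mul_le_mul_of_nonneg_right hs' (Real.rpow_nonneg dist_nonneg _)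
  measurable := measurable_roofGrad a b
  norm_le x := by
    by_cases hx : ∃ j, x ∈ roofCell a b j
    · obtain ⟨j, hj⟩ := hx
      rw [roofGrad_eq_of_mem a b hj]; exact haC j
    · rw [roofGrad_eq_zero a b (by simpa using hx)]; simpa using hC.le
  weak := isWeakGrad_roof a b ha

lemma isRegularDomain_of_convex {T : Set Plane} (ho : IsOpen T) (hc : Convex ℝ T)
    (hne : T.Nonempty) (hb : Bornology.IsBounded T) : IsRegularDomain T :=
  ⟨ho, hb, ⟨hne, hc.isPreconnected⟩, hc.addHaar_frontier volume⟩

lemma exists_split {V : Set Plane} (hV : IsRegularDomain V) (p : Plane) {α κ ε lam : ℝ}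
    (hα : α ∈ Ioo (0 : ℝ) 1) (hκ : 0 < κ) (hε : ε ∈ Ioo (0 : ℝ) 1) (hl : lam ∈ Ioo (0 : ℝ) 1) :
    ∃ f g 𝒯, IsSplit α κ ε lam p V f g 𝒯 := by
  by_cases hp : p = 0
  · subst hp; exact ⟨0, 0, {V}, isSplit_zero hκ.le hε hl hV⟩
  obtain ⟨hε0, hε1⟩ := hε
  obtain ⟨hl0, hl1⟩ := hl
  have hpn : 0 < ‖p‖ := norm_pos_iff.2 hp
  obtain ⟨η, hη, hηp⟩ : ∃ η > 0, η * ‖p‖ ≤ ε := ⟨ε / ‖p‖, by positivity, by field_simp; rfl⟩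
  have h1l : 0 < 1 - lam := by linarith
  have h1e : 0 < 1 - ε := by linarith
  obtain ⟨l, hl, hle⟩ : ∃ l > 0, lam * (1 - lam) = η * (l - (1 - ε) * l) :=
    ⟨lam * (1 - lam) / (η * ε), by positivity, by field_simp; ring⟩
  set a := hipGrad p lam η with ha
  set b := hipOff lam η l with hb
  have hinj : Function.Injective a := injective_hipGrad hp hl0 hl1 hη
  have haC : ∀ j, ‖a j‖ ≤ ‖p‖ + ε := by
    have h1 : (1 - lam) * ‖p‖ ≤ 1 * ‖p‖ := by gcongr; linarith
    have h2 : lam * ‖p‖ ≤ 1 * ‖p‖ := by gcongr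
    intro j
    fin_cases j <;> simp [hipGrad, norm_smul, norm_rot, abs_of_pos, *] <;> linarith
  obtain ⟨s, hs0, hsκ, hs⟩ := exists_height (κ := κ / 2) (L := 2 * (‖p‖ + ε)) hα
    (by positivity) (by positivity)
  obtain ⟨ρ, hρ, hbox⟩ := exists_box_subset_closedBall (l := l) hp
  have hbase : roofBase a b = box p 0 1 l := roofBase_hip hl0 hl1 hη
  have hd := dot_self_pos hp
  have hvb := volume_box hp (l := l) zero_le_one
  have hpos : 0 < volume (roofBase a b) := by
    rw [hbase, hvb, ← ENNReal.ofReal_mul (by positivity)]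
    exact ENNReal.ofReal_pos.2 (by positivity)
  have hne : (roofBase a b).Nonempty := nonempty_of_measure_ne_zero hpos.ne'
  obtain ⟨u, huc, hu, hud, hunull⟩ := exists_packing (a := a) (b := b) hρ (by rwa [hbase]) hne
    hV.1 (r₀ := s / (η * l)) (by positivity)
  have : Countable u := huc.to_subtype
  set B : u → Set Plane := fun z => roofBase a (shift a b z) with hB
  have hBm : ∀ z, MeasurableSet (B z) := fun z => (isOpen_roofBase _ _).measurableSet
  have hBd : Pairwise (Function.onFun Disjoint B) := fun z z' hz =>
    hud z.2 z'.2 fun h => hz (Subtype.ext h)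
  have hBV : ∀ z, B z ⊆ V := fun z => (hu z z.2).2.2
  have hbump : ∀ z : u, IsBump α (κ / 2) (‖p‖ + ε) (B z) (roof a (shift a b z))
      (roofGrad a (shift a b z)) := by
    intro z
    refine isBump_roof hinj hα (by positivity) haC hsκ hs fun x => roof_le_of_add hs0.le ?_
    obtain ⟨hz, hz', -⟩ := hu z z.2
    rw [aff_shift a b hz, aff_shift a b hz, ← mul_add]
    obtain ⟨-, -, e2, e3⟩ := aff_hip (p := p) (lam := lam) (η := η) (l := l)
      (z.1.2⁻¹ • (x - z.1.1))
    rw [ha, hb, e2, e3]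
    rw [le_div_iff₀ (by positivity)] at hz'
    linarith
  have hglue := isBump_glue hα.1 (by positivity) (by positivity) hBm hBd hbump
  have hgmem : ∀ (z : u) (x : Plane), x ∈ B z → ∑' z : u, roofGrad a (shift a b z) x =
      roofGrad a (shift a b z) x := fun z x hx =>
    tsum_eq_of_mem hBd (fun z => (hbump z).grad_off) hx
  have hfmem : ∀ (z : u) (x : Plane), x ∈ B z → ∑' z : u, roof a (shift a b z) x =
      roof a (shift a b z) x := fun z x hx =>
    tsum_eq_of_mem hBd (fun z => (hbump z).fun_off) hx
  have hunull' : volume (V \ ⋃ z, B z) = 0 := by rwa [hB, iUnion_subtype]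
  have hvol : ∀ (j : Fin 4) (t : ℝ) (v : Plane), v = a j →
      ENNReal.ofReal t * volume (roofBase a b) ≤ volume (roofCell a b j) →
      ENNReal.ofReal t * volume V ≤
        volume {x ∈ V | ∑' z : u, roofGrad a (shift a b z) x = v} := by
    intro j t v hv h
    have hV' : volume V ≤ ∑' z, volume (B z) := by
      calc volume V ≤ volume ((⋃ z, B z) ∪ (V \ ⋃ z, B z)) :=
            measure_mono fun x hx => by by_cases h : x ∈ ⋃ z, B z <;> simp_all
        _ ≤ volume (⋃ z, B z) + volume (V \ ⋃ z, B z) := measure_union_le _ _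
        _ ≤ _ := by rw [hunull', add_zero]; exact measure_iUnion_le _
    calc _ ≤ ENNReal.ofReal t * ∑' z, volume (B z) := by gcongr
      _ = ∑' z, ENNReal.ofReal t * volume (B z) := ENNReal.tsum_mul_left.symm
      _ ≤ ∑' z : u, volume (roofCell a (shift a b z) j) := by
        refine ENNReal.tsum_le_tsum fun z => ?_
        have hz := (hu z z.2).1
        change _ * volume (roofBase a (shift a b z)) ≤ _
        rw [roofBase_shift a b hz, roofCell_shift a b hz, volume_preimage_rescale hz,
          volume_preimage_rescale hz, mul_left_comm]
        gcongr
      _ = volume (⋃ z : u, roofCell a (shift a b z) j) := by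
        rw [measure_iUnion _ fun z => (isOpen_roofCell _ _ _).measurableSet]
        exact fun z z' h => (hBd h).mono (roofCell_subset _ _ _) (roofCell_subset _ _ _)
      _ ≤ _ := by
        refine measure_mono (iUnion_subset fun z x hx => ?_)
        have hxB := roofCell_subset _ _ _ hx
        exact ⟨hBV z hxB, by rw [hgmem z x hxB, roofGrad_eq_of_mem _ _ hx, hv]⟩
  refine ⟨_, _, {T | (∃ (z : u) (j : Fin 4), roofCell a (shift a b z) j = T) ∧ T.Nonempty},
    ⟨(hglue.mono (by linarith) le_rfl (iUnion_subset hBV)), ?_, ?_, ?_, ?_, ?_, ?_, ?_,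
      fun h => absurd h hp⟩⟩
  · refine (countable_range fun q : u × Fin 4 => roofCell a (shift a b q.1) q.2).mono ?_
    rintro T ⟨⟨z, j, rfl⟩, -⟩
    exact ⟨(z, j), rfl⟩
  · rintro T ⟨⟨z, j, rfl⟩, hT⟩
    have hTV := (roofCell_subset a (shift a b z) j).trans (hBV z)
    refine ⟨isRegularDomain_of_convex (isOpen_roofCell _ _ _) (convex_roofCell _ _ _) hT
      (hV.2.1.subset hTV), hTV, a j, shift a b z j, fun x hx => ?_⟩
    have hxB := roofCell_subset _ _ _ hx
    exact ⟨(hfmem z x hxB).trans (roof_eq_of_mem _ _ hx),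
      (hgmem z x hxB).trans (roofGrad_eq_of_mem _ _ hx)⟩
  · rintro T ⟨⟨z, j, rfl⟩, -⟩ T' ⟨⟨z', j', rfl⟩, -⟩ hne
    rcases eq_or_ne z z' with rfl | hz
    · refine disjoint_left.2 fun x hx hx' => hne ?_
      rw [roofCell_disjoint _ _ hx hx']
    · exact (hBd hz).mono (roofCell_subset _ _ _) (roofCell_subset _ _ _)
  · refine measure_mono_null (t := (V \ ⋃ z, B z) ∪
      ⋃ z : u, (B z \ ⋃ j, roofCell a (shift a b z) j)) ?_ (measure_union_null hunull'
        (measure_iUnion_null fun z => volume_roofBase_diff _ _ hinj))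
    rintro x ⟨hxV, hx⟩
    by_cases h : x ∈ ⋃ z, B z
    · right
      obtain ⟨z, hz⟩ := mem_iUnion.1 h
      refine mem_iUnion.2 ⟨z, hz, fun h' => hx ?_⟩
      obtain ⟨j, hj⟩ := mem_iUnion.1 h'
      exact ⟨_, ⟨⟨z, j, rfl⟩, ⟨x, hj⟩⟩, hj⟩
    · exact Or.inl ⟨hxV, h⟩
  · intro x _
    by_cases h : x ∈ ⋃ z, B z
    · obtain ⟨z, hz⟩ := mem_iUnion.1 h
      simp only [hgmem z x hz]
      by_cases hx : ∃ j, x ∈ roofCell a (shift a b z) j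
      · obtain ⟨j, hj⟩ := hx
        rw [roofGrad_eq_of_mem _ _ hj]
        fin_cases j
        · exact Or.inl rfl
        · exact Or.inr (Or.inl rfl)
        · right; right
          simpa [ha, hipGrad, norm_smul, norm_rot, abs_of_pos hη] using hηp
        · right; right
          simpa [ha, hipGrad, norm_smul, norm_rot, abs_of_pos hη] using hηp
      · right; right
        rw [roofGrad_eq_zero _ _ (by simpa using hx)]; simpa using hε0.le
    · right; right
      rw [hglue.grad_off x h]; simpa using hε0.le
  · refine hvol 0 _ _ rfl ?_
    refine le_trans (le_of_eq ?_) (measure_mono (box_subset_roofCell_zero hl1 hle.le hη))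
    rw [hbase, hvb, volume_box hp hl0.le, mul_left_comm, ← ENNReal.ofReal_mul (by positivity)]
    congr 2; ring
  · refine hvol 1 _ _ rfl ?_
    refine le_trans (le_of_eq ?_) (measure_mono (box_subset_roofCell_one hl0 hle.le hη))
    rw [hbase, hvb, volume_box hp hl1.le, mul_left_comm, ← ENNReal.ofReal_mul (by positivity)]
    congr 2; ring

/-- Real `2 × 2` matrices. -/
abbrev Mat := Matrix (Fin 2) (Fin 2) ℝ

/-- The matrix whose `i`-th row is `y`, the other row being zero. -/
def rowMat (i : Fin 2) (y : Plane) : Mat := Pi.single (M := fun _ => Plane) i y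

lemma rowMat_same (i : Fin 2) (y : Plane) : rowMat i y i = y :=
  Pi.single_eq_same (M := fun _ => Plane) i y

lemma rowMat_ne {i k : Fin 2} (h : k ≠ i) (y : Plane) : rowMat i y k = 0 :=
  Pi.single_eq_of_ne (M := fun _ => Plane) h y

lemma rowMat_zero (i : Fin 2) : rowMat i 0 = 0 := Pi.single_zero i

lemma rowMat_neg (i : Fin 2) (y : Plane) : rowMat i (-y) = -rowMat i y :=
  Pi.single_neg (f := fun _ => Plane) i y

lemma add_rowMat_same (X : Mat) (i : Fin 2) (y : Plane) : (X + rowMat i y) i = X i + y :=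
  congrArg (X i + ·) (rowMat_same i y)

lemma add_rowMat_ne {i k : Fin 2} (h : k ≠ i) (X : Mat) (y : Plane) :
    (X + rowMat i y) k = X k :=
  (congrArg (X k + ·) (rowMat_ne h y)).trans (add_zero _)

/-- A decomposition of `Ω` into countably many regular pieces, up to a null set. -/
structure IsDecomp (Ω : Set Plane) (𝒮 : Set (Set Plane)) : Prop where
  countable : 𝒮.Countable
  regular : ∀ V ∈ 𝒮, IsRegularDomain V
  subset : ∀ V ∈ 𝒮, V ⊆ Ω
  disjoint : 𝒮.PairwiseDisjoint id
  null : volume (Ω \ ⋃₀ 𝒮) = 0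

lemma IsDecomp.mul_volume_le {Ω : Set Plane} {𝒮 : Set (Set Plane)} (h : IsDecomp Ω 𝒮)
    {S T : Set Plane} (hS : S ⊆ Ω) {c d : ENNReal}
    (hV : ∀ V ∈ 𝒮, c * volume (V ∩ S) ≤ d * volume (V ∩ T)) : c * volume S ≤ d * volume T := by
  have := h.countable.to_subtype
  have h1 : volume S ≤ ∑' V : 𝒮, volume (V.1 ∩ S) := by
    calc volume S ≤ volume ((⋃ V : 𝒮, V.1 ∩ S) ∪ (Ω \ ⋃₀ 𝒮)) := by
          refine measure_mono fun x hx => ?_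
          by_cases hx' : x ∈ ⋃₀ 𝒮
          · obtain ⟨V, hV, hxV⟩ := hx'
            exact Or.inl (mem_iUnion.2 ⟨⟨V, hV⟩, hxV, hx⟩)
          · exact Or.inr ⟨hS hx, hx'⟩
      _ ≤ volume (⋃ V : 𝒮, V.1 ∩ S) + volume (Ω \ ⋃₀ 𝒮) := measure_union_le _ _
      _ ≤ _ := by rw [h.null, add_zero]; exact measure_iUnion_le _
  have h2 : ∑' V : 𝒮, volume (V.1 ∩ T) ≤ volume T := by
    have hm : ∀ V : 𝒮, MeasurableSet V.1 := fun V => (h.regular V V.2).1.measurableSet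
    calc ∑' V : 𝒮, volume (V.1 ∩ T) = ∑' V : 𝒮, volume.restrict T V.1 :=
          tsum_congr fun V => (Measure.restrict_apply (hm V)).symm
      _ = volume.restrict T (⋃ V : 𝒮, V.1) := by
          rw [measure_iUnion _ hm]
          exact fun V V' hne => h.disjoint V.2 V'.2 fun h' => hne (Subtype.ext h')
      _ ≤ volume.restrict T univ := measure_mono (subset_univ _)
      _ = volume T := Measure.restrict_apply_univ T
  calc c * volume S ≤ c * ∑' V : 𝒮, volume (V.1 ∩ S) := by gcongr
    _ = ∑' V : 𝒮, c * volume (V.1 ∩ S) := ENNReal.tsum_mul_left.symm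
    _ ≤ ∑' V : 𝒮, d * volume (V.1 ∩ T) := ENNReal.tsum_le_tsum fun V => hV V V.2
    _ = d * ∑' V : 𝒮, volume (V.1 ∩ T) := ENNReal.tsum_mul_left
    _ ≤ d * volume T := by gcongr

/-- A piecewise affine perturbation `w` of the affine map with gradient `A`, the perturbed map
having gradient `G`, which is constant on each piece of `𝒮`, and satisfies `P` there. -/
structure IsStage (Ω : Set Plane) (A : Mat) (P : Mat → Prop) (w : Plane → Plane)
    (G : Plane → Mat) (𝒮 : Set (Set Plane)) : Prop where
  decomp : IsDecomp Ω 𝒮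
  off : ∀ x ∉ Ω, w x = 0
  grad_off : ∀ x ∉ Ω, G x = A
  continuous : Continuous w
  measurable : ∀ k, Measurable fun x => G x k
  bounded : ∃ C, ∀ x k, ‖G x k‖ ≤ C
  weak : ∀ k, IsWeakGrad (fun x => w x k) (fun x => G x k - A k)
  affine : ∀ V ∈ 𝒮, ∃ X c, P X ∧ ∀ x ∈ V, G x = X ∧ w x = lmap (X - A) c x

/-- How to modify a gradient: split the row `row` of `X` in direction `dir X`. -/
structure Rule where
  row : Fin 2
  dir : Mat → Plane
  lam : ℝ
  eps : ℝ

/-- The first main new gradient produced by a rule. -/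
def Rule.fst (r : Rule) (X : Mat) : Mat := X + rowMat r.row ((1 - r.lam) • r.dir X)

/-- The second main new gradient produced by a rule. -/
def Rule.snd (r : Rule) (X : Mat) : Mat := X - rowMat r.row (r.lam • r.dir X)

/-- `w', G', 𝒮'` arise from `w, G, 𝒮` by applying the rule `r` on each piece. -/
structure IsStep (r : Rule) (α κ : ℝ) (w : Plane → Plane) (G : Plane → Mat)
    (𝒮 : Set (Set Plane)) (w' : Plane → Plane) (G' : Plane → Mat)
    (𝒮' : Set (Set Plane)) : Prop where
  abs_le : ∀ x k, |w' x k - w x k| ≤ κ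
  holder : ∀ x y k, |(w' x k - w x k) - (w' y k - w y k)| ≤ κ * dist x y ^ α
  volume_fst : ∀ V ∈ 𝒮, ENNReal.ofReal ((1 - r.eps) * r.lam) * volume V ≤
    volume {x ∈ V | G' x = r.fst (G x)}
  volume_snd : ∀ V ∈ 𝒮, ENNReal.ofReal ((1 - r.eps) * (1 - r.lam)) * volume V ≤
    volume {x ∈ V | G' x = r.snd (G x)}
  keep : ∀ V ∈ 𝒮, ∀ x ∈ V, r.dir (G x) = 0 → V ∈ 𝒮' ∧ w' x = w x ∧ G' x = G x

lemma exists_step {Ω : Set Plane} {A : Mat} {P P' : Mat → Prop} {w : Plane → Plane}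
    {G : Plane → Mat} {𝒮 : Set (Set Plane)} (h : IsStage Ω A P w G 𝒮) (r : Rule)
    (hlam : r.lam ∈ Ioo (0 : ℝ) 1) (heps : r.eps ∈ Ioo (0 : ℝ) 1)
    {C : ℝ} (hC : ∀ X, P X → ‖r.dir X‖ ≤ C)
    (h1 : ∀ X, P X → P' (r.fst X)) (h2 : ∀ X, P X → P' (r.snd X))
    (h3 : ∀ X g, P X → ‖g‖ ≤ r.eps → P' (X + rowMat r.row g))
    {α κ : ℝ} (hα : α ∈ Ioo (0 : ℝ) 1) (hκ : 0 < κ) :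
    ∃ w' G' 𝒮', IsStage Ω A P' w' G' 𝒮' ∧ IsStep r α κ w G 𝒮 w' G' 𝒮' := by
  have := h.decomp.countable.to_subtype
  choose! X c hX using h.affine
  have hGX : ∀ V ∈ 𝒮, ∀ x ∈ V, G x = X V := fun V hV x hx => ((hX V hV).2 x hx).1
  have hsplit : ∀ V : 𝒮, ∃ f g 𝒯, IsSplit α (κ / 2) r.eps r.lam (r.dir (X V)) V f g 𝒯 :=
    fun V => exists_split (h.decomp.regular V V.2) _ hα (by positivity) heps hlam
  choose f g 𝒯 hs using hsplit
  have hBd : Pairwise (Function.onFun Disjoint fun V : 𝒮 => V.1) := fun V V' hne =>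
    h.decomp.disjoint V.2 V'.2 fun h' => hne (Subtype.ext h')
  have hC0 : 0 ≤ max C 0 + r.eps := add_nonneg (le_max_right _ _) heps.1.le
  have hbump : ∀ V : 𝒮, IsBump α (κ / 2) (max C 0 + r.eps) V.1 (f V) (g V) := fun V =>
    (hs V).bump.mono le_rfl (by gcongr; exact (hC _ (hX V V.2).1).trans (le_max_left _ _))
      Subset.rfl
  have hglue := isBump_glue hα.1 (by positivity) hC0
    (fun V : 𝒮 => (h.decomp.regular V V.2).1.measurableSet) hBd hbump
  set F : Plane → ℝ := fun x => ∑' V, f V x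
  set D : Plane → Plane := fun x => ∑' V, g V x
  have hFmem : ∀ (V : 𝒮) (x : Plane), x ∈ V.1 → F x = f V x := fun V x hx =>
    tsum_eq_of_mem hBd (fun V => (hbump V).fun_off) hx
  have hDmem : ∀ (V : 𝒮) (x : Plane), x ∈ V.1 → D x = g V x := fun V x hx =>
    tsum_eq_of_mem hBd (fun V => (hbump V).grad_off) hx
  have hsub : ⋃ V : 𝒮, V.1 ⊆ Ω := iUnion_subset fun V => h.decomp.subset V V.2
  have hwk : ∀ x k, (w x + (Pi.single r.row (F x) : Plane)) k - w x k =
      if k = r.row then F x else 0 := by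
    intro x k
    rw [Pi.add_apply, add_sub_cancel_left, Pi.single_apply]
  have hfst : ∀ (V : 𝒮) (x : Plane), x ∈ V.1 → g V x = (1 - r.lam) • r.dir (X V) →
      G x + rowMat r.row (D x) = r.fst (G x) := by
    intro V x hx hg
    rw [Rule.fst, hDmem V x hx, hg, hGX V V.2 x hx]
  have hsnd : ∀ (V : 𝒮) (x : Plane), x ∈ V.1 → g V x = -(r.lam • r.dir (X V)) →
      G x + rowMat r.row (D x) = r.snd (G x) := by
    intro V x hx hg
    rw [Rule.snd, hDmem V x hx, hg, hGX V V.2 x hx, rowMat_neg, sub_eq_add_neg]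
  have hgrad : ∀ (V : 𝒮) (x : Plane), x ∈ V.1 → G x + rowMat r.row (D x) = r.fst (G x) ∨
      G x + rowMat r.row (D x) = r.snd (G x) ∨
      ∃ g, ‖g‖ ≤ r.eps ∧ G x + rowMat r.row (D x) = G x + rowMat r.row g := by
    intro V x hx
    rcases (hs V).grad x hx with h' | h' | h'
    · exact Or.inl (hfst V x hx h')
    · exact Or.inr (Or.inl (hsnd V x hx h'))
    · exact Or.inr (Or.inr ⟨g V x, h', by rw [hDmem V x hx]⟩)
  refine ⟨fun x => w x + (Pi.single r.row (F x) : Plane), fun x => G x + rowMat r.row (D x),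
    ⋃ V : 𝒮, 𝒯 V, ⟨⟨?_, ?_, ?_, ?_, ?_⟩, ?_, ?_, ?_, ?_, ?_, ?_, ?_⟩, ⟨?_, ?_, ?_, ?_, ?_⟩⟩
  · exact countable_iUnion fun V => (hs V).countable
  · rintro T hT
    obtain ⟨V, hV⟩ := mem_iUnion.1 hT
    exact ((hs V).piece T hV).1
  · rintro T hT
    obtain ⟨V, hV⟩ := mem_iUnion.1 hT
    exact ((hs V).piece T hV).2.1.trans (h.decomp.subset V V.2)
  · rintro T hT T' hT' hne
    obtain ⟨V, hV⟩ := mem_iUnion.1 hT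
    obtain ⟨V', hV'⟩ := mem_iUnion.1 hT'
    rcases eq_or_ne V V' with rfl | hVV
    · exact (hs V).disjoint hV hV' hne
    · exact (hBd hVV).mono ((hs V).piece T hV).2.1 ((hs V').piece T' hV').2.1
  · refine measure_mono_null (t := (Ω \ ⋃₀ 𝒮) ∪ ⋃ V : 𝒮, (V.1 \ ⋃₀ 𝒯 V)) ?_
      (measure_union_null h.decomp.null (measure_iUnion_null fun V => (hs V).null))
    rintro x ⟨hxΩ, hx⟩
    by_cases hx' : x ∈ ⋃₀ 𝒮
    · obtain ⟨V, hV, hxV⟩ := hx'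
      refine Or.inr (mem_iUnion.2 ⟨⟨V, hV⟩, hxV, fun ⟨T, hT, hxT⟩ => hx ?_⟩)
      exact ⟨T, mem_iUnion.2 ⟨⟨V, hV⟩, hT⟩, hxT⟩
    · exact Or.inl ⟨hxΩ, hx'⟩
  · intro x hx
    simp [h.off x hx, hglue.fun_off x fun h' => hx (hsub h')]
  · intro x hx
    simp [h.grad_off x hx, hglue.grad_off x fun h' => hx (hsub h'), rowMat_zero]
  · refine h.continuous.add (continuous_pi fun k => ?_)
    rcases eq_or_ne k r.row with hk | hk
    · subst hk; simpa using hglue.continuous hα.1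
    · simpa [Pi.single_apply, hk] using continuous_const
  · intro k
    rcases eq_or_ne k r.row with hk | hk
    · subst hk
      simp only [add_rowMat_same]
      exact (h.measurable _).add hglue.measurable
    · simpa only [add_rowMat_ne hk] using h.measurable k
  · obtain ⟨C', hC'⟩ := h.bounded
    refine ⟨C' + (max C 0 + r.eps), fun x k => (norm_add_le _ _).trans
      (add_le_add (hC' x k) ?_)⟩
    rcases eq_or_ne k r.row with hk | hk
    · subst hk
      rw [rowMat_same]; exact hglue.norm_le x
    · rw [rowMat_ne hk]; simpa using hC0
  · intro k φ hφ hφc i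
    rcases eq_or_ne k r.row with hk | hk
    · subst hk
      have hd : Continuous fun x => fderiv ℝ φ x (Pi.single i 1) :=
        ((hφ 1).continuous_fderiv one_ne_zero).clm_apply continuous_const
      have hdc : HasCompactSupport fun x => fderiv ℝ φ x (Pi.single i 1) :=
        hφc.fderiv_apply (𝕜 := ℝ) _
      have i1 : Integrable fun x => w x r.row * fderiv ℝ φ x (Pi.single i 1) :=
        (((continuous_apply r.row).comp h.continuous).mul hd).integrable_of_hasCompactSupport
          hdc.mul_left
      have i2 : Integrable fun x => F x * fderiv ℝ φ x (Pi.single i 1) :=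
        ((hglue.continuous hα.1).mul hd).integrable_of_hasCompactSupport hdc.mul_left
      have i3 : Integrable fun x => (G x r.row - A r.row) i * φ x := by
        obtain ⟨C', hC'⟩ := h.bounded
        refine integrable_mul_of_bounded (C := C' + ‖A r.row‖)
          ((measurable_pi_apply i).comp ((h.measurable _).sub measurable_const)) (fun x => ?_)
          (hφ 0).continuous hφc
        exact (norm_le_pi_norm _ i).trans ((norm_sub_le _ _).trans (add_le_add (hC' x _) le_rfl))
      have i4 : Integrable fun x => D x i * φ x :=
        integrable_mul_of_bounded ((measurable_pi_apply i).comp hglue.measurable)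
          (fun x => (norm_le_pi_norm _ i).trans (hglue.norm_le x)) (hφ 0).continuous hφc
      have e1 := h.weak r.row φ hφ hφc i
      have e2 := hglue.weak φ hφ hφc i
      calc _ = ∫ x, (w x r.row * fderiv ℝ φ x (Pi.single i 1) +
            F x * fderiv ℝ φ x (Pi.single i 1)) := by
              simp [add_mul]
        _ = -∫ x, ((G x r.row - A r.row) i * φ x + D x i * φ x) := by
              rw [integral_add i1 i2, integral_add i3 i4, neg_add, e1, e2]
        _ = _ := by
              congr 2; ext x
              have e := congrFun (add_rowMat_same (G x) r.row (D x)) i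
              simp only [Pi.add_apply] at e
              simp only [Pi.sub_apply, e]
              ring
    · have := h.weak k φ hφ hφc i
      simpa [rowMat_ne hk, Pi.single_apply, hk] using this
  · rintro T hT
    obtain ⟨V, hV⟩ := mem_iUnion.1 hT
    obtain ⟨hT1, hT2, a, b, hab⟩ := (hs V).piece T hV
    obtain ⟨hP, hV'⟩ := hX V V.2
    refine ⟨X V + rowMat r.row a, c V + Pi.single r.row b, ?_, fun x hx => ⟨?_, ?_⟩⟩
    · obtain ⟨x, hx⟩ := hT1.2.2.1.nonempty
      have hxV := hT2 hx
      have e : X V + rowMat r.row a = G x + rowMat r.row (D x) := by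
        rw [hDmem V x hxV, (hab x hx).2, hGX V V.2 x hxV]
      rw [e]
      have := hGX V V.2 x hxV
      rcases hgrad V x hxV with h' | h' | ⟨y, hy, h'⟩
      · rw [h', this]; exact h1 _ hP
      · rw [h', this]; exact h2 _ hP
      · rw [h', this]; exact h3 _ _ hP hy
    · rw [hDmem V x (hT2 hx), (hab x hx).2, hGX V V.2 x (hT2 hx)]
    · rw [(hV' x (hT2 hx)).2, hFmem V x (hT2 hx), (hab x hx).1]
      ext k
      rcases eq_or_ne k r.row with hk | hk
      · subst hk
        simp only [lmap, Pi.add_apply, Pi.single_eq_same, aff_def, Matrix.sub_apply,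
          Matrix.add_apply, Fin.sum_univ_two, rowMat_same]
        ring
      · simp [lmap, rowMat_ne hk, hk]
  · intro x k
    rw [hwk]
    split_ifs
    · have := hglue.abs_le x; linarith
    · simpa using hκ.le
  · intro x y k
    rw [hwk, hwk]
    split_ifs
    · have := hglue.holder x y; rwa [mul_div_cancel₀ κ two_ne_zero] at this
    · simpa using mul_nonneg hκ.le (Real.rpow_nonneg dist_nonneg _)
  · exact fun V hV => (hs ⟨V, hV⟩).volume_fst.trans
      (measure_mono fun x hx => ⟨hx.1, hfst ⟨V, hV⟩ x hx.1 hx.2⟩)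
  · exact fun V hV => (hs ⟨V, hV⟩).volume_snd.trans
      (measure_mono fun x hx => ⟨hx.1, hsnd ⟨V, hV⟩ x hx.1 hx.2⟩)
  · intro V hV x hx h0
    rw [hGX V hV x hx] at h0
    obtain ⟨hf, hg, h𝒯⟩ := (hs ⟨V, hV⟩).trivial h0
    refine ⟨mem_iUnion.2 ⟨⟨V, hV⟩, by rw [h𝒯]; rfl⟩, ?_, ?_⟩
    · simp [hFmem ⟨V, hV⟩ x hx, hf]
    · simp [hDmem ⟨V, hV⟩ x hx, hg, rowMat_zero]

/-- The rule `r` maps gradients satisfying `P` to gradients satisfying `P'`. -/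
structure Rule.MapsTo (r : Rule) (P P' : Mat → Prop) : Prop where
  lam_mem : r.lam ∈ Ioo (0 : ℝ) 1
  eps_mem : r.eps ∈ Ioo (0 : ℝ) 1
  bounded : ∃ C, ∀ X, P X → ‖r.dir X‖ ≤ C
  fst : ∀ X, P X → P' (r.fst X)
  snd : ∀ X, P X → P' (r.snd X)
  add : ∀ X g, P X → ‖g‖ ≤ r.eps → P' (X + rowMat r.row g)

/-- A sequence of stages, each obtained from the previous one by a rule. -/
structure IsScheme (Ω : Set Plane) (A : Mat) (r : ℕ → Rule) (P : ℕ → Mat → Prop) (α κ : ℝ)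
    (w : ℕ → Plane → Plane) (G : ℕ → Plane → Mat) (𝒮 : ℕ → Set (Set Plane)) : Prop where
  zero : w 0 = 0 ∧ G 0 = fun _ => A
  stage : ∀ n, IsStage Ω A (P n) (w n) (G n) (𝒮 n)
  step : ∀ n, IsStep (r n) α (κ / 2 / 2 ^ n) (w n) (G n) (𝒮 n) (w (n + 1)) (G (n + 1)) (𝒮 (n + 1))

lemma isStage_zero {Ω : Set Plane} (hΩ : IsRegularDomain Ω) {A : Mat} {P : Mat → Prop}
    (hA : P A) : IsStage Ω A P 0 (fun _ => A) {Ω} where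
  decomp :=
    { countable := countable_singleton Ω
      regular := by rintro V rfl; exact hΩ
      subset := by rintro V rfl; exact Subset.rfl
      disjoint := pairwiseDisjoint_singleton Ω id
      null := by simp }
  off _ _ := rfl
  grad_off _ _ := rfl
  continuous := continuous_zero
  measurable _ := measurable_const
  bounded := by
    obtain ⟨C, hC⟩ := Finite.exists_le fun k => ‖A k‖
    exact ⟨C, fun _ k => hC k⟩
  weak k φ _ _ i := by simp
  affine := by
    rintro V rfl
    exact ⟨A, 0, hA, fun x _ => ⟨rfl, by ext k; simp [lmap]⟩⟩

lemma exists_isScheme {Ω : Set Plane} (hΩ : IsRegularDomain Ω) {A : Mat} {r : ℕ → Rule}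
    {P : ℕ → Mat → Prop} (hA : P 0 A) (hr : ∀ n, (r n).MapsTo (P n) (P (n + 1)))
    {α κ : ℝ} (hα : α ∈ Ioo (0 : ℝ) 1) (hκ : 0 < κ) :
    ∃ w G 𝒮, IsScheme Ω A r P α κ w G 𝒮 := by
  let S : ℕ → Type := fun n =>
    {t : (Plane → Plane) × (Plane → Mat) × Set (Set Plane) // IsStage Ω A (P n) t.1 t.2.1 t.2.2}
  have hstep : ∀ n (t : S n), ∃ t' : S (n + 1), IsStep (r n) α (κ / 2 / 2 ^ n) t.1.1 t.1.2.1 t.1.2.2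
      t'.1.1 t'.1.2.1 t'.1.2.2 := by
    intro n t
    obtain ⟨C, hC⟩ := (hr n).bounded
    obtain ⟨w', G', 𝒮', h1, h2⟩ := exists_step t.2 (r n) (hr n).lam_mem (hr n).eps_mem hC
      (hr n).fst (hr n).snd (hr n).add hα (κ := κ / 2 / 2 ^ n) (by positivity)
    exact ⟨⟨(w', G', 𝒮'), h1⟩, h2⟩
  choose F hF using hstep
  let seq : ∀ n, S n := fun n =>
    Nat.rec (motive := S) ⟨(0, fun _ => A, {Ω}), isStage_zero hΩ hA⟩ F n
  exact ⟨fun n => (seq n).1.1, fun n => (seq n).1.2.1, fun n => (seq n).1.2.2, ⟨rfl, rfl⟩,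
    fun n => (seq n).2, fun n => hF n (seq n)⟩

lemma IsStage.const {Ω : Set Plane} {A : Mat} {P : Mat → Prop} {w : Plane → Plane}
    {G : Plane → Mat} {𝒮 : Set (Set Plane)} (h : IsStage Ω A P w G 𝒮) {V : Set Plane}
    (hV : V ∈ 𝒮) {x y : Plane} (hx : x ∈ V) (hy : y ∈ V) : G x = G y := by
  obtain ⟨X, c, -, hX⟩ := h.affine V hV
  rw [(hX x hx).1, (hX y hy).1]

lemma IsStage.pred {Ω : Set Plane} {A : Mat} {P : Mat → Prop} {w : Plane → Plane}
    {G : Plane → Mat} {𝒮 : Set (Set Plane)} (h : IsStage Ω A P w G 𝒮) {V : Set Plane}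
    (hV : V ∈ 𝒮) {x : Plane} (hx : x ∈ V) : P (G x) := by
  obtain ⟨X, c, hP, hX⟩ := h.affine V hV
  rwa [(hX x hx).1]

lemma IsStage.measurableSet_eq {Ω : Set Plane} {A : Mat} {P : Mat → Prop} {w : Plane → Plane}
    {G : Plane → Mat} {𝒮 : Set (Set Plane)} (h : IsStage Ω A P w G 𝒮) (X : Mat) :
    MeasurableSet {x | G x = X} := by
  have : {x | G x = X} = ⋂ k, {x | G x k = X k} := by
    ext x; simp only [mem_ofPred_eq, mem_iInter]; exact funext_iff
  rw [this]
  exact MeasurableSet.iInter fun k => measurableSet_eq_fun (h.measurable k) measurable_const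

namespace IsScheme

variable {Ω : Set Plane} {A : Mat} {r : ℕ → Rule} {P : ℕ → Mat → Prop} {α κ : ℝ}
  {w : ℕ → Plane → Plane} {G : ℕ → Plane → Mat} {𝒮 : ℕ → Set (Set Plane)}

lemma volume_fst_le (h : IsScheme Ω A r P α κ w G 𝒮) (n : ℕ) {Q Q' : Mat → Prop}
    (hQ : ∀ X, Q X → Q' ((r n).fst X)) :
    ENNReal.ofReal ((1 - (r n).eps) * (r n).lam) * volume {x ∈ Ω | Q (G n x)} ≤
      volume {x ∈ Ω | Q' (G (n + 1) x)} := by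
  rw [← one_mul (volume {x ∈ Ω | Q' (G (n + 1) x)})]
  refine (h.stage n).decomp.mul_volume_le (fun x hx => hx.1) fun V hV => ?_
  by_cases hne : (V ∩ {x ∈ Ω | Q (G n x)}).Nonempty
  · obtain ⟨y, hy, -, hQy⟩ := hne
    calc _ ≤ ENNReal.ofReal ((1 - (r n).eps) * (r n).lam) * volume V := by
          gcongr; exact inter_subset_left
      _ ≤ _ := (h.step n).volume_fst V hV
      _ ≤ _ := by
        rw [one_mul]
        refine measure_mono fun x hx => ⟨hx.1, (h.stage n).decomp.subset V hV hx.1, ?_⟩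
        rw [hx.2, (h.stage n).const hV hx.1 hy]
        exact hQ _ hQy
  · rw [not_nonempty_iff_eq_empty.1 hne]; simp

lemma volume_snd_le (h : IsScheme Ω A r P α κ w G 𝒮) (n : ℕ) {Q Q' : Mat → Prop}
    (hQ : ∀ X, Q X → Q' ((r n).snd X)) :
    ENNReal.ofReal ((1 - (r n).eps) * (1 - (r n).lam)) * volume {x ∈ Ω | Q (G n x)} ≤
      volume {x ∈ Ω | Q' (G (n + 1) x)} := by
  rw [← one_mul (volume {x ∈ Ω | Q' (G (n + 1) x)})]
  refine (h.stage n).decomp.mul_volume_le (fun x hx => hx.1) fun V hV => ?_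
  by_cases hne : (V ∩ {x ∈ Ω | Q (G n x)}).Nonempty
  · obtain ⟨y, hy, -, hQy⟩ := hne
    calc _ ≤ ENNReal.ofReal ((1 - (r n).eps) * (1 - (r n).lam)) * volume V := by
          gcongr; exact inter_subset_left
      _ ≤ _ := (h.step n).volume_snd V hV
      _ ≤ _ := by
        rw [one_mul]
        refine measure_mono fun x hx => ⟨hx.1, (h.stage n).decomp.subset V hV hx.1, ?_⟩
        rw [hx.2, (h.stage n).const hV hx.1 hy]
        exact hQ _ hQy
  · rw [not_nonempty_iff_eq_empty.1 hne]; simp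

/-- If the direction vanishes on gradients satisfying `Q`, and the first new gradient always
satisfies `Q`, the set where `Q` fails shrinks by a definite proportion. -/
lemma volume_not_le (h : IsScheme Ω A r P α κ w G 𝒮) (hΩ : volume Ω ≠ ⊤) (n : ℕ)
    (hl : (r n).lam ∈ Icc (0 : ℝ) 1) (he : (r n).eps ∈ Icc (0 : ℝ) 1)
    {Q : Mat → Prop} (hQ : ∀ X, Q ((r n).fst X)) (hQ' : ∀ X, Q X → (r n).dir X = 0) :
    volume {x ∈ Ω | ¬ Q (G (n + 1) x)} ≤
      ENNReal.ofReal (1 - (1 - (r n).eps) * (r n).lam) * volume {x ∈ Ω | ¬ Q (G n x)} := by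
  rw [← one_mul (volume {x ∈ Ω | ¬ Q (G (n + 1) x)})]
  refine (h.stage n).decomp.mul_volume_le (fun x hx => hx.1) fun V hV => ?_
  rw [one_mul]
  have hVΩ := (h.stage n).decomp.subset V hV
  obtain ⟨y, hy⟩ := ((h.stage n).decomp.regular V hV).2.2.1.nonempty
  by_cases hQy : Q (G n y)
  · have : V ∩ {x ∈ Ω | ¬ Q (G (n + 1) x)} = ∅ := by
      refine eq_empty_of_forall_notMem fun x hx => hx.2.2 ?_
      have e := (h.stage n).const hV hx.1 hy
      rw [((h.step n).keep V hV x hx.1 (by rw [e]; exact hQ' _ hQy)).2.2, e]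
      exact hQy
    rw [this]; simp
  · have e1 : V ∩ {x ∈ Ω | ¬ Q (G n x)} = V := by
      refine inter_eq_left.2 fun x hx => ⟨hVΩ hx, ?_⟩
      rwa [(h.stage n).const hV hx hy]
    have e2 : {x ∈ V | G (n + 1) x = (r n).fst (G n x)} =
        V ∩ {x | G (n + 1) x = (r n).fst (G n y)} := by
      ext x
      constructor
      · rintro ⟨hx, hx'⟩
        exact ⟨hx, by rw [mem_ofPred_eq, hx', (h.stage n).const hV hx hy]⟩
      · rintro ⟨hx, hx'⟩
        exact ⟨hx, by rw [hx', (h.stage n).const hV hx hy]⟩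
    have hfst := (h.step n).volume_fst V hV
    rw [e1]
    rw [e2] at hfst
    have hVfin : volume V ≠ ⊤ := ((measure_mono hVΩ).trans_lt hΩ.lt_top).ne
    have hsplit := measure_inter_add_sdiff (μ := volume) V
      ((h.stage (n + 1)).measurableSet_eq ((r n).fst (G n y)))
    have hp : 0 ≤ (1 - (r n).eps) * (r n).lam := mul_nonneg (by linarith [he.2]) hl.1
    rw [ENNReal.ofReal_sub _ hp, ENNReal.sub_mul (fun _ _ => hVfin), ENNReal.ofReal_one, one_mul]
    refine ENNReal.le_sub_of_add_le_left (ENNReal.mul_ne_top ENNReal.ofReal_ne_top hVfin) ?_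
    calc _ ≤ volume (V ∩ {x | G (n + 1) x = (r n).fst (G n y)}) +
          volume (V \ {x | G (n + 1) x = (r n).fst (G n y)}) := by
          refine add_le_add hfst (measure_mono fun x hx => ⟨hx.1, fun h' => hx.2.2 ?_⟩)
          rw [h']; exact hQ _
      _ = volume V := hsplit

end IsScheme

lemma rot_rot (p : Plane) : rot (rot p) = -p := by
  ext i; fin_cases i <;> simp [rot]

lemma rot_smul (c : ℝ) (p : Plane) : rot (c • p) = c • rot p := by
  ext i; fin_cases i <;> simp [rot]

/-- The orientation of a row. -/
def rowSign : Fin 2 → ℝ := ![-1, 1]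

lemma rowSign_mul_self (i : Fin 2) : rowSign i * rowSign i = 1 := by
  fin_cases i <;> simp [rowSign]

lemma rowSign_add_one (i : Fin 2) : rowSign (i + 1) = -rowSign i := by
  fin_cases i <;> simp [rowSign]

lemma abs_rowSign (i : Fin 2) : |rowSign i| = 1 := by
  fin_cases i <;> simp [rowSign]

lemma add_one_ne (i : Fin 2) : i + 1 ≠ i := by revert i; decide

lemma add_one_add_one (i : Fin 2) : i + 1 + 1 = i := by revert i; decide

/-- The value of the `i`-th row for which the matrix, with its other row unchanged, becomes an
admissible gradient. -/
def target (K : ℝ) (i : Fin 2) (X : Mat) : Plane := (rowSign i * K⁻¹) • rot (X (i + 1))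

/-- The matrices whose `i`-th row is equal to the target value for some `i`. -/
def IsTerminal (K : ℝ) (X : Mat) : Prop := ∃ i, X i = target K i X

lemma norm_target {K : ℝ} (hK : 0 < K) (i : Fin 2) (X : Mat) :
    ‖target K i X‖ = K⁻¹ * ‖X (i + 1)‖ := by
  rw [target, norm_smul, norm_rot, Real.norm_eq_abs, abs_mul, abs_rowSign,
    abs_of_pos (inv_pos.2 hK), one_mul]

lemma mem_Eset {ρ : ℝ} {X : Mat} (h : X 1 = ρ • rot (X 0)) : X ∈ Eset ρ := by
  have h10 : X 1 0 = -(ρ * X 0 1) := by rw [h]; simp [rot]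
  have h11 : X 1 1 = ρ * X 0 0 := by rw [h]; simp [rot]
  set r := √(X 0 0 ^ 2 + X 0 1 ^ 2) with hr
  have hr2 : r ^ 2 = X 0 0 ^ 2 + X 0 1 ^ 2 := Real.sq_sqrt (by positivity)
  rcases (Real.sqrt_nonneg (X 0 0 ^ 2 + X 0 1 ^ 2)).eq_or_lt with h0 | h0
  · rw [← hr] at h0
    rw [← h0] at hr2
    have e0 : X 0 0 = 0 := by nlinarith [sq_nonneg (X 0 0), sq_nonneg (X 0 1)]
    have e1 : X 0 1 = 0 := by nlinarith [sq_nonneg (X 0 0), sq_nonneg (X 0 1)]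
    refine ⟨0, le_rfl, 1, ⟨by simp, by simp⟩, ?_⟩
    ext i j
    fin_cases i <;> fin_cases j <;> simp [e0, e1, h10, h11]
  · rw [← hr] at h0
    refine ⟨r, h0.le, !![X 0 0 / r, X 0 1 / r; -(X 0 1 / r), X 0 0 / r], ⟨?_, ?_⟩, ?_⟩
    · ext i j
      fin_cases i <;> fin_cases j <;>
      · simp [Matrix.mul_apply, Fin.sum_univ_two]
        field_simp
        try linarith
        try ring
    · rw [Matrix.det_fin_two]
      simp
      field_simp
      linarith
    · ext i j
      fin_cases i <;> fin_cases j <;> simp [h10, h11] <;> field_simp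

lemma IsTerminal.mem_Eset {K : ℝ} (hK : K ≠ 0) {X : Mat} (h : IsTerminal K X) :
    X ∈ Eset K ∪ Eset K⁻¹ := by
  obtain ⟨i, hi⟩ := h
  fin_cases i
  · left
    apply Paper.mem_Eset
    have : X 0 = -(K⁻¹ • rot (X 1)) := by simpa [target, rowSign] using hi
    rw [this, ← neg_smul, rot_smul, rot_rot, smul_smul, smul_neg, mul_neg, mul_inv_cancel₀ hK]
    simp
  · right
    apply Paper.mem_Eset
    simpa [target, rowSign] using hi

open Classical in
/-- The rule which makes the `i`-th row of a non-terminal matrix jump to the target value, or move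
away from it by a factor `s`. -/
def mainRule (K s eps : ℝ) (i : Fin 2) : Rule where
  row := i
  dir X := if IsTerminal K X then 0 else (1 + s) • (target K i X - X i)
  lam := s / (1 + s)
  eps := eps

/-- The rule which moves the `i`-th row to `v` with probability one half. -/
def startRule (v : Plane) (i : Fin 2) : Rule where
  row := i
  dir X := (2 : ℝ) • (v - X i)
  lam := 1 / 2
  eps := 1 / 2

section mainRule

variable {K s eps : ℝ} {i : Fin 2}

lemma mainRule_of_isTerminal {X : Mat} (h : IsTerminal K X) : (mainRule K s eps i).dir X = 0 :=
  if_pos h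

lemma mainRule_fst (hs : 0 < s) {X : Mat} (h : ¬ IsTerminal K X) :
    (mainRule K s eps i).fst X = X + rowMat i (target K i X - X i) := by
  have : (1 - s / (1 + s)) * (1 + s) = 1 := by field_simp; ring
  rw [Rule.fst]
  simp only [mainRule, if_neg h, smul_smul, this, one_smul]

lemma mainRule_snd (hs : 0 < s) {X : Mat} (h : ¬ IsTerminal K X) :
    (mainRule K s eps i).snd X = X - rowMat i (s • (target K i X - X i)) := by
  have : s / (1 + s) * (1 + s) = s := by field_simp
  rw [Rule.snd]
  simp only [mainRule, if_neg h, smul_smul, this]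

lemma target_add_rowMat (X : Mat) (y : Plane) : target K i (X + rowMat i y) = target K i X := by
  rw [target, add_rowMat_ne (add_one_ne i), target]

lemma isTerminal_fst (hs : 0 < s) (X : Mat) : IsTerminal K ((mainRule K s eps i).fst X) := by
  by_cases h : IsTerminal K X
  · rw [Rule.fst, mainRule_of_isTerminal h, smul_zero, rowMat_zero, add_zero]
    exact h
  · refine ⟨i, ?_⟩
    rw [mainRule_fst hs h, target_add_rowMat, add_rowMat_same, add_sub_cancel]

lemma mainRule_mapsTo (hK : 1 < K) (hs : 0 < s) (heps : eps ∈ Ioo (0 : ℝ) 1) {a b c : ℝ}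
    (hb : b ≤ c) (hc : (1 + s) * a + s * (K⁻¹ * b) ≤ c) (hac : a + eps ≤ c) :
    (mainRule K s eps i).MapsTo (fun X => ‖X i‖ ≤ a ∧ ‖X (i + 1)‖ ≤ b)
      (fun X => ‖X (i + 1)‖ ≤ b ∧ ‖X i‖ ≤ c) where
  lam_mem := ⟨div_pos hs (by linarith), (div_lt_one (by linarith)).2 (by linarith)⟩
  eps_mem := heps
  bounded := by
    refine ⟨(1 + s) * (K⁻¹ * b + a), fun X hX => ?_⟩
    have h0 : 0 ≤ K⁻¹ := inv_nonneg.2 (by linarith)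
    have ha : 0 ≤ a := (norm_nonneg _).trans hX.1
    have hb : 0 ≤ b := (norm_nonneg _).trans hX.2
    by_cases h : IsTerminal K X
    · rw [mainRule_of_isTerminal h, norm_zero]; positivity
    · simp only [mainRule, if_neg h]
      rw [norm_smul, Real.norm_eq_abs, abs_of_pos (by linarith)]
      gcongr
      refine (norm_sub_le _ _).trans (add_le_add ?_ hX.1)
      rw [norm_target (by linarith)]
      gcongr
      exact hX.2
  fst X hX := by
    have ha : 0 ≤ a := (norm_nonneg _).trans hX.1
    by_cases h : IsTerminal K X
    · rw [Rule.fst, mainRule_of_isTerminal h, smul_zero, rowMat_zero, add_zero]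
      exact ⟨hX.2, hX.1.trans (by linarith [heps.1])⟩
    · rw [mainRule_fst hs h, add_rowMat_ne (add_one_ne i), add_rowMat_same, add_sub_cancel,
        norm_target (by linarith)]
      refine ⟨hX.2, le_trans ?_ hb⟩
      refine le_trans (mul_le_of_le_one_left (norm_nonneg _) (inv_le_one_of_one_le₀ hK.le)) hX.2
  snd X hX := by
    have ha : 0 ≤ a := (norm_nonneg _).trans hX.1
    have h0 : 0 ≤ K⁻¹ := inv_nonneg.2 (by linarith)
    by_cases h : IsTerminal K X
    · rw [Rule.snd, mainRule_of_isTerminal h, smul_zero, rowMat_zero, sub_zero]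
      exact ⟨hX.2, hX.1.trans (by linarith [heps.1])⟩
    · rw [mainRule_snd hs h, sub_eq_add_neg, ← rowMat_neg, add_rowMat_ne (add_one_ne i),
        add_rowMat_same]
      refine ⟨hX.2, le_trans ?_ hc⟩
      have : X i + -(s • (target K i X - X i)) = (1 + s) • X i - s • target K i X := by
        rw [smul_sub, add_smul, one_smul]; abel
      rw [this]
      refine (norm_sub_le _ _).trans ?_
      rw [norm_smul, norm_smul, Real.norm_eq_abs, Real.norm_eq_abs, abs_of_pos hs,
        abs_of_pos (by linarith), norm_target (by linarith)]
      gcongr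
      · exact hX.1
      · exact hX.2
  add X g hX hg := by
    simp only [mainRule] at hg ⊢
    rw [add_rowMat_ne (add_one_ne i), add_rowMat_same]
    exact ⟨hX.2, (norm_add_le _ _).trans ((add_le_add hX.1 hg).trans hac)⟩

end mainRule

section startRule

variable {v : Plane} {i : Fin 2}

lemma startRule_fst (X : Mat) : (startRule v i).fst X = X + rowMat i (v - X i) := by
  have : (1 - 1 / 2 : ℝ) * 2 = 1 := by norm_num
  rw [Rule.fst]
  simp only [startRule, smul_smul, this, one_smul]

lemma startRule_snd (X : Mat) : (startRule v i).snd X = X - rowMat i (v - X i) := by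
  have : (1 / 2 : ℝ) * 2 = 1 := by norm_num
  rw [Rule.snd]
  simp only [startRule, smul_smul, this, one_smul]

lemma startRule_mapsTo {a b c : ℝ} (hc : 2 * a + ‖v‖ ≤ c) (hc' : a + 1 / 2 ≤ c) :
    (startRule v i).MapsTo (fun X => ‖X i‖ ≤ a ∧ ‖X (i + 1)‖ ≤ b)
      (fun X => ‖X (i + 1)‖ ≤ b ∧ ‖X i‖ ≤ c) where
  lam_mem := by norm_num [startRule]
  eps_mem := by norm_num [startRule]
  bounded := by
    refine ⟨2 * (‖v‖ + a), fun X hX => ?_⟩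
    simp only [startRule]
    rw [norm_smul, Real.norm_eq_abs, abs_two]
    gcongr
    exact (norm_sub_le _ _).trans (by gcongr; exact hX.1)
  fst X hX := by
    have ha : 0 ≤ a := (norm_nonneg _).trans hX.1
    rw [startRule_fst, add_rowMat_ne (add_one_ne i), add_rowMat_same, add_sub_cancel]
    exact ⟨hX.2, by linarith⟩
  snd X hX := by
    rw [startRule_snd, sub_eq_add_neg, ← rowMat_neg, add_rowMat_ne (add_one_ne i),
      add_rowMat_same]
    refine ⟨hX.2, le_trans ?_ hc⟩
    have : X i + -(v - X i) = (2 : ℝ) • X i - v := by rw [two_smul]; abel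
    rw [this]
    refine (norm_sub_le _ _).trans ?_
    rw [norm_smul, Real.norm_eq_abs, abs_two]
    gcongr
    exact hX.1
  add X g hX hg := by
    simp only [startRule] at hg ⊢
    rw [add_rowMat_ne (add_one_ne i), add_rowMat_same]
    exact ⟨hX.2, (norm_add_le _ _).trans ((add_le_add hX.1 hg).trans hc')⟩

end startRule

/-- The critical integrability exponent. -/
def critExp (K : ℝ) : ℝ := 2 * K / (K + 1)

/-- The factor by which the gradient moves away from its target value in the `k`-th main step. -/
def stepSize (K : ℝ) (k : ℕ) : ℝ := critExp K / (k + 1 + 1 / (K + 1))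

/-- The proportion which is lost in the `k`-th main step. -/
def stepErr (k : ℕ) : ℝ := 1 / (2 * (k + 2) ^ 2)

/-- The row which is modified in the `k`-th main step. -/
def stepRow : ℕ → Fin 2
  | 0 => 1
  | k + 1 => stepRow k + 1

/-- The rules used to construct the optimal map. -/
def rules (K ℓ : ℝ) : ℕ → Rule
  | 0 => startRule (-rot ![ℓ, 0]) 1
  | 1 => startRule ((2 : ℝ) • ![ℓ, 0]) 0
  | k + 2 => mainRule K (stepSize K k) (stepErr k) (stepRow k)

/-- The bounds on the rows of the gradient after `n` steps. -/
def GradBound (ℓ : ℝ) : ℕ → Mat → Prop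
  | 0 => fun X => ‖X 1‖ ≤ ℓ ∧ ‖X 0‖ ≤ ℓ
  | 1 => fun X => ‖X 0‖ ≤ ℓ ∧ ‖X 1‖ ≤ 4 * ℓ
  | k + 2 => fun X => ‖X (stepRow k)‖ ≤ 4 * ℓ * (k + 1) ∧ ‖X (stepRow k + 1)‖ ≤ 4 * ℓ * (k + 2)

section

variable {K ℓ : ℝ}

lemma critExp_eq (hK : 1 < K) : critExp K = 2 - 2 * (1 / (K + 1)) := by
  have : K + 1 ≠ 0 := by linarith
  rw [critExp]; field_simp; ring

lemma inv_add_one_mem (hK : 1 < K) : 1 / (K + 1) ∈ Ioo (0 : ℝ) (1 / 2) :=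
  ⟨by positivity, one_div_lt_one_div_of_lt two_pos (by linarith)⟩

lemma critExp_mem (hK : 1 < K) : critExp K ∈ Ioo (1 : ℝ) 2 := by
  have := inv_add_one_mem hK
  rw [critExp_eq hK]
  exact ⟨by linarith [this.2], by linarith [this.1]⟩

lemma stepErr_mem (k : ℕ) : stepErr k ∈ Ioc (0 : ℝ) (1 / 8) := by
  refine ⟨by rw [stepErr]; positivity, ?_⟩
  rw [stepErr]
  apply one_div_le_one_div_of_le (by norm_num)
  have : (0 : ℝ) ≤ k := k.cast_nonneg
  nlinarith

lemma stepSize_mem (hK : 1 < K) (k : ℕ) : stepSize K k ∈ Ioo (0 : ℝ) 2 := by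
  have h1 := inv_add_one_mem hK
  have h2 := critExp_mem hK
  have h3 : (0 : ℝ) ≤ k := k.cast_nonneg
  have h4 : (0 : ℝ) < k + 1 + 1 / (K + 1) := by linarith [h1.1]
  refine ⟨div_pos (by linarith [h2.1]) h4, ?_⟩
  rw [stepSize, div_lt_iff₀ h4]
  linarith [h1.1, h2.2]

lemma stepSize_spec (hK : 1 < K) (k : ℕ) :
    (k + 1 : ℝ) + stepSize K k * (k + 1 + K⁻¹ * (k + 2)) = k + 3 := by
  have h1 : K + 1 ≠ 0 := by linarith
  have h2 : K ≠ 0 := by linarith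
  have h3 : (k + 1) * (K + 1) + 1 ≠ 0 := by positivity
  rw [stepSize, critExp]
  field_simp
  ring

lemma rules_mapsTo (hK : 1 < K) (hℓ : 1 ≤ ℓ) :
    ∀ n, (rules K ℓ n).MapsTo (GradBound ℓ n) (GradBound ℓ (n + 1))
  | 0 => by
    have hn : ‖(![ℓ, 0] : Plane)‖ = ℓ := by
      simp [Pi.norm_def, Fin.univ_succ, abs_of_nonneg (zero_le_one.trans hℓ)]
    exact startRule_mapsTo (by rw [norm_neg, norm_rot, hn]; linarith) (by linarith)
  | 1 => by
    have hn : ‖(![ℓ, 0] : Plane)‖ = ℓ := by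
      simp [Pi.norm_def, Fin.univ_succ, abs_of_nonneg (zero_le_one.trans hℓ)]
    have := startRule_mapsTo (v := (2 : ℝ) • ![ℓ, 0]) (i := 0) (a := ℓ) (b := 4 * ℓ) (c := 8 * ℓ)
      (by rw [norm_smul, Real.norm_eq_abs, abs_two, hn]; linarith) (by linarith)
    have hP : GradBound ℓ (1 + 1) = fun X => ‖X (0 + 1)‖ ≤ 4 * ℓ ∧ ‖X 0‖ ≤ 8 * ℓ := by
      funext X
      have h8 : 4 * ℓ * 2 = 8 * ℓ := by ring
      simp [GradBound, stepRow, h8]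
    rw [hP]
    exact this
  | k + 2 => by
    have hs := stepSize_mem hK k
    have he := stepErr_mem k
    have := mainRule_mapsTo (i := stepRow k) (s := stepSize K k) (eps := stepErr k) hK hs.1
      ⟨he.1, by linarith [he.2]⟩
      (a := 4 * ℓ * (k + 1)) (b := 4 * ℓ * (k + 2)) (c := 4 * ℓ * (k + 3))
      (by gcongr; norm_num)
      (le_of_eq (by linear_combination 4 * ℓ * stepSize_spec hK k))
      (by nlinarith [he.2])
    have hP : GradBound ℓ (k + 2 + 1) =
        fun X => ‖X (stepRow k + 1)‖ ≤ 4 * ℓ * (k + 2) ∧ ‖X (stepRow k)‖ ≤ 4 * ℓ * (k + 3) := by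
      funext X
      have h2 : (k + 1 + 1 : ℝ) = k + 2 := by ring
      have h3 : (k + 1 + 2 : ℝ) = k + 3 := by ring
      simp only [GradBound, stepRow, add_one_add_one, Nat.cast_add, Nat.cast_one, h2, h3]
    rw [hP]
    exact this

/-- The gradients which are not terminal after `k` main steps, with `i` the row to be modified
next. -/
def IsMain (ℓ : ℝ) (k : ℕ) (i : Fin 2) (X : Mat) : Prop :=
  ∃ e : Plane, ‖e‖ = ℓ ∧ X (i + 1) = (k + 2 : ℝ) • e ∧ X i = (-((k + 1) * rowSign i)) • rot e

/-- The largest norm of a row. -/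
def rowNorm (X : Mat) : ℝ := max ‖X 0‖ ‖X 1‖

lemma rowNorm_eq (i : Fin 2) (X : Mat) : rowNorm X = max ‖X (i + 1)‖ ‖X i‖ := by
  fin_cases i
  · exact max_comm _ _
  · rfl

variable {k : ℕ} {i : Fin 2} {X : Mat}

lemma IsMain.not_isTerminal (hK : 1 < K) (hℓ : 1 ≤ ℓ) (h : IsMain ℓ k i X) :
    ¬ IsTerminal K X := by
  obtain ⟨e, he, h1, h2⟩ := h
  have he0 : e ≠ 0 := by rintro rfl; simp at he; linarith
  have hr0 : rot e ≠ 0 := by rw [← norm_ne_zero_iff, norm_rot, norm_ne_zero_iff]; exact he0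
  have hK0 : 0 < K⁻¹ := inv_pos.2 (by linarith)
  have hk : (0 : ℝ) ≤ k := k.cast_nonneg
  rintro ⟨j, hj⟩
  obtain rfl | rfl : j = i ∨ j = i + 1 := by clear hj h1 h2; revert i j; decide
  · rw [target, h1, h2, rot_smul, smul_smul] at hj
    have := smul_left_injective ℝ hr0 hj
    have hs := rowSign_mul_self j
    have h3 : 0 ≤ K⁻¹ * (k + 2) := by positivity
    nlinarith [congrArg (· * rowSign j) this]
  · rw [target, add_one_add_one, h1, h2, rot_smul, rot_rot, smul_smul, smul_neg, ← neg_smul,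
      rowSign_add_one] at hj
    have := smul_left_injective ℝ he0 hj
    have hs := rowSign_mul_self i
    have h3 : 0 ≤ K⁻¹ * (k + 1) := by positivity
    have : (k + 2 : ℝ) = -(K⁻¹ * (k + 1)) := by
      rw [this]; linear_combination (-(K⁻¹ * (k + 1))) * hs
    linarith

lemma IsMain.snd (hK : 1 < K) (hℓ : 1 ≤ ℓ) (h : IsMain ℓ k i X) (eps : ℝ) :
    IsMain ℓ (k + 1) (i + 1) ((mainRule K (stepSize K k) eps i).snd X) := by
  rw [mainRule_snd (stepSize_mem hK k).1 (h.not_isTerminal hK hℓ)]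
  obtain ⟨e, he, h1, h2⟩ := h
  refine ⟨(-rowSign i) • rot e, ?_, ?_, ?_⟩
  · rw [norm_smul, norm_rot, norm_neg, Real.norm_eq_abs, abs_rowSign, one_mul, he]
  · rw [add_one_add_one, sub_eq_add_neg, ← rowMat_neg, add_rowMat_same, target, h1, h2, rot_smul,
      smul_smul, ← sub_smul, smul_smul, ← neg_smul, ← add_smul, smul_smul]
    congr 1
    push_cast
    linear_combination (-rowSign i) * stepSize_spec hK k
  · rw [sub_eq_add_neg, ← rowMat_neg, add_rowMat_ne (add_one_ne i), h1, rot_smul, rot_rot,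
      smul_smul, rowSign_add_one, smul_neg, ← neg_smul]
    congr 1
    push_cast
    linear_combination (-(k + 2 : ℝ)) * rowSign_mul_self i

lemma IsMain.fst (hK : 1 < K) (hℓ : 1 ≤ ℓ) (h : IsMain ℓ k i X) {s eps : ℝ} (hs : 0 < s) :
    IsTerminal K ((mainRule K s eps i).fst X) ∧
      rowNorm ((mainRule K s eps i).fst X) = (k + 2) * ℓ := by
  refine ⟨isTerminal_fst hs X, ?_⟩
  rw [mainRule_fst hs (h.not_isTerminal hK hℓ)]
  obtain ⟨e, he, h1, h2⟩ := h
  have : ‖X (i + 1)‖ = (k + 2) * ℓ := by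
    rw [h1, norm_smul, he, Real.norm_eq_abs, abs_of_nonneg (by positivity)]
  rw [rowNorm_eq i, add_rowMat_ne (add_one_ne i), add_rowMat_same, add_sub_cancel,
    norm_target (by linarith), max_eq_left, this]
  exact mul_le_of_le_one_left (norm_nonneg _) (inv_le_one_of_one_le₀ hK.le)

lemma isMain_start (hℓ : 1 ≤ ℓ) (X : Mat) :
    IsMain ℓ 0 1 ((rules K ℓ 1).fst ((rules K ℓ 0).fst X)) := by
  refine ⟨![ℓ, 0], ?_, ?_, ?_⟩
  · simp [Pi.norm_def, Fin.univ_succ, abs_of_nonneg (zero_le_one.trans hℓ)]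
  · simp only [rules]
    rw [startRule_fst, show (1 + 1 : Fin 2) = 0 from rfl, add_rowMat_same, add_sub_cancel]
    simp
  · simp only [rules]
    rw [startRule_fst, add_rowMat_ne (by decide), startRule_fst, add_rowMat_same, add_sub_cancel]
    simp [rowSign]

end

/-- A bounded factor which accounts for the proportions `stepErr` lost in the main steps. -/
def lossFactor (k : ℕ) : ℝ := 2 * (k + 1) / (k + 2)

lemma lossFactor_pos (k : ℕ) : 0 < lossFactor k := by rw [lossFactor]; positivity

lemma lossFactor_le (k : ℕ) : lossFactor k ≤ 2 := by
  rw [lossFactor, div_le_iff₀ (by positivity)]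
  linarith

lemma lossFactor_succ_ge (k : ℕ) : (1 + 2 * stepErr k) * lossFactor k ≤ lossFactor (k + 1) := by
  have e : (1 + 2 * stepErr k) = ((k + 2) ^ 2 + 1) / ((k : ℝ) + 2) ^ 2 := by
    rw [stepErr]; field_simp
  rw [e, lossFactor, lossFactor, div_mul_div_comm]
  push_cast
  rw [div_le_div_iff₀ (by positivity) (by positivity)]
  nlinarith [sq_nonneg ((k : ℝ) + 2), (k.cast_nonneg : (0 : ℝ) ≤ k)]

section

variable {K : ℝ}

/-- An upper bound for the relative volume of the set which is not terminal after `k` main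
steps. -/
def upperFrac (K : ℝ) (k : ℕ) : ℝ :=
  lossFactor k * ((1 / (K + 1) + critExp K) / (k + 1 / (K + 1) + critExp K)) ^ critExp K

/-- A lower bound for the relative volume of the set which carries the main gradient after `k`
main steps. -/
def lowerFrac (K : ℝ) (k : ℕ) : ℝ :=
  1 / 16 * (lossFactor k)⁻¹ * ((1 + 1 / (K + 1)) / (k + 1 + 1 / (K + 1))) ^ critExp K

lemma upperFrac_succ (hK : 1 < K) (k : ℕ) :
    (1 - (1 - stepErr k) * (stepSize K k / (1 + stepSize K k))) * upperFrac K k ≤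
      upperFrac K (k + 1) := by
  have hb := inv_add_one_mem hK
  have hq := critExp_mem hK
  have hs := stepSize_mem hK k
  have he := stepErr_mem k
  have hk : (0 : ℝ) ≤ k := k.cast_nonneg
  have hb0 := hb.1
  have hq0 : 0 < critExp K := by linarith [hq.1]
  have hse : stepSize K k = critExp K / (k + 1 + 1 / (K + 1)) := rfl
  set b := 1 / (K + 1)
  set q := critExp K
  have hx : 0 < k + b + q := by linarith
  have hx' : 0 < k + 1 + b + q := by linarith
  have e1 : 1 - (1 - stepErr k) * (stepSize K k / (1 + stepSize K k)) =
      (1 + stepErr k * stepSize K k) * (1 + stepSize K k)⁻¹ := by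
    have : 1 + stepSize K k ≠ 0 := by linarith [hs.1]
    field_simp; ring
  have e2 : (1 + stepSize K k)⁻¹ = 1 + q * -(1 / (k + 1 + b + q)) := by
    have : k + 1 + b ≠ 0 := by linarith
    rw [hse]
    field_simp; ring
  have e3 : 1 + -(1 / (k + 1 + b + q)) = (k + b + q) / (k + 1 + b + q) := by
    field_simp; ring
  have h1 : (1 + stepSize K k)⁻¹ ≤ ((k + b + q) / (k + 1 + b + q)) ^ q := by
    rw [e2, ← e3]
    refine one_add_mul_self_le_rpow_one_add ?_ hq.1.le
    rw [neg_le_neg_iff, div_le_one hx']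
    linarith
  have h2 : 1 + stepErr k * stepSize K k ≤ 1 + 2 * stepErr k := by nlinarith [hs.2, he.1]
  have h0 : 0 < (1 + stepSize K k)⁻¹ := inv_pos.2 (by linarith [hs.1])
  have hl := lossFactor_succ_ge k
  have hl0 := lossFactor_pos k
  have h4 : ((b + q) / (k + 1 + b + q)) ^ q =
      ((k + b + q) / (k + 1 + b + q)) ^ q * ((b + q) / (k + b + q)) ^ q := by
    rw [← Real.mul_rpow (by positivity) (by positivity)]
    congr 1; field_simp
  rw [upperFrac, upperFrac, e1]
  push_cast
  rw [h4]
  calc (1 + stepErr k * stepSize K k) * (1 + stepSize K k)⁻¹ *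
        (lossFactor k * ((b + q) / (k + b + q)) ^ q) ≤
      (1 + 2 * stepErr k) * ((k + b + q) / (k + 1 + b + q)) ^ q *
        (lossFactor k * ((b + q) / (k + b + q)) ^ q) := by
        gcongr
        linarith [he.1]
    _ = ((1 + 2 * stepErr k) * lossFactor k) *
        (((k + b + q) / (k + 1 + b + q)) ^ q * ((b + q) / (k + b + q)) ^ q) := by ring
    _ ≤ _ := by gcongr

lemma lowerFrac_succ (hK : 1 < K) (k : ℕ) :
    lowerFrac K (k + 1) ≤
      (1 - stepErr k) * (1 - stepSize K k / (1 + stepSize K k)) * lowerFrac K k := by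
  have hb := inv_add_one_mem hK
  have hq := critExp_mem hK
  have hs := stepSize_mem hK k
  have he := stepErr_mem k
  have hk : (0 : ℝ) ≤ k := k.cast_nonneg
  have hb0 := hb.1
  have hq0 : 0 < critExp K := by linarith [hq.1]
  have hse : stepSize K k = critExp K / (k + 1 + 1 / (K + 1)) := rfl
  set b := 1 / (K + 1)
  set q := critExp K
  have hy : 0 < k + 1 + b := by linarith
  have hs0 : 0 < 1 + stepSize K k := by linarith [hs.1]
  have e1 : 1 - stepSize K k / (1 + stepSize K k) = (1 + stepSize K k)⁻¹ := by
    field_simp; ring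
  have e2 : 1 + stepSize K k = 1 + q * (1 / (k + 1 + b)) := by
    rw [hse]; ring
  have e3 : (1 + 1 / (k + 1 + b))⁻¹ = (k + 1 + b) / (k + 1 + 1 + b) := by
    have : k + 1 + b + 1 ≠ 0 := by linarith
    rw [show k + 1 + 1 + b = k + 1 + b + 1 by ring]
    field_simp
  have h1 : ((k + 1 + b) / (k + 1 + 1 + b)) ^ q ≤ (1 + stepSize K k)⁻¹ := by
    rw [← e3, Real.inv_rpow (by positivity)]
    apply inv_anti₀ hs0
    rw [e2]
    refine one_add_mul_self_le_rpow_one_add ?_ hq.1.le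
    have : 0 < 1 / (k + 1 + b) := by positivity
    linarith
  have hl := lossFactor_succ_ge k
  have hl0 := lossFactor_pos k
  have h2 : (lossFactor (k + 1))⁻¹ ≤ (1 - stepErr k) * (lossFactor k)⁻¹ := by
    have h3 : ((1 + 2 * stepErr k) * lossFactor k)⁻¹ ≤ (1 - stepErr k) * (lossFactor k)⁻¹ := by
      rw [mul_inv]
      gcongr
      rw [inv_le_iff_one_le_mul₀ (by linarith [he.1])]
      nlinarith [he.1, he.2]
    exact (inv_anti₀ (mul_pos (by linarith [he.1]) hl0) hl).trans h3
  have h4 : ((1 + b) / (k + 1 + 1 + b)) ^ q =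
      ((k + 1 + b) / (k + 1 + 1 + b)) ^ q * ((1 + b) / (k + 1 + b)) ^ q := by
    rw [← Real.mul_rpow (by positivity) (by positivity)]
    congr 1; field_simp
  have he1 : 0 ≤ 1 - stepErr k := by linarith [he.2]
  rw [lowerFrac, lowerFrac, e1]
  push_cast
  rw [h4]
  calc 1 / 16 * (lossFactor (k + 1))⁻¹ *
        (((k + 1 + b) / (k + 1 + 1 + b)) ^ q * ((1 + b) / (k + 1 + b)) ^ q) ≤
      1 / 16 * ((1 - stepErr k) * (lossFactor k)⁻¹) *
        ((1 + stepSize K k)⁻¹ * ((1 + b) / (k + 1 + b)) ^ q) := by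
        gcongr
    _ = _ := by ring

lemma upperFrac_le (hK : 1 < K) (k : ℕ) :
    upperFrac K k ≤ 8 * ((k : ℝ) + 1) ^ (-critExp K) := by
  have hb := inv_add_one_mem hK
  have hq := critExp_mem hK
  have hk : (0 : ℝ) ≤ k := k.cast_nonneg
  have e := critExp_eq hK
  have hb0 := hb.1
  have hq0 : 0 < critExp K := by linarith [hq.1]
  rw [upperFrac]
  set b := 1 / (K + 1)
  have h1 : (b + critExp K) / (k + b + critExp K) ≤ 2 / (k + 1) :=
    div_le_div₀ two_pos.le (by linarith) (by linarith) (by linarith [hb.2])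
  have h2 : (2 : ℝ) ^ critExp K ≤ 4 := by
    calc (2 : ℝ) ^ critExp K ≤ 2 ^ (2 : ℝ) := Real.rpow_le_rpow_of_exponent_le (by norm_num) hq.2.le
      _ = 4 := by norm_num
  calc lossFactor k * ((b + critExp K) / (k + b + critExp K)) ^ critExp K ≤
      2 * (2 / (k + 1)) ^ critExp K := by
        gcongr
        exact lossFactor_le k
    _ = 2 * (2 ^ critExp K * ((k : ℝ) + 1) ^ (-critExp K)) := by
        rw [Real.div_rpow (by norm_num) (by positivity), Real.rpow_neg (by positivity),
          div_eq_mul_inv]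
    _ ≤ 2 * (4 * ((k : ℝ) + 1) ^ (-critExp K)) := by gcongr
    _ = _ := by ring

lemma lowerFrac_ge (hK : 1 < K) (k : ℕ) :
    1 / 32 * ((k : ℝ) + 4) ^ (-critExp K) ≤ lowerFrac K k := by
  have hb := inv_add_one_mem hK
  have hq := critExp_mem hK
  have hk : (0 : ℝ) ≤ k := k.cast_nonneg
  have hb0 := hb.1
  have hq0 : 0 < critExp K := by linarith [hq.1]
  rw [lowerFrac]
  set b := 1 / (K + 1)
  have h1 : ((k : ℝ) + 4)⁻¹ ≤ (1 + b) / (k + 1 + b) := by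
    rw [inv_eq_one_div]
    exact div_le_div₀ (by linarith) (by linarith) (by linarith) (by linarith [hb.2])
  have h2 : (2 : ℝ)⁻¹ ≤ (lossFactor k)⁻¹ := inv_anti₀ (lossFactor_pos k) (lossFactor_le k)
  rw [Real.rpow_neg (by positivity), ← Real.inv_rpow (by positivity)]
  calc 1 / 32 * ((k : ℝ) + 4)⁻¹ ^ critExp K = 1 / 16 * 2⁻¹ * ((k : ℝ) + 4)⁻¹ ^ critExp K := by ring
    _ ≤ _ := by gcongr

lemma lam_ge (hK : 1 < K) (k : ℕ) :
    ((k : ℝ) + 4)⁻¹ ≤ stepSize K k / (1 + stepSize K k) := by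
  have hb := inv_add_one_mem hK
  have hq := critExp_mem hK
  have hk : (0 : ℝ) ≤ k := k.cast_nonneg
  have e := critExp_eq hK
  have hb0 := hb.1
  have hq0 : 0 < critExp K := by linarith [hq.1]
  rw [stepSize]
  set b := 1 / (K + 1)
  have : k + 1 + b ≠ 0 := by linarith
  have e2 : critExp K / (k + 1 + b) / (1 + critExp K / (k + 1 + b)) =
      critExp K / (k + 1 + b + critExp K) := by
    field_simp
  rw [e2, inv_eq_one_div]
  exact div_le_div₀ hq0.le hq.1.le (by linarith) (by linarith)

end

namespace IsScheme

variable {Ω : Set Plane} {A : Mat} {K ℓ α κ : ℝ} {w : ℕ → Plane → Plane} {G : ℕ → Plane → Mat}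
  {𝒮 : ℕ → Set (Set Plane)}

lemma volume_not_isTerminal_le (h : IsScheme Ω A (rules K ℓ) (GradBound ℓ) α κ w G 𝒮)
    (hK : 1 < K) (hΩ : volume Ω ≠ ⊤) (k : ℕ) :
    volume {x ∈ Ω | ¬ IsTerminal K (G (k + 2) x)} ≤
      ENNReal.ofReal (8 * ((k : ℝ) + 1) ^ (-critExp K)) * volume Ω := by
  suffices H : volume {x ∈ Ω | ¬ IsTerminal K (G (k + 2) x)} ≤
      ENNReal.ofReal (upperFrac K k) * volume Ω from H.trans (by gcongr; exact upperFrac_le hK k)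
  induction k with
  | zero =>
    have hb := inv_add_one_mem hK
    have hq := critExp_mem hK
    have : upperFrac K 0 = 1 := by
      rw [upperFrac, lossFactor]
      simp only [CharP.cast_eq_zero, zero_add]
      rw [div_self (by linarith [hb.1, hq.1]), Real.one_rpow]
      norm_num
    rw [this, ENNReal.ofReal_one, one_mul]
    exact measure_mono fun x hx => hx.1
  | succ k ih =>
    have hs := stepSize_mem hK k
    have he := stepErr_mem k
    have hs1 : stepSize K k / (1 + stepSize K k) ≤ 1 := by
      rw [div_le_one (by linarith [hs.1])]; linarith
    have hs0 : 0 ≤ stepSize K k / (1 + stepSize K k) := div_nonneg hs.1.le (by linarith [hs.1])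
    refine (h.volume_not_le hΩ (k + 2) (Q := IsTerminal K) ⟨hs0, hs1⟩
      ⟨he.1.le, he.2.trans (by norm_num)⟩ (isTerminal_fst hs.1)
      fun X => mainRule_of_isTerminal).trans ?_
    calc ENNReal.ofReal (1 - (1 - stepErr k) * (stepSize K k / (1 + stepSize K k))) *
          volume {x ∈ Ω | ¬ IsTerminal K (G (k + 2) x)} ≤
        ENNReal.ofReal (1 - (1 - stepErr k) * (stepSize K k / (1 + stepSize K k))) *
          (ENNReal.ofReal (upperFrac K k) * volume Ω) := by gcongr
      _ = ENNReal.ofReal ((1 - (1 - stepErr k) * (stepSize K k / (1 + stepSize K k))) *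
          upperFrac K k) * volume Ω := by
        rw [← mul_assoc, ENNReal.ofReal_mul]
        nlinarith [he.1, he.2]
      _ ≤ _ := by gcongr; exact upperFrac_succ hK k

lemma volume_isMain_ge (h : IsScheme Ω A (rules K ℓ) (GradBound ℓ) α κ w G 𝒮)
    (hK : 1 < K) (hℓ : 1 ≤ ℓ) (k : ℕ) :
    ENNReal.ofReal (lowerFrac K k) * volume Ω ≤
      volume {x ∈ Ω | IsMain ℓ k (stepRow k) (G (k + 2) x)} := by
  induction k with
  | zero =>
    have h0 := h.volume_fst_le 0 (Q := fun _ => True)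
      (Q' := fun X => ∃ Y, X = (rules K ℓ 0).fst Y) fun X _ => ⟨X, rfl⟩
    have h1 := h.volume_fst_le 1 (Q := fun X => ∃ Y, X = (rules K ℓ 0).fst Y)
      (Q' := IsMain ℓ 0 1) (by rintro _ ⟨Y, rfl⟩; exact isMain_start hℓ Y)
    have hb := inv_add_one_mem hK
    have e : lowerFrac K 0 = (1 - 1 / 2) * (1 / 2) * ((1 - 1 / 2) * (1 / 2)) := by
      rw [lowerFrac, lossFactor]
      simp only [CharP.cast_eq_zero, zero_add]
      rw [div_self (by linarith [hb.1]), Real.one_rpow]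
      norm_num
    refine le_trans ?_ h1
    rw [e, ENNReal.ofReal_mul (by norm_num), mul_assoc]
    refine mul_le_mul_right (le_trans (le_of_eq ?_) h0) _
    simp [rules, startRule]
  | succ k ih =>
    have hs := stepSize_mem hK k
    have he := stepErr_mem k
    have hs1 : stepSize K k / (1 + stepSize K k) ≤ 1 := by
      rw [div_le_one (by linarith [hs.1])]; linarith
    have h1 := h.volume_snd_le (k + 2) (Q := IsMain ℓ k (stepRow k))
      (Q' := IsMain ℓ (k + 1) (stepRow (k + 1))) fun X hX => hX.snd hK hℓ _
    refine le_trans ?_ h1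
    calc _ ≤ ENNReal.ofReal ((1 - stepErr k) * (1 - stepSize K k / (1 + stepSize K k)) *
          lowerFrac K k) * volume Ω := by gcongr; exact lowerFrac_succ hK k
      _ = ENNReal.ofReal ((1 - stepErr k) * (1 - stepSize K k / (1 + stepSize K k))) *
          (ENNReal.ofReal (lowerFrac K k) * volume Ω) := by
        rw [ENNReal.ofReal_mul (mul_nonneg (by linarith [he.2]) (by linarith)), mul_assoc]
      _ ≤ _ := mul_le_mul_right ih _

lemma volume_terminal_ge (h : IsScheme Ω A (rules K ℓ) (GradBound ℓ) α κ w G 𝒮)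
    (hK : 1 < K) (hℓ : 1 ≤ ℓ) (k : ℕ) :
    ENNReal.ofReal (1 / 64 * (((k : ℝ) + 4)⁻¹ * ((k : ℝ) + 4) ^ (-critExp K))) * volume Ω ≤
      volume {x ∈ Ω | IsTerminal K (G (k + 3) x) ∧ rowNorm (G (k + 3) x) = (k + 2) * ℓ} := by
  have hs := stepSize_mem hK k
  have he := stepErr_mem k
  have h1 := h.volume_fst_le (k + 2) (Q := IsMain ℓ k (stepRow k))
    (Q' := fun X => IsTerminal K X ∧ rowNorm X = (k + 2) * ℓ) fun X hX => hX.fst hK hℓ hs.1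
  refine le_trans ?_ h1
  have h2 := lam_ge hK k
  have h3 := lowerFrac_ge hK k
  have h4 : 0 ≤ stepSize K k / (1 + stepSize K k) := div_nonneg hs.1.le (by linarith [hs.1])
  have h5 : 1 / 2 ≤ 1 - stepErr k := by linarith [he.2]
  calc _ = ENNReal.ofReal (1 / 2 * ((k : ℝ) + 4)⁻¹ * (1 / 32 * ((k : ℝ) + 4) ^ (-critExp K))) *
        volume Ω := by congr 2; ring
    _ ≤ ENNReal.ofReal ((1 - stepErr k) * (stepSize K k / (1 + stepSize K k)) * lowerFrac K k) *
        volume Ω := by gcongr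
    _ = ENNReal.ofReal ((1 - stepErr k) * (stepSize K k / (1 + stepSize K k))) *
        (ENNReal.ofReal (lowerFrac K k) * volume Ω) := by
      rw [ENNReal.ofReal_mul (mul_nonneg (by linarith [he.2]) h4), mul_assoc]
    _ ≤ _ := mul_le_mul_right (h.volume_isMain_ge hK hℓ k) _

end IsScheme

/-- `u, H, 𝒮'` is the limit of the sequence of maps `w n` with gradients `G n`, all the gradients
in the limit satisfying `T`. -/
structure IsLimitOf (Ω : Set Plane) (A : Mat) (T : Mat → Prop) (α κ : ℝ) (w : ℕ → Plane → Plane)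
    (G : ℕ → Plane → Mat) (u : Plane → Plane) (H : Plane → Mat) (𝒮' : Set (Set Plane)) :
    Prop where
  decomp : IsDecomp Ω 𝒮'
  off : ∀ x ∉ Ω, u x = 0
  norm_le : ∀ n x, ‖u x - w n x‖ ≤ κ / 2 ^ n
  norm_le' : ∀ x, ‖u x‖ ≤ κ
  holder : ∀ x y, ‖u x - u y‖ ≤ κ * dist x y ^ α
  grad_off : ∀ x ∉ Ω, H x = A
  affine : ∀ V ∈ 𝒮', ∃ X c, T X ∧ ∀ x ∈ V, H x = X ∧ u x = lmap (X - A) c x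
  grad_eq : ∀ n, ∀ᵐ x, (x ∈ Ω → T (G (n + 2) x)) → H x = G (n + 2) x

namespace IsScheme

variable {Ω : Set Plane} {A : Mat} {r : ℕ → Rule} {P : ℕ → Mat → Prop} {α κ : ℝ}
  {w : ℕ → Plane → Plane} {G : ℕ → Plane → Mat} {𝒮 : ℕ → Set (Set Plane)} {T : Mat → Prop}

lemma keep (h : IsScheme Ω A r P α κ w G 𝒮) (hT : ∀ n X, T X → (r (n + 2)).dir X = 0) {n : ℕ}
    {V : Set Plane} (hV : V ∈ 𝒮 (n + 2)) {x : Plane} (hx : x ∈ V) (hTx : T (G (n + 2) x)) {m : ℕ}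
    (hm : n ≤ m) : V ∈ 𝒮 (m + 2) ∧ w (m + 2) x = w (n + 2) x ∧ G (m + 2) x = G (n + 2) x := by
  induction m, hm using Nat.le_induction with
  | base => exact ⟨hV, rfl, rfl⟩
  | succ m _ ih =>
    obtain ⟨h1, h2, h3⟩ := ih
    obtain ⟨h4, h5, h6⟩ := (h.step (m + 2)).keep V h1 x hx (hT m _ (by rwa [h3]))
    exact ⟨h4, h5.trans h2, h6.trans h3⟩

lemma exists_isLimitOf (h : IsScheme Ω A r P α κ w G 𝒮)
    (hT : ∀ n X, T X → (r (n + 2)).dir X = 0)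
    (hN : Tendsto (fun n => volume {x ∈ Ω | ¬ T (G (n + 2) x)}) atTop (𝓝 0)) :
    ∃ u H 𝒮', IsLimitOf Ω A T α κ w G u H 𝒮' := by
  classical
  have hκ : 0 ≤ κ / 2 := by simpa using (abs_nonneg _).trans ((h.step 0).abs_le 0 0)
  have hd : ∀ x n, dist (w n x) (w (n + 1) x) ≤ κ / 2 / 2 ^ n := fun x n => by
    rw [dist_comm, dist_pi_le_iff (by positivity)]
    exact fun k => (h.step n).abs_le x k
  choose u hu using fun x => cauchySeq_tendsto_of_complete (cauchySeq_of_le_geometric_two (hd x))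
  have hle : ∀ n x, ‖u x - w n x‖ ≤ κ / 2 ^ n := fun n x => by
    rw [← dist_eq_norm, dist_comm]
    exact dist_le_of_le_geometric_two_of_tendsto (hd x) (hu x) n
  let H : Plane → Mat := fun x =>
    if hx : ∃ n, ∃ V ∈ 𝒮 (n + 2), x ∈ V ∧ T (G (n + 2) x) then G (hx.choose + 2) x else A
  have hHu : ∀ {n : ℕ} {V : Set Plane} {x : Plane}, V ∈ 𝒮 (n + 2) → x ∈ V → T (G (n + 2) x) →
      H x = G (n + 2) x ∧ u x = w (n + 2) x := by
    intro n V x hV hx hTx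
    constructor
    · have hex : ∃ n, ∃ V ∈ 𝒮 (n + 2), x ∈ V ∧ T (G (n + 2) x) := ⟨n, V, hV, hx, hTx⟩
      obtain ⟨V', hV', hx', hTx'⟩ := hex.choose_spec
      simp only [H, dif_pos hex]
      rcases le_total n hex.choose with hc | hc
      · exact (h.keep hT hV hx hTx hc).2.2
      · exact (h.keep hT hV' hx' hTx' hc).2.2.symm
    · refine tendsto_nhds_unique (hu x) (tendsto_const_nhds.congr' ?_)
      filter_upwards [eventually_ge_atTop (n + 2)] with m hm
      obtain ⟨m, rfl⟩ := Nat.exists_eq_add_of_le' (show 2 ≤ m by omega)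
      exact (h.keep hT hV hx hTx (by omega)).2.1.symm
  let 𝒮' : Set (Set Plane) := {V | ∃ n, V ∈ 𝒮 (n + 2) ∧ ∀ x ∈ V, T (G (n + 2) x)}
  have hcover : ∀ n, Ω \ ⋃₀ 𝒮' ⊆ {x ∈ Ω | ¬ T (G (n + 2) x)} ∪ (Ω \ ⋃₀ 𝒮 (n + 2)) := by
    intro n x hx
    by_cases hx' : x ∈ ⋃₀ 𝒮 (n + 2)
    · obtain ⟨V, hV, hxV⟩ := hx'
      refine Or.inl ⟨hx.1, fun hTx => hx.2 ⟨V, ⟨n, hV, fun y hy => ?_⟩, hxV⟩⟩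
      rwa [(h.stage (n + 2)).const hV hy hxV]
    · exact Or.inr ⟨hx.1, hx'⟩
  have hoff : ∀ x ∉ Ω, H x = A := fun x hx => by
    have : ¬ ∃ n, ∃ V ∈ 𝒮 (n + 2), x ∈ V ∧ T (G (n + 2) x) := by
      rintro ⟨n, V, hV, hxV, -⟩
      exact hx ((h.stage (n + 2)).decomp.subset V hV hxV)
    simp only [H, dif_neg this]
  refine ⟨u, H, 𝒮', ⟨⟨?_, ?_, ?_, ?_, ?_⟩, ?_, hle, ?_, ?_, hoff, ?_, ?_⟩⟩
  · refine (countable_iUnion fun n => (h.stage (n + 2)).decomp.countable).mono ?_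
    rintro V ⟨n, hV, -⟩
    exact mem_iUnion.2 ⟨n, hV⟩
  · rintro V ⟨n, hV, -⟩
    exact (h.stage (n + 2)).decomp.regular V hV
  · rintro V ⟨n, hV, -⟩
    exact (h.stage (n + 2)).decomp.subset V hV
  · rintro V ⟨n, hV, hVT⟩ V' ⟨n', hV', hVT'⟩ hne
    obtain ⟨x, hx⟩ := ((h.stage (n + 2)).decomp.regular V hV).2.2.1.nonempty
    obtain ⟨x', hx'⟩ := ((h.stage (n' + 2)).decomp.regular V' hV').2.2.1.nonempty
    exact (h.stage (max n n' + 2)).decomp.disjoint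
      (h.keep hT hV hx (hVT x hx) (le_max_left n n')).1
      (h.keep hT hV' hx' (hVT' x' hx') (le_max_right n n')).1 hne
  · refine le_antisymm (ge_of_tendsto' hN fun n => ?_) zero_le
    refine (measure_mono (hcover n)).trans ((measure_union_le _ _).trans ?_)
    rw [(h.stage (n + 2)).decomp.null, add_zero]
  · intro x hx
    refine tendsto_nhds_unique (hu x) (tendsto_const_nhds.congr fun n => ?_)
    rw [(h.stage n).off x hx]
  · intro x
    have := hle 0 x
    rwa [h.zero.1, Pi.zero_apply, sub_zero, pow_zero, div_one] at this
  · intro x y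
    have h0 : dist (w 0 x - w 0 y) (u x - u y) ≤ κ * dist x y ^ α := by
      refine dist_le_of_le_geometric_two_of_tendsto₀ (f := fun n => w n x - w n y) (fun n => ?_)
        ((hu x).sub (hu y))
      have hh : 0 ≤ dist x y ^ α := Real.rpow_nonneg dist_nonneg _
      rw [dist_comm, dist_pi_le_iff (by rw [mul_div_right_comm]; positivity)]
      intro k
      rw [Real.dist_eq, mul_div_right_comm, mul_div_right_comm]
      refine le_trans (le_of_eq ?_) ((h.step n).holder x y k)
      congr 1
      simp only [Pi.sub_apply]
      ring
    rwa [h.zero.1, Pi.zero_apply, Pi.zero_apply, sub_zero, dist_zero_left] at h0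
  · rintro V ⟨n, hV, hVT⟩
    obtain ⟨X, c, -, hX⟩ := (h.stage (n + 2)).affine V hV
    obtain ⟨x, hx⟩ := ((h.stage (n + 2)).decomp.regular V hV).2.2.1.nonempty
    refine ⟨X, c, (hX x hx).1 ▸ hVT x hx, fun y hy => ?_⟩
    obtain ⟨h1, h2⟩ := hHu hV hy (hVT y hy)
    exact ⟨h1.trans (hX y hy).1, h2.trans (hX y hy).2⟩
  · intro n
    have hnull : ∀ᵐ x, x ∉ Ω \ ⋃₀ 𝒮 (n + 2) :=
      measure_eq_zero_iff_ae_notMem.1 (h.stage (n + 2)).decomp.null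
    filter_upwards [hnull] with x hx hTx
    by_cases hxΩ : x ∈ Ω
    · have : x ∈ ⋃₀ 𝒮 (n + 2) := by_contra fun hx' => hx ⟨hxΩ, hx'⟩
      obtain ⟨V, hV, hxV⟩ := this
      exact (hHu hV hxV (hTx hxΩ)).1
    · rw [hoff x hxΩ, (h.stage (n + 2)).grad_off x hxΩ]

end IsScheme

namespace IsLimitOf

variable {Ω : Set Plane} {A : Mat} {T : Mat → Prop} {α κ : ℝ} {w : ℕ → Plane → Plane}
  {G : ℕ → Plane → Mat} {u : Plane → Plane} {H : Plane → Mat} {𝒮' : Set (Set Plane)}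

lemma ae_property (h : IsLimitOf Ω A T α κ w G u H 𝒮') : ∀ᵐ x, x ∈ Ω → T (H x) := by
  filter_upwards [measure_eq_zero_iff_ae_notMem.1 h.decomp.null] with x hx hxΩ
  have : x ∈ ⋃₀ 𝒮' := by_contra fun hx' => hx ⟨hxΩ, hx'⟩
  obtain ⟨V, hV, hxV⟩ := this
  obtain ⟨X, c, hX, hV'⟩ := h.affine V hV
  rwa [(hV' x hxV).1]

/-- Every function of the limit gradient is measurable. -/
lemma aemeasurable_comp (h : IsLimitOf Ω A T α κ w G u H 𝒮') {β : Type*} [MeasurableSpace β]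
    (F : Mat → β) : AEMeasurable (fun x => F (H x)) (volume.restrict Ω) := by
  have := h.decomp.countable.to_subtype
  have e : volume.restrict Ω = volume.restrict (⋃ V : 𝒮', V.1) := by
    refine Measure.restrict_congr_set (ae_eq_set.2 ⟨?_, ?_⟩)
    · rw [← sUnion_eq_iUnion]; exact h.decomp.null
    · have hsub : ⋃ V : 𝒮', V.1 ⊆ Ω := iUnion_subset fun V => h.decomp.subset V V.2
      rw [sdiff_eq_empty.2 hsub, measure_empty]
  rw [e, aemeasurable_iUnion_iff]
  intro V
  obtain ⟨X, c, -, hX⟩ := h.affine V V.2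
  refine (aemeasurable_const (b := F X)).congr ?_
  filter_upwards [ae_restrict_mem (h.decomp.regular V V.2).1.measurableSet] with x hx
  rw [(hX x hx).1]

end IsLimitOf

namespace IsLimitOf

variable {Ω : Set Plane} {A : Mat} {T : Mat → Prop} {α κ : ℝ} {w : ℕ → Plane → Plane}
  {G : ℕ → Plane → Mat} {u : Plane → Plane} {H : Plane → Mat} {𝒮' : Set (Set Plane)}

lemma tendsto_integral_fun (h : IsLimitOf Ω A T α κ w G u H 𝒮')
    (hw : ∀ n, Continuous (w n)) {g : Plane → ℝ} (hg : Continuous g)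
    (hg' : HasCompactSupport g) (k : Fin 2) :
    Tendsto (fun n => ∫ x, w n x k * g x) atTop (𝓝 (∫ x, u x k * g x)) := by
  have hgi : Integrable g := hg.integrable_of_hasCompactSupport hg'
  have hκ : 0 ≤ κ := (norm_nonneg _).trans (h.norm_le' 0)
  refine tendsto_integral_of_dominated_convergence (fun x => 2 * κ * ‖g x‖) (fun n => ?_)
    (hgi.norm.const_mul _) (fun n => ae_of_all _ fun x => ?_) (ae_of_all _ fun x => ?_)
  · exact ((continuous_pi_iff.1 (hw n) k).mul hg).aestronglyMeasurable
  · rw [norm_mul]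
    gcongr
    refine (norm_le_pi_norm _ k).trans ?_
    have h1 := norm_sub_norm_le (w n x) (u x)
    rw [norm_sub_rev] at h1
    have h2 : κ / 2 ^ n ≤ κ := div_le_self hκ (one_le_pow₀ (by norm_num))
    linarith [h.norm_le n x, h.norm_le' x]
  · refine Tendsto.mul_const _ (tendsto_pi_nhds.1 ?_ k)
    rw [tendsto_iff_norm_sub_tendsto_zero]
    refine squeeze_zero (g := fun n => κ / 2 ^ n) (fun n => norm_nonneg _)
      (fun n => (norm_sub_rev _ _).trans_le (h.norm_le n x)) ?_
    have := (tendsto_pow_atTop_nhds_zero_of_lt_one (r := (1 / 2 : ℝ)) (by norm_num)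
      (by norm_num)).const_mul κ
    simpa [div_eq_mul_inv] using this

lemma tendsto_integral_grad (h : IsLimitOf Ω A T α κ w G u H 𝒮') (hΩ : IsOpen Ω)
    {P : ℕ → Mat → Prop} {𝒮 : ℕ → Set (Set Plane)} (hs : ∀ n, IsStage Ω A (P n) (w n) (G n) (𝒮 n))
    {B : ℕ → ℝ} (hB : ∀ n X, P (n + 2) X → ∀ k, ‖X k‖ ≤ B n)
    (hN : Tendsto (fun n => volume {x ∈ Ω | ¬ T (G (n + 2) x)}) atTop (𝓝 0))
    (hBN : Tendsto (fun n => ENNReal.ofReal (B n) * volume {x ∈ Ω | ¬ T (G (n + 2) x)})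
      atTop (𝓝 0))
    {k i : Fin 2} (hint : IntegrableOn (fun x => H x k i) Ω) {g : Plane → ℝ} (hg : Continuous g)
    (hg' : HasCompactSupport g) :
    Tendsto (fun n => ∫ x, (G (n + 2) x k - A k) i * g x) atTop
      (𝓝 (∫ x, (H x k - A k) i * g x)) := by
  obtain ⟨C, hC⟩ := hg'.exists_bound_of_continuous hg
  have hmG : ∀ n, Measurable fun x => (G n x k - A k) i := fun n =>
    (measurable_pi_apply i).comp (((hs n).measurable k).sub_const _)
  have e1 : ∀ n, ∫ x, (G (n + 2) x k - A k) i * g x = ∫ x in Ω, (G (n + 2) x k - A k) i * g x :=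
    fun n => (setIntegral_eq_integral_of_forall_compl_eq_zero fun x hx => by
      rw [(hs (n + 2)).grad_off x hx]; simp).symm
  have e2 : ∫ x, (H x k - A k) i * g x = ∫ x in Ω, (H x k - A k) i * g x :=
    (setIntegral_eq_integral_of_forall_compl_eq_zero fun x hx => by
      rw [h.grad_off x hx]; simp).symm
  simp only [e1, e2]
  let S : ℕ → Set Plane := fun n => toMeasurable volume {x ∈ Ω | ¬ T (G (n + 2) x)}
  have hSm : ∀ n, MeasurableSet (S n) := fun n => measurableSet_toMeasurable _ _
  have hSv : ∀ n, volume.restrict Ω (S n) ≤ volume {x ∈ Ω | ¬ T (G (n + 2) x)} := fun n =>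
    (Measure.restrict_apply_le _ _).trans (measure_toMeasurable _).le
  refine tendsto_integral_of_L1 _ ?_ (Eventually.of_forall fun n => ?_) ?_
  · refine AEStronglyMeasurable.mul ?_ hg.aestronglyMeasurable
    exact (h.aemeasurable_comp fun X => (X k - A k) i).aestronglyMeasurable
  · obtain ⟨D, hD⟩ := (hs (n + 2)).bounded
    refine (integrable_mul_of_bounded (C := D + ‖A k‖) (hmG _) (fun x => ?_) hg hg').integrableOn
    exact (norm_le_pi_norm (G (n + 2) x k - A k) i).trans
      ((norm_sub_le _ _).trans (add_le_add_left (hD x k) _))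
  · have hbound : ∀ n, ∫⁻ x in Ω, ‖(G (n + 2) x k - A k) i * g x - (H x k - A k) i * g x‖ₑ ≤
        (ENNReal.ofReal (B n) * volume {x ∈ Ω | ¬ T (G (n + 2) x)} +
          ∫⁻ x in S n, ‖H x k i‖ₑ ∂(volume.restrict Ω)) * ENNReal.ofReal C := by
      intro n
      have hnull : ∀ᵐ x, x ∉ Ω \ ⋃₀ 𝒮 (n + 2) :=
        measure_eq_zero_iff_ae_notMem.1 (hs (n + 2)).decomp.null
      calc _ ≤ ∫⁻ x in Ω, (S n).indicator
            (fun x => (ENNReal.ofReal (B n) + ‖H x k i‖ₑ) * ENNReal.ofReal C) x := by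
            refine lintegral_mono_ae ?_
            filter_upwards [ae_restrict_of_ae (h.grad_eq n), ae_restrict_of_ae hnull,
              ae_restrict_mem hΩ.measurableSet] with x hx hx' hxΩ
            by_cases hT : T (G (n + 2) x)
            · rw [hx fun _ => hT]; simp
            · have hmem : x ∈ S n := subset_toMeasurable _ _ ⟨hxΩ, hT⟩
              rw [indicator_of_mem hmem]
              have hxS : x ∈ ⋃₀ 𝒮 (n + 2) := by_contra fun hxS => hx' ⟨hxΩ, hxS⟩
              obtain ⟨V, hV, hxV⟩ := hxS
              have hGB : |G (n + 2) x k i| ≤ B n :=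
                (norm_le_pi_norm _ i).trans (hB n _ ((hs (n + 2)).pred hV hxV) k)
              have hCx : ‖g x‖ₑ ≤ ENNReal.ofReal C := by
                rw [← ofReal_norm]; exact ENNReal.ofReal_le_ofReal (hC x)
              rw [← sub_mul, enorm_mul]
              refine mul_le_mul' ?_ hCx
              rw [Pi.sub_apply, Pi.sub_apply, sub_sub_sub_cancel_right]
              refine enorm_sub_le.trans ?_
              gcongr
              rw [← ofReal_norm]
              exact ENNReal.ofReal_le_ofReal hGB
        _ = ∫⁻ x in S n, (ENNReal.ofReal (B n) + ‖H x k i‖ₑ) * ENNReal.ofReal C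
            ∂(volume.restrict Ω) := lintegral_indicator (hSm n) _
        _ = (ENNReal.ofReal (B n) * volume.restrict Ω (S n) +
            ∫⁻ x in S n, ‖H x k i‖ₑ ∂(volume.restrict Ω)) * ENNReal.ofReal C := by
            rw [lintegral_mul_const' _ _ ENNReal.ofReal_ne_top,
              lintegral_add_left measurable_const, lintegral_const,
              Measure.restrict_apply_univ]
        _ ≤ _ := mul_le_mul_left (add_le_add_left (mul_le_mul_right (hSv n) _) _) _
    refine tendsto_of_tendsto_of_tendsto_of_le_of_le tendsto_const_nhds ?_ (fun n => zero_le)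
      hbound
    have h1 : Tendsto (fun n => ∫⁻ x in S n, ‖H x k i‖ₑ ∂(volume.restrict Ω)) atTop (𝓝 0) :=
      tendsto_setLIntegral_zero hint.2.ne
        (tendsto_of_tendsto_of_tendsto_of_le_of_le tendsto_const_nhds hN (fun n => zero_le) hSv)
    have h2 := ENNReal.Tendsto.mul_const (hBN.add h1)
      (Or.inr (ENNReal.ofReal_ne_top (r := C)))
    simpa using h2

lemma isWeakGrad (h : IsLimitOf Ω A T α κ w G u H 𝒮') (hΩ : IsOpen Ω)
    {P : ℕ → Mat → Prop} {𝒮 : ℕ → Set (Set Plane)} (hs : ∀ n, IsStage Ω A (P n) (w n) (G n) (𝒮 n))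
    {B : ℕ → ℝ} (hB : ∀ n X, P (n + 2) X → ∀ k, ‖X k‖ ≤ B n)
    (hN : Tendsto (fun n => volume {x ∈ Ω | ¬ T (G (n + 2) x)}) atTop (𝓝 0))
    (hBN : Tendsto (fun n => ENNReal.ofReal (B n) * volume {x ∈ Ω | ¬ T (G (n + 2) x)})
      atTop (𝓝 0))
    (hint : ∀ k i, IntegrableOn (fun x => H x k i) Ω) (k : Fin 2) :
    IsWeakGrad (fun x => u x k) (fun x => H x k - A k) := by
  intro φ hφ hφ' i
  have hφ1 : ContDiff ℝ 1 φ := by exact_mod_cast hφ 1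
  have hd : Continuous fun x => fderiv ℝ φ x (Pi.single i 1) :=
    (hφ1.continuous_fderiv (by simp)).clm_apply continuous_const
  have hd' : HasCompactSupport fun x => fderiv ℝ φ x (Pi.single i 1) :=
    (hφ'.fderiv ℝ).comp_left (g := fun L : Plane →L[ℝ] ℝ => L (Pi.single i 1)) (by simp)
  have h1 := (h.tendsto_integral_fun (fun n => (hs n).continuous) hd hd' k).comp
    (tendsto_add_atTop_nat 2)
  have h2 := (h.tendsto_integral_grad hΩ hs hB hN hBN (hint k i) hφ1.continuous hφ').neg
  refine tendsto_nhds_unique (h1.congr fun n => ?_) h2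
  exact (hs (n + 2)).weak k φ hφ hφ' i

end IsLimitOf

section tails

variable {X : Type*} [MeasurableSpace X] {μ : Measure X} {f : X → ℝ} {q : ℝ}

/-- A function with tails of order `t ^ (-q)` is `p`-integrable for all `p < q`. -/
lemma integrable_rpow_of_meas_lt_le [IsFiniteMeasure μ] (hf : ∀ x, 0 ≤ f x)
    (hm : AEMeasurable f μ) {C : ℝ}
    (h : ∀ t : ℝ, 1 < t → μ {x | t < f x} ≤ ENNReal.ofReal (C * t ^ (-q))) {p : ℝ} (hp : 1 ≤ p)
    (hpq : p < q) : Integrable (fun x => f x ^ p) μ := by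
  have hp0 : 0 < p := by linarith
  rw [← lintegral_ofReal_ne_top_iff_integrable (hm.pow_const p).aestronglyMeasurable
    (ae_of_all _ fun x => Real.rpow_nonneg (hf x) p),
    lintegral_rpow_eq_lintegral_meas_lt_mul μ (ae_of_all _ hf) hm hp0]
  refine ENNReal.mul_ne_top ENNReal.ofReal_ne_top ?_
  rw [← Ioc_union_Ioi_eq_Ioi zero_le_one]
  refine ((lintegral_union_le _ _ _).trans_lt (ENNReal.add_lt_top.2 ⟨?_, ?_⟩)).ne
  · calc ∫⁻ t in Ioc 0 1, μ {x | t < f x} * ENNReal.ofReal (t ^ (p - 1)) ≤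
        ∫⁻ t in Ioc (0 : ℝ) 1, μ univ := by
          refine setLIntegral_mono' measurableSet_Ioc fun t ht => ?_
          refine (mul_le_mul' (measure_mono (subset_univ _)) ?_).trans (mul_one _).le
          rw [← ENNReal.ofReal_one]
          exact ENNReal.ofReal_le_ofReal (Real.rpow_le_one ht.1.le ht.2 (by linarith))
      _ < ⊤ := by simp
  · have hi : IntegrableOn (fun t : ℝ => C * t ^ (p - 1 - q)) (Ioi 1) :=
      (integrableOn_Ioi_rpow_of_lt (by linarith) one_pos).const_mul C
    refine lt_of_le_of_lt (setLIntegral_mono' measurableSet_Ioi fun t ht => ?_)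
      hi.lintegral_lt_top
    have ht0 : (0 : ℝ) < t := zero_lt_one.trans ht
    refine (mul_le_mul_left (h t ht) _).trans (le_of_eq ?_)
    rw [← ENNReal.ofReal_mul' (Real.rpow_nonneg ht0.le _), mul_assoc, ← Real.rpow_add ht0]
    congr 3; ring

/-- A function whose tails are at least of order `t ^ (-q)` is not `q`-integrable. -/
lemma not_integrable_rpow_of_le_meas_lt (hf : ∀ x, 0 ≤ f x) (hm : AEMeasurable f μ) {c a : ℝ}
    (hc : 0 < c) (ha : 0 < a) (hq : 0 < q)
    (h : ∀ t : ℝ, a < t → ENNReal.ofReal (c * t ^ (-q)) ≤ μ {x | t < f x}) :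
    ¬ Integrable (fun x => f x ^ q) μ := by
  rw [← lintegral_ofReal_ne_top_iff_integrable (hm.pow_const q).aestronglyMeasurable
    (ae_of_all _ fun x => Real.rpow_nonneg (hf x) q),
    lintegral_rpow_eq_lintegral_meas_lt_mul μ (ae_of_all _ hf) hm hq, not_not,
    ENNReal.mul_eq_top]
  refine Or.inl ⟨by simpa using hq, ?_⟩
  have hi : ¬ IntegrableOn (fun t : ℝ => c * t⁻¹) (Ioi a) := fun hi => by
    refine not_integrableOn_Ioi_inv (a := a) ((hi.const_mul c⁻¹).congr (ae_of_all _ fun t => ?_))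
    exact inv_mul_cancel_left₀ hc.ne' _
  have htop : ∫⁻ t in Ioi a, ENNReal.ofReal (c * t⁻¹) = ⊤ := by
    by_contra hne
    refine hi ((lintegral_ofReal_ne_top_iff_integrable ?_ ?_).1 hne)
    · exact (measurable_inv.const_mul c).aestronglyMeasurable
    · filter_upwards [ae_restrict_mem measurableSet_Ioi] with t ht
      exact mul_nonneg hc.le (inv_nonneg.2 (ha.trans ht).le)
  rw [eq_top_iff, ← htop]
  refine le_trans ?_ (lintegral_mono_set (Ioi_subset_Ioi ha.le))
  refine setLIntegral_mono' measurableSet_Ioi fun t ht => ?_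
  have ht0 : (0 : ℝ) < t := ha.trans ht
  refine le_trans (le_of_eq ?_) (mul_le_mul_left (h t ht) _)
  rw [← ENNReal.ofReal_mul' (Real.rpow_nonneg ht0.le _), mul_assoc, ← Real.rpow_add ht0,
    ← Real.rpow_neg_one]
  congr 3; ring

end tails

lemma norm_row_le_frobNorm (X : Mat) (k : Fin 2) : ‖X k‖ ≤ frobNorm X := by
  refine (pi_norm_le_iff_of_nonneg (Real.sqrt_nonneg _)).2 fun i => Real.abs_le_sqrt ?_
  refine le_trans ?_ (Finset.single_le_sum (f := fun k => ∑ i, X k i ^ 2)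
    (fun _ _ => Finset.sum_nonneg fun _ _ => sq_nonneg _) (Finset.mem_univ k))
  exact Finset.single_le_sum (f := fun i => X k i ^ 2) (fun _ _ => sq_nonneg _)
    (Finset.mem_univ i)

lemma frobNorm_le {X : Mat} {c : ℝ} (hX : ∀ k, ‖X k‖ ≤ c) : frobNorm X ≤ 2 * c := by
  have hc : 0 ≤ c := (norm_nonneg _).trans (hX 0)
  refine Real.sqrt_le_iff.2 ⟨by positivity, ?_⟩
  have h : ∀ k i, X k i ^ 2 ≤ c ^ 2 := fun k i =>
    sq_le_sq' (neg_le_of_abs_le ((norm_le_pi_norm (X k) i).trans (hX k)))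
      (le_of_abs_le ((norm_le_pi_norm (X k) i).trans (hX k)))
  simp only [Fin.sum_univ_two]
  linarith [h 0 0, h 0 1, h 1 0, h 1 1]

lemma frobNorm_nonneg (X : Mat) : 0 ≤ frobNorm X := Real.sqrt_nonneg _

lemma rowNorm_le_frobNorm (X : Mat) : rowNorm X ≤ frobNorm X :=
  max_le (norm_row_le_frobNorm X 0) (norm_row_le_frobNorm X 1)

lemma GradBound.norm_le {ℓ : ℝ} (hℓ : 1 ≤ ℓ) {n : ℕ} {X : Mat} (h : GradBound ℓ (n + 2) X)
    (k : Fin 2) : ‖X k‖ ≤ 4 * ℓ * (n + 2) := by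
  obtain rfl | rfl : k = stepRow n ∨ k = stepRow n + 1 := by
    generalize stepRow n = j; revert k j; decide
  · exact h.1.trans (by gcongr; norm_num)
  · exact h.2

section

variable {Ω : Set Plane} {A : Mat} {K ℓ α κ : ℝ} {w : ℕ → Plane → Plane} {G : ℕ → Plane → Mat}
  {𝒮 : ℕ → Set (Set Plane)} {u : Plane → Plane} {H : Plane → Mat} {𝒮' : Set (Set Plane)}

lemma volume_tail_le_aux (h : IsScheme Ω A (rules K ℓ) (GradBound ℓ) α κ w G 𝒮)
    (hl : IsLimitOf Ω A (IsTerminal K) α κ w G u H 𝒮') (hK : 1 < K) (hℓ : 1 ≤ ℓ)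
    (hΩ : volume Ω ≠ ⊤) (n : ℕ) {t : ℝ} (ht : 8 * ℓ * (n + 2) ≤ t) :
    volume {x ∈ Ω | t < frobNorm (H x)} ≤
      ENNReal.ofReal (8 * ((n : ℝ) + 1) ^ (-critExp K)) * volume Ω := by
  refine le_trans (measure_mono_ae ?_) (h.volume_not_isTerminal_le hK hΩ n)
  have hnull : ∀ᵐ x, x ∉ Ω \ ⋃₀ 𝒮 (n + 2) :=
    measure_eq_zero_iff_ae_notMem.1 (h.stage (n + 2)).decomp.null
  filter_upwards [hl.grad_eq n, hnull] with x hx hx' hxt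
  refine ⟨hxt.1, fun hT => ?_⟩
  have hxS : x ∈ ⋃₀ 𝒮 (n + 2) := by_contra fun hxS => hx' ⟨hxt.1, hxS⟩
  obtain ⟨V, hV, hxV⟩ := hxS
  have h1 := hxt.2
  rw [hx fun _ => hT] at h1
  have h2 := frobNorm_le fun k => ((h.stage (n + 2)).pred hV hxV).norm_le hℓ k
  linarith

lemma volume_tail_le (h : IsScheme Ω A (rules K ℓ) (GradBound ℓ) α κ w G 𝒮)
    (hl : IsLimitOf Ω A (IsTerminal K) α κ w G u H 𝒮') (hK : 1 < K) (hℓ : 1 ≤ ℓ)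
    (hΩ : volume Ω ≠ ⊤) {t : ℝ} (ht : ℓ < t) :
    volume {x ∈ Ω | t < frobNorm (H x)} ≤
      ENNReal.ofReal (4608 * (ℓ / t) ^ critExp K) * volume Ω := by
  have hq := critExp_mem hK
  have ht0 : 0 < t := by linarith
  have hℓ0 : 0 < ℓ := by linarith
  have hpow : ∀ {c : ℝ}, 1 ≤ c → c ^ critExp K ≤ c ^ 2 := fun hc => by
    rw [← Real.rpow_natCast]
    exact Real.rpow_le_rpow_of_exponent_le hc (by exact_mod_cast hq.2.le)
  rcases lt_or_ge t (16 * ℓ) with h16 | h16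
  · refine le_trans (measure_mono fun x hx => hx.1) ((one_mul _).symm.le.trans ?_)
    rw [← ENNReal.ofReal_one]
    gcongr
    have h1 : (1 : ℝ) ≤ 16 ^ critExp K * (ℓ / t) ^ critExp K := by
      rw [← Real.mul_rpow (by norm_num) (by positivity)]
      refine Real.one_le_rpow ?_ (by linarith [hq.1])
      rw [← mul_div_assoc, le_div_iff₀ ht0]
      linarith
    have h2 := hpow (c := 16) (by norm_num)
    have h3 : 0 ≤ (ℓ / t) ^ critExp K := by positivity
    nlinarith
  · have hfl : 2 ≤ ⌊t / (8 * ℓ)⌋₊ := by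
      apply Nat.le_floor
      rw [le_div_iff₀ (by positivity)]
      push_cast
      linarith
    obtain ⟨n, hn⟩ := Nat.exists_eq_add_of_le' hfl
    have h1 : ((n : ℝ) + 2) ≤ t / (8 * ℓ) := by
      have := Nat.floor_le (a := t / (8 * ℓ)) (by positivity)
      rw [hn] at this
      exact_mod_cast this
    have h2 : t / (8 * ℓ) < (n : ℝ) + 3 := by
      have := Nat.lt_floor_add_one (t / (8 * ℓ))
      rw [hn] at this
      push_cast at this
      linarith
    refine (volume_tail_le_aux h hl hK hℓ hΩ n (t := t) ?_).trans ?_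
    · rw [le_div_iff₀ (by positivity)] at h1
      linarith
    refine mul_le_mul_left (ENNReal.ofReal_le_ofReal ?_) _
    have hn0 : (0 : ℝ) ≤ n := n.cast_nonneg
    have h3 : ((n : ℝ) + 1)⁻¹ ≤ 24 * (ℓ / t) := by
      rw [inv_le_iff_one_le_mul₀ (by positivity)]
      rw [div_lt_iff₀ (by positivity)] at h2
      rw [← mul_div_assoc, div_mul_eq_mul_div, le_div_iff₀ ht0]
      nlinarith
    rw [Real.rpow_neg (by positivity), ← Real.inv_rpow (by positivity)]
    calc 8 * ((n : ℝ) + 1)⁻¹ ^ critExp K ≤ 8 * (24 * (ℓ / t)) ^ critExp K := by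
          gcongr; linarith [hq.1]
      _ = 8 * (24 ^ critExp K * (ℓ / t) ^ critExp K) := by
          rw [Real.mul_rpow (by norm_num) (by positivity)]
      _ ≤ 8 * (24 ^ 2 * (ℓ / t) ^ critExp K) := by gcongr; exact hpow (by norm_num)
      _ = _ := by ring

lemma volume_tail_ge (h : IsScheme Ω A (rules K ℓ) (GradBound ℓ) α κ w G 𝒮)
    (hl : IsLimitOf Ω A (IsTerminal K) α κ w G u H 𝒮') (hK : 1 < K) (hℓ : 1 ≤ ℓ)
    (hΩ : IsOpen Ω) {t : ℝ} (ht : ℓ < t) :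
    ENNReal.ofReal (1 / 32000 * (ℓ / t) ^ critExp K) * volume Ω ≤
      volume {x ∈ Ω | t < frobNorm (H x)} := by
  have hq := critExp_mem hK
  have ht0 : 0 < t := by linarith
  have hℓ0 : 0 < ℓ := by linarith
  have htℓ : 1 < t / ℓ := (one_lt_div hℓ0).2 ht
  set n := ⌈t / ℓ⌉₊
  have h1 : t / ℓ ≤ n := Nat.le_ceil _
  have h2 : (n : ℝ) < t / ℓ + 1 := Nat.ceil_lt_add_one (by positivity)
  have hn0 : (0 : ℝ) < n := by linarith
  let F : ℕ → Set Plane := fun k => {x | rowNorm (H x) = (k + 2) * ℓ}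
  have hFm : ∀ k, NullMeasurableSet (F k) (volume.restrict Ω) := fun k =>
    (hl.aemeasurable_comp rowNorm).nullMeasurableSet_preimage (measurableSet_singleton _)
  have hFd : Pairwise (Function.onFun Disjoint F) := fun j k hjk =>
    disjoint_left.2 fun x hj hk => hjk (by
      have := mul_right_cancel₀ hℓ0.ne' (hj.symm.trans hk)
      exact_mod_cast add_right_cancel this)
  have hFv : ∀ k, k ∈ Finset.Ico n (2 * n) → ENNReal.ofReal
      (1 / 64 * ((5 * n : ℝ)⁻¹ * (5 * n : ℝ) ^ (-critExp K))) * volume Ω ≤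
      volume.restrict Ω (F k) := by
    intro k hk
    have hk' : (k : ℝ) + 1 ≤ 2 * n := by exact_mod_cast (Finset.mem_Ico.1 hk).2
    have hn1 : (1 : ℝ) ≤ n := by linarith
    have hk4 : (k : ℝ) + 4 ≤ 5 * n := by linarith
    calc _ ≤ ENNReal.ofReal (1 / 64 * (((k : ℝ) + 4)⁻¹ * ((k : ℝ) + 4) ^ (-critExp K))) *
          volume Ω := by
          refine mul_le_mul_left (ENNReal.ofReal_le_ofReal (mul_le_mul_of_nonneg_left
            (mul_le_mul (inv_anti₀ (by positivity) hk4) ?_ (by positivity) (by positivity))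
            (by norm_num))) _
          exact Real.rpow_le_rpow_of_nonpos (by positivity) hk4 (by linarith [hq.1])
      _ ≤ _ := h.volume_terminal_ge hK hℓ k
      _ ≤ volume (F k ∩ Ω) := by
          refine measure_mono_ae ?_
          filter_upwards [hl.grad_eq (k + 1)] with x hx hx'
          refine ⟨?_, hx'.1⟩
          change rowNorm (H x) = (k + 2) * ℓ
          rw [hx fun _ => hx'.2.1]
          exact hx'.2.2
      _ = _ := (Measure.restrict_apply' hΩ.measurableSet).symm
  calc ENNReal.ofReal (1 / 32000 * (ℓ / t) ^ critExp K) * volume Ω ≤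
      ENNReal.ofReal (n * (1 / 64 * ((5 * n : ℝ)⁻¹ * (5 * n : ℝ) ^ (-critExp K)))) * volume Ω := by
        refine mul_le_mul_left (ENNReal.ofReal_le_ofReal ?_) _
        have h10 : (10 : ℝ) ^ critExp K ≤ 100 := by
          calc (10 : ℝ) ^ critExp K ≤ 10 ^ (2 : ℝ) :=
                Real.rpow_le_rpow_of_exponent_le (by norm_num) hq.2.le
            _ = 100 := by norm_num
        have e1 : n * (1 / 64 * ((5 * n : ℝ)⁻¹ * (5 * n : ℝ) ^ (-critExp K))) =
            1 / 320 * (5 * n : ℝ) ^ (-critExp K) := by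
          field_simp; norm_num
        have e2 : (10 * (t / ℓ)) ^ (-critExp K) = (10 ^ critExp K)⁻¹ * (ℓ / t) ^ critExp K := by
          rw [Real.mul_rpow (by norm_num) (by positivity), Real.rpow_neg (by norm_num),
            Real.rpow_neg (by positivity), ← Real.inv_rpow (x := t / ℓ) (by positivity), inv_div]
        calc 1 / 32000 * (ℓ / t) ^ critExp K = 1 / 320 * (100⁻¹ * (ℓ / t) ^ critExp K) := by ring
          _ ≤ 1 / 320 * ((10 ^ critExp K)⁻¹ * (ℓ / t) ^ critExp K) := by gcongr
          _ = 1 / 320 * (10 * (t / ℓ)) ^ (-critExp K) := by rw [e2]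
          _ ≤ 1 / 320 * (5 * n : ℝ) ^ (-critExp K) := by
            gcongr 1 / 320 * ?_
            exact Real.rpow_le_rpow_of_nonpos (by positivity) (by linarith) (by linarith [hq.1])
          _ = _ := e1.symm
    _ = ∑ k ∈ Finset.Ico n (2 * n), ENNReal.ofReal
        (1 / 64 * ((5 * n : ℝ)⁻¹ * (5 * n : ℝ) ^ (-critExp K))) * volume Ω := by
        rw [Finset.sum_const, Nat.card_Ico, ENNReal.ofReal_mul (by positivity),
          ENNReal.ofReal_natCast, nsmul_eq_mul, mul_assoc, two_mul, Nat.add_sub_cancel]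
    _ ≤ ∑ k ∈ Finset.Ico n (2 * n), volume.restrict Ω (F k) := Finset.sum_le_sum hFv
    _ = volume.restrict Ω (⋃ k ∈ Finset.Ico n (2 * n), F k) :=
        (measure_biUnion_finset₀ (fun j _ k _ hjk => (hFd hjk).aedisjoint) fun k _ => hFm k).symm
    _ = volume ((⋃ k ∈ Finset.Ico n (2 * n), F k) ∩ Ω) :=
        Measure.restrict_apply' hΩ.measurableSet
    _ ≤ _ := by
        refine measure_mono fun x hx => ⟨hx.2, ?_⟩
        obtain ⟨k, hk, hxk⟩ := mem_iUnion₂.1 hx.1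
        refine lt_of_lt_of_le ?_ (rowNorm_le_frobNorm (H x))
        have hk' : (n : ℝ) ≤ k := by exact_mod_cast (Finset.mem_Ico.1 hk).1
        have hxk' : rowNorm (H x) = (k + 2) * ℓ := hxk
        rw [hxk']
        calc t = t / ℓ * ℓ := (div_mul_cancel₀ _ hℓ0.ne').symm
          _ < (k + 2) * ℓ := by gcongr; linarith

end

lemma lmap_apply (A : Mat) (b x : Plane) (k : Fin 2) : lmap A b x k = aff (A k) (b k) x := rfl

lemma continuous_lmap (A : Mat) (b : Plane) : Continuous (lmap A b) :=
  continuous_pi fun k => continuous_aff (A k) (b k)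

lemma dist_lmap_le (A : Mat) (b x y : Plane) :
    dist (lmap A b x) (lmap A b y) ≤ 2 * frobNorm A * dist x y := by
  have hA := frobNorm_nonneg A
  refine (dist_pi_le_iff (by positivity)).2 fun k => ?_
  rw [Real.dist_eq]
  exact (aff_sub (A k) (b k) x y).trans (by gcongr; exact norm_row_le_frobNorm A k)

section holder

variable {α β κ : ℝ} {v : Plane → Plane}

/-- A bounded `β`-Hölder map is `α`-Hölder for all `α ≤ β`. -/
lemma dist_le_of_holder (hα : 0 ≤ α) (hαβ : α ≤ β) (hv : ∀ x, ‖v x‖ ≤ κ)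
    (hh : ∀ x y, ‖v x - v y‖ ≤ κ * dist x y ^ β) (x y : Plane) :
    dist (v x) (v y) ≤ 2 * κ * dist x y ^ α := by
  have hκ : 0 ≤ κ := (norm_nonneg _).trans (hv 0)
  rw [dist_eq_norm]
  rcases le_or_gt 1 (dist x y) with h | h
  · calc ‖v x - v y‖ ≤ κ + κ := (norm_sub_le _ _).trans (add_le_add (hv x) (hv y))
      _ = 2 * κ * 1 := by ring
      _ ≤ _ := by gcongr; exact Real.one_le_rpow h hα
  · rcases eq_or_ne x y with rfl | hxy
    · rw [sub_self, norm_zero]; positivity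
    · calc ‖v x - v y‖ ≤ κ * dist x y ^ β := hh x y
        _ ≤ κ * dist x y ^ α := mul_le_mul_of_nonneg_left
            (Real.rpow_le_rpow_of_exponent_ge (dist_pos.2 hxy) h.le hαβ) hκ
        _ ≤ 2 * κ * dist x y ^ α := by gcongr; linarith

lemma holderNorm_le {c : ℝ} (hv : ∀ x, ‖v x‖ ≤ κ)
    (hh : ∀ x y, dist (v x) (v y) ≤ c * dist x y ^ α) (hc : 0 ≤ c) (S : Set Plane) :
    holderNorm α S v ≤ κ + c := by
  have hκ : 0 ≤ κ := (norm_nonneg _).trans (hv 0)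
  refine add_le_add (Real.sSup_le ?_ hκ) (Real.sSup_le ?_ hc)
  · rintro _ ⟨x, _, rfl⟩
    exact hv x
  · rintro _ ⟨x, _, y, _, hxy, rfl⟩
    exact (div_le_iff₀ (Real.rpow_pos_of_pos (dist_pos.2 hxy) α)).2 (hh x y)

lemma memHolder_lmap_add {c : ℝ} (hα : α ∈ Ico (0 : ℝ) 1) (hc : Continuous v)
    (hh : ∀ x y, dist (v x) (v y) ≤ c * dist x y ^ α) (A : Mat) (b : Plane) {S : Set Plane}
    (hS : Bornology.IsBounded S) : MemHolder α S fun x => lmap A b x + v x := by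
  obtain ⟨D, hD⟩ := Metric.isBounded_iff.1 hS
  have hA := frobNorm_nonneg A
  refine ⟨((continuous_lmap A b).add hc).continuousOn,
    2 * frobNorm A * D ^ (1 - α) + c, fun x hx y hy => ?_⟩
  have hd : dist x y = dist x y ^ (1 - α) * dist x y ^ α := by
    rw [← Real.rpow_add_of_nonneg dist_nonneg (by linarith [hα.2]) hα.1, sub_add_cancel,
      Real.rpow_one]
  calc dist (lmap A b x + v x) (lmap A b y + v y) ≤ 2 * frobNorm A * dist x y + c * dist x y ^ α :=
        (dist_add_add_le _ _ _ _).trans (add_le_add (dist_lmap_le A b x y) (hh x y))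
    _ = 2 * frobNorm A * (dist x y ^ (1 - α) * dist x y ^ α) + c * dist x y ^ α := by rw [← hd]
    _ ≤ 2 * frobNorm A * (D ^ (1 - α) * dist x y ^ α) + c * dist x y ^ α := by
        have := Real.rpow_le_rpow dist_nonneg (hD hx hy) (sub_nonneg.2 hα.2.le)
        gcongr
    _ = _ := by ring

end holder

lemma isWeakGrad_lmap (A : Mat) (b : Plane) (k : Fin 2) :
    IsWeakGrad (fun x => lmap A b x k) fun _ => A k := by
  refine isWeakGrad_of_lipschitz (K := (2 * ‖A k‖).toNNReal) (LipschitzWith.of_dist_le_mul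
    fun x y => ?_) fun i => ae_of_all _ fun x => lineDeriv_aff (A k) (b k) x i
  rw [Real.dist_eq, Real.coe_toNNReal _ (by positivity)]
  exact aff_sub (A k) (b k) x y

lemma hasWeakGradientOn_lmap_add {Ω : Set Plane} (hΩ : IsRegularDomain Ω) {A : Mat} {b : Plane}
    {u : Plane → Plane} {H : Plane → Mat} (hu : Continuous u)
    (hH : ∀ k i, IntegrableOn (fun x => H x k i) Ω)
    (hw : ∀ k, IsWeakGrad (fun x => u x k) fun x => H x k - A k) :
    HasWeakGradientOn (fun x => lmap A b x + u x) H Ω where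
  integrable := ((((continuous_lmap A b).add hu).continuousOn).integrableOn_compact
    hΩ.2.1.isCompact_closure).mono_set subset_closure
  integrable_grad := hH
  parts φ hφ hφ' hs k i := by
    have hφ1 : ContDiff ℝ 1 φ := by exact_mod_cast hφ 1
    have hd : Continuous fun x => fderiv ℝ φ x (Pi.single i 1) :=
      (hφ1.continuous_fderiv (by simp)).clm_apply continuous_const
    have hd' : HasCompactSupport fun x => fderiv ℝ φ x (Pi.single i 1) :=
      (hφ'.fderiv ℝ).comp_left (g := fun L : Plane →L[ℝ] ℝ => L (Pi.single i 1)) (by simp)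
    have hoff : ∀ x ∉ Ω, φ x = 0 := fun x hx => image_eq_zero_of_notMem_tsupport fun h => hx (hs h)
    have hoff' : ∀ x ∉ Ω, fderiv ℝ φ x (Pi.single i 1) = 0 := fun x hx => by
      rw [image_eq_zero_of_notMem_tsupport (f := fderiv ℝ φ)
        fun h => hx (hs (tsupport_fderiv_subset ℝ h))]
      rfl
    have hci : ∀ {f g : Plane → ℝ}, Continuous f → Continuous g → HasCompactSupport g →
        Integrable fun x => f x * g x := fun hf hg hg' =>
      (hf.mul hg).integrable_of_hasCompactSupport hg'.mul_left
    have hHφ : Integrable fun x => H x k i * φ x := by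
      refine (integrableOn_iff_integrable_of_support_subset (s := Ω) ?_).1 ?_
      · exact fun x hx => by_contra fun h => hx (by simp [hoff x h])
      · obtain ⟨C, hC⟩ := hφ'.exists_bound_of_continuous hφ1.continuous
        exact (hH k i).mul_bdd hφ1.continuous.aestronglyMeasurable (ae_of_all _ hC)
    have hAφ : Integrable fun x => A k i * φ x := hci continuous_const hφ1.continuous hφ'
    have hl : Continuous fun x => lmap A b x k := (continuous_apply k).comp (continuous_lmap A b)
    have hu' : Continuous fun x => u x k := (continuous_apply k).comp hu
    have h1 := hw k φ hφ hφ' i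
    have h2 := isWeakGrad_lmap A b k φ hφ hφ' i
    rw [setIntegral_eq_integral_of_forall_compl_eq_zero fun x hx => by rw [hoff' x hx, mul_zero],
      setIntegral_eq_integral_of_forall_compl_eq_zero fun x hx => by rw [hoff x hx, mul_zero]]
    simp only [Pi.add_apply, add_mul, Pi.sub_apply, sub_mul] at h1 ⊢
    rw [integral_add (hci hl hd hd') (hci hu' hd hd'), h1, h2, integral_sub hHφ hAφ]
    ring

lemma tendsto_zero_of_le_rpow {f : ℕ → ENNReal} {c s : ℝ} {C : ENNReal} (hs : 0 < s)
    (hC : C ≠ ⊤) (h : ∀ n, f n ≤ ENNReal.ofReal (c * ((n : ℝ) + 1) ^ (-s)) * C) :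
    Tendsto f atTop (𝓝 0) := by
  have h1 : Tendsto (fun n : ℕ => c * ((n : ℝ) + 1) ^ (-s)) atTop (𝓝 (c * 0)) :=
    ((tendsto_rpow_neg_atTop hs).comp
      (tendsto_natCast_atTop_atTop.atTop_add tendsto_const_nhds)).const_mul c
  have h2 := ENNReal.Tendsto.mul_const (b := C) (ENNReal.tendsto_ofReal h1) (Or.inr hC)
  rw [mul_zero, ENNReal.ofReal_zero, zero_mul] at h2
  exact tendsto_of_tendsto_of_tendsto_of_le_of_le tendsto_const_nhds h2 (fun _ => bot_le) h

lemma one_add_rpow_le {a q : ℝ} (ha : 0 ≤ a) (hq : q ∈ Ioo (1 : ℝ) 2) :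
    (1 + a) ^ q ≤ 4 * (1 + a ^ q) := by
  have hq0 : 0 ≤ q := by linarith [hq.1]
  have h0 : 0 ≤ a ^ q := by positivity
  have h2 : (2 : ℝ) ^ q ≤ 4 := by
    calc (2 : ℝ) ^ q ≤ 2 ^ (2 : ℝ) := Real.rpow_le_rpow_of_exponent_le (by norm_num) hq.2.le
      _ = 4 := by norm_num
  rcases le_total a 1 with h | h
  · calc (1 + a) ^ q ≤ 2 ^ q := Real.rpow_le_rpow (by positivity) (by linarith) hq0
      _ ≤ 4 * (1 + a ^ q) := by linarith
  · calc (1 + a) ^ q ≤ (2 * a) ^ q := Real.rpow_le_rpow (by positivity) (by linarith) hq0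
      _ = 2 ^ q * a ^ q := Real.mul_rpow (by norm_num) ha
      _ ≤ 4 * a ^ q := by gcongr
      _ ≤ _ := by linarith

lemma one_add_rpow_ge {a q : ℝ} (ha : 0 ≤ a) (hq : 0 ≤ q) :
    1 + a ^ q ≤ 2 * (1 + a) ^ q := by
  have h1 : 1 ≤ (1 + a) ^ q := Real.one_le_rpow (by linarith) hq
  have h2 : a ^ q ≤ (1 + a) ^ q := Real.rpow_le_rpow ha (by linarith) hq
  linarith

lemma exists_isScheme_isLimitOf {K : ℝ} (hK : 1 < K) {Ω : Set Plane} (hΩ : IsRegularDomain Ω)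
    (A : Mat) {α κ : ℝ} (hα : α ∈ Ioo (0 : ℝ) 1) (hκ : 0 < κ) :
    ∃ w G 𝒮 u H 𝒮',
      IsScheme Ω A (rules K (1 + frobNorm A)) (GradBound (1 + frobNorm A)) α κ w G 𝒮 ∧
      IsLimitOf Ω A (IsTerminal K) α κ w G u H 𝒮' ∧
      ((∀ k i, IntegrableOn (fun x => H x k i) Ω) →
        ∀ k, IsWeakGrad (fun x => u x k) fun x => H x k - A k) := by
  have hq := critExp_mem hK
  have hvol : volume Ω ≠ ⊤ := hΩ.2.1.measure_lt_top.ne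
  have hA := frobNorm_nonneg A
  have hrow : ∀ k, ‖A k‖ ≤ 1 + frobNorm A := fun k =>
    (norm_row_le_frobNorm A k).trans (by linarith)
  have hℓ : 1 ≤ 1 + frobNorm A := by linarith
  set ℓ := 1 + frobNorm A
  obtain ⟨w, G, 𝒮, hp⟩ := exists_isScheme (r := rules K ℓ) (P := GradBound ℓ) hΩ
    ⟨hrow 1, hrow 0⟩ (rules_mapsTo hK hℓ) hα hκ
  have hle := hp.volume_not_isTerminal_le hK hvol
  have hN := tendsto_zero_of_le_rpow (by linarith [hq.1]) hvol hle
  obtain ⟨u, H, 𝒮', hl⟩ := hp.exists_isLimitOf (fun _ _ => mainRule_of_isTerminal) hN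
  refine ⟨w, G, 𝒮, u, H, 𝒮', hp, hl, fun hint =>
    hl.isWeakGrad hΩ.1 hp.stage (fun n _ hX => hX.norm_le hℓ) hN ?_ hint⟩
  refine tendsto_zero_of_le_rpow (c := 64 * ℓ) (s := critExp K - 1) (by linarith [hq.1]) hvol
    fun n => ?_
  have hn : (0 : ℝ) < n + 1 := by positivity
  refine (mul_le_mul_right (hle n) _).trans ?_
  rw [← mul_assoc, ← ENNReal.ofReal_mul (by positivity)]
  refine mul_le_mul_left (ENNReal.ofReal_le_ofReal ?_) _
  rw [neg_sub, sub_eq_add_neg, Real.rpow_add hn, Real.rpow_one]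
  calc 4 * ℓ * (n + 2) * (8 * ((n : ℝ) + 1) ^ (-critExp K)) =
      32 * ℓ * (((n : ℝ) + 2) * ((n : ℝ) + 1) ^ (-critExp K)) := by ring
    _ ≤ 32 * ℓ * (2 * ((n : ℝ) + 1) * ((n : ℝ) + 1) ^ (-critExp K)) := by gcongr; linarith
    _ = _ := by ring

/-- The gradient of the limit is integrable below the critical exponent. -/
lemma IsLimitOf.integrableOn_rpow {K ℓ α κ : ℝ} {Ω : Set Plane} {A : Mat} {w : ℕ → Plane → Plane}
    {G : ℕ → Plane → Mat} {𝒮 : ℕ → Set (Set Plane)} {u : Plane → Plane} {H : Plane → Mat}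
    {𝒮' : Set (Set Plane)} (hl : IsLimitOf Ω A (IsTerminal K) α κ w G u H 𝒮')
    (h : IsScheme Ω A (rules K ℓ) (GradBound ℓ) α κ w G 𝒮) (hK : 1 < K) (hℓ : 1 ≤ ℓ)
    (hΩ : IsRegularDomain Ω) {p : ℝ} (hp : 1 ≤ p) (hpq : p < critExp K) :
    IntegrableOn (fun x => frobNorm (H x) ^ p) Ω := by
  have hq := critExp_mem hK
  have hvol : volume Ω < ⊤ := hΩ.2.1.measure_lt_top
  have : IsFiniteMeasure (volume.restrict Ω) := ⟨by simpa using hvol⟩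
  refine integrable_rpow_of_meas_lt_le (fun x => frobNorm_nonneg _) (hl.aemeasurable_comp frobNorm)
    (C := 4608 * ℓ ^ critExp K * (volume Ω).toReal) (fun t ht => ?_) hp hpq
  have ht0 : 0 < t := by linarith
  have h1 : volume {x ∈ Ω | t < frobNorm (H x)} ≤
      ENNReal.ofReal (4608 * (ℓ / t) ^ critExp K) * volume Ω := by
    rcases lt_or_ge ℓ t with htℓ | htℓ
    · exact volume_tail_le h hl hK hℓ hvol.ne htℓ
    · refine (measure_mono fun x hx => hx.1).trans ((one_mul _).symm.le.trans ?_)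
      rw [← ENNReal.ofReal_one]
      refine mul_le_mul_left (ENNReal.ofReal_le_ofReal ?_) _
      have : 1 ≤ (ℓ / t) ^ critExp K :=
        Real.one_le_rpow ((one_le_div ht0).2 htℓ) (by linarith [hq.1])
      linarith
  rw [Measure.restrict_apply' hΩ.1.measurableSet, inter_comm]
  refine h1.trans (le_of_eq ?_)
  rw [Real.div_rpow (by linarith) ht0.le, Real.rpow_neg ht0.le, ← ENNReal.ofReal_toReal hvol.ne,
    ← ENNReal.ofReal_mul (by positivity), ENNReal.toReal_ofReal ENNReal.toReal_nonneg]
  congr 1; ring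

/-- Theorem (optimal integrability for isotropic elliptic equations in the plane). -/
theorem elliptic_optimal_integrability (𝒦 : ℝ) (h𝒦 : 1 < 𝒦) :
    ∃ M : ℝ, 1 < M ∧
      ∀ (A : Matrix (Fin 2) (Fin 2) ℝ) (b : Fin 2 → ℝ),
      ∀ α ∈ Set.Ico (0:ℝ) 1, ∀ δ ∈ Set.Ioo (0:ℝ) 1,
      ∀ Ω : Set (Fin 2 → ℝ), IsRegularDomain Ω →
      ∃ (u : (Fin 2 → ℝ) → Fin 2 → ℝ) (G : (Fin 2 → ℝ) → Matrix (Fin 2) (Fin 2) ℝ),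
        IsPiecewiseAffineOn u Ω ∧ HasWeakGradientOn u G Ω ∧ MemHolder α (closure Ω) u ∧
        (∀ x ∈ frontier Ω, u x = lmap A b x) ∧
        holderNorm α (closure Ω) (fun x => u x - lmap A b x) < δ ∧
        (∀ᵐ x ∂(volume.restrict Ω), G x ∈ Eset 𝒦 ∪ Eset 𝒦⁻¹) ∧
        (∀ t : ℝ, 1 + frobNorm A < t →
          ENNReal.ofReal (M⁻¹ * (1 + frobNorm A ^ (2 * 𝒦 / (𝒦 + 1))) *
              t ^ (-(2 * 𝒦 / (𝒦 + 1)))) * volume Ω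
            ≤ volume {x ∈ Ω | t < frobNorm (G x)} ∧
          volume {x ∈ Ω | t < frobNorm (G x)}
            ≤ ENNReal.ofReal (M * (1 + frobNorm A ^ (2 * 𝒦 / (𝒦 + 1))) *
              t ^ (-(2 * 𝒦 / (𝒦 + 1)))) * volume Ω) ∧
        (∀ p : ℝ, 1 ≤ p → p < 2 * 𝒦 / (𝒦 + 1) →
          IntegrableOn (fun x => frobNorm (G x) ^ p) Ω volume) ∧
        ¬ IntegrableOn (fun x => frobNorm (G x) ^ (2 * 𝒦 / (𝒦 + 1))) Ω volume := by
  have hq := critExp_mem h𝒦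
  refine ⟨10 ^ 5, by norm_num, fun A b α hα δ hδ Ω hΩ => ?_⟩
  change ∃ u G, IsPiecewiseAffineOn u Ω ∧ HasWeakGradientOn u G Ω ∧ MemHolder α (closure Ω) u ∧
    (∀ x ∈ frontier Ω, u x = lmap A b x) ∧
    holderNorm α (closure Ω) (fun x => u x - lmap A b x) < δ ∧
    (∀ᵐ x ∂(volume.restrict Ω), G x ∈ Eset 𝒦 ∪ Eset 𝒦⁻¹) ∧
    (∀ t : ℝ, 1 + frobNorm A < t →
      ENNReal.ofReal ((10 ^ 5)⁻¹ * (1 + frobNorm A ^ critExp 𝒦) * t ^ (-critExp 𝒦)) * volume Ω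
        ≤ volume {x ∈ Ω | t < frobNorm (G x)} ∧
      volume {x ∈ Ω | t < frobNorm (G x)} ≤
        ENNReal.ofReal (10 ^ 5 * (1 + frobNorm A ^ critExp 𝒦) * t ^ (-critExp 𝒦)) * volume Ω) ∧
    (∀ p : ℝ, 1 ≤ p → p < critExp 𝒦 → IntegrableOn (fun x => frobNorm (G x) ^ p) Ω volume) ∧
    ¬ IntegrableOn (fun x => frobNorm (G x) ^ critExp 𝒦) Ω volume
  have hA := frobNorm_nonneg A
  have hq0 : 0 < critExp 𝒦 := by linarith [hq.1]
  have hβ : max α (1 / 2) ∈ Ioo (0 : ℝ) 1 :=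
    ⟨lt_max_of_lt_right (by norm_num), max_lt hα.2 (by norm_num)⟩
  have hδ0 : 0 < δ / 8 := by linarith [hδ.1]
  obtain ⟨w, G, 𝒮, u, H, 𝒮', hp, hl, hw⟩ := exists_isScheme_isLimitOf h𝒦 hΩ A hβ hδ0
  have hint : ∀ p : ℝ, 1 ≤ p → p < critExp 𝒦 →
      IntegrableOn (fun x => frobNorm (H x) ^ p) Ω volume := fun p h1 h2 =>
    hl.integrableOn_rpow hp h𝒦 (by linarith) hΩ h1 h2
  have hintH : ∀ k i, IntegrableOn (fun x => H x k i) Ω := fun k i => by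
    have h1 := hint 1 le_rfl hq.1
    simp only [Real.rpow_one] at h1
    exact h1.mono' (hl.aemeasurable_comp fun X => X k i).aestronglyMeasurable
      (ae_of_all _ fun x => (norm_le_pi_norm (H x k) i).trans (norm_row_le_frobNorm _ k))
  have hcont : Continuous u := continuous_pi fun k => continuous_of_holder hβ.1 fun x y =>
    (norm_le_pi_norm (u x - u y) k).trans (hl.holder x y)
  have hh := dist_le_of_holder hα.1 (le_max_left α (1 / 2)) hl.norm_le' hl.holder
  have hle : ∀ t : ℝ, 1 + frobNorm A < t → ((1 + frobNorm A) / t) ^ critExp 𝒦 =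
      (1 + frobNorm A) ^ critExp 𝒦 * t ^ (-critExp 𝒦) := fun t ht => by
    rw [Real.div_rpow (by linarith) (by linarith), Real.rpow_neg (by linarith), div_eq_mul_inv]
  have htail : ∀ t : ℝ, 1 + frobNorm A < t →
      ENNReal.ofReal ((10 ^ 5)⁻¹ * (1 + frobNorm A ^ critExp 𝒦) * t ^ (-critExp 𝒦)) * volume Ω
        ≤ volume {x ∈ Ω | t < frobNorm (H x)} := fun t ht => by
    refine le_trans (mul_le_mul_left (ENNReal.ofReal_le_ofReal ?_) _)
      (volume_tail_ge hp hl h𝒦 (by linarith) hΩ.1 ht)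
    rw [hle t ht, ← mul_assoc]
    refine mul_le_mul_of_nonneg_right ?_ (Real.rpow_nonneg (by linarith) _)
    have h0 : 0 ≤ (1 + frobNorm A) ^ critExp 𝒦 := by positivity
    linarith [one_add_rpow_ge hA hq0.le]
  refine ⟨fun x => lmap A b x + u x, H, ⟨𝒮', hl.decomp.countable, fun V hV =>
    ⟨hl.decomp.regular V hV, hl.decomp.subset V hV, ?_⟩, hl.decomp.disjoint, hl.decomp.null⟩,
    hasWeakGradientOn_lmap_add hΩ hcont hintH (hw hintH),
    memHolder_lmap_add hα hcont hh A b (Metric.isBounded_closure_iff.2 hΩ.2.1), fun x hx => ?_, ?_,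
    ?_, fun t ht => ⟨htail t ht, ?_⟩, hint, ?_⟩
  · obtain ⟨X, c, -, hX⟩ := hl.affine V hV
    refine ⟨X, b + c, fun x hx => ?_⟩
    ext k
    simp only [Pi.add_apply, (hX x hx).2, lmap_apply, aff_def, Matrix.sub_apply]
    ring
  · have hxΩ : x ∉ Ω := fun h => (hΩ.1.frontier_eq ▸ hx).2 h
    simp [hl.off x hxΩ]
  · simp only [add_sub_cancel_left]
    exact (holderNorm_le hl.norm_le' hh (by positivity) _).trans_lt (by linarith [hδ.1])
  · rw [ae_restrict_iff' hΩ.1.measurableSet]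
    filter_upwards [hl.ae_property] with x hx hxΩ
    exact (hx hxΩ).mem_Eset (by linarith)
  · refine (volume_tail_le hp hl h𝒦 (by linarith) hΩ.2.1.measure_lt_top.ne ht).trans
      (mul_le_mul_left (ENNReal.ofReal_le_ofReal ?_) _)
    rw [hle t ht, ← mul_assoc]
    refine mul_le_mul_of_nonneg_right ?_ (Real.rpow_nonneg (by linarith) _)
    have h0 : 0 ≤ frobNorm A ^ critExp 𝒦 := by positivity
    linarith [one_add_rpow_le hA hq]
  · have hpos : 0 < (volume Ω).toReal := ENNReal.toReal_pos
      (hΩ.1.measure_pos volume hΩ.2.2.1.nonempty).ne' hΩ.2.1.measure_lt_top.ne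
    refine not_integrable_rpow_of_le_meas_lt (fun x => frobNorm_nonneg _)
      (hl.aemeasurable_comp frobNorm) (a := 1 + frobNorm A)
      (c := (10 ^ 5)⁻¹ * (1 + frobNorm A ^ critExp 𝒦) * (volume Ω).toReal)
      (by positivity) (by positivity) hq0 fun t ht => ?_
    have ht0 : 0 < t := by linarith
    rw [Measure.restrict_apply' hΩ.1.measurableSet, inter_comm]
    refine le_trans (le_of_eq ?_) (htail t ht)
    rw [mul_right_comm, ENNReal.ofReal_mul (by positivity),
      ENNReal.ofReal_toReal hΩ.2.1.measure_lt_top.ne]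

end Paper
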